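/- For every fixed integer k ≥ 1 there exists a constant d_k > 0 such that, if X₁,…,Xₙ are independent points uniformly distributed in the unit square [0,1]², P = {X₁,…,Xₙ}, and U_k is the number of unordered pairs of points of P that are useful order-k Delaunay edges but not useful order-i Delaunay edges for any i < k, then lim_{n→∞} E[U_k]/n = d_k. -/

import Mathlib

open EuclideanGeometry Set

noncomputable section

/-- Points of the Euclidean plane. -/
abbrev Pt : Type := EuclideanSpace ℝ (Fin 2)

noncomputable instance : DecidableEq Pt := Classical.decEq _

/-- `P` is in general position: no three (distinct) points collinear and
no four (distinct) points concyclic. -/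
def GenPos (P : Set Pt) : Prop :=
  (∀ u v w : Pt, u ∈ P → v ∈ P → w ∈ P → u ≠ v → u ≠ w → v ≠ w →
    ¬ Collinear ℝ ({u, v, w} : Set Pt)) ∧
  (∀ u v w z : Pt, u ∈ P → v ∈ P → w ∈ P → z ∈ P →
    u ≠ v → u ≠ w → u ≠ z → v ≠ w → v ≠ z → w ≠ z →
    ¬ EuclideanGeometry.Cospherical ({u, v, w, z} : Set Pt))

/-- The (closed) triangle spanned by a finite set of points. -/
def triSet (t : Finset Pt) : Set Pt := convexHull ℝ (t : Set Pt)

/-- `T` is a triangulation of `P`: a finite set of triangles with vertices in `P`,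
every point of `P` is a vertex of some triangle, the interiors of the triangles are
pairwise disjoint, and their union is the convex hull of `P`. -/
def IsTriangulation (P : Set Pt) (T : Set (Finset Pt)) : Prop :=
  T.Finite ∧
  (∀ t ∈ T, t.card = 3 ∧ (t : Set Pt) ⊆ P) ∧
  (∀ p ∈ P, ∃ t ∈ T, p ∈ t) ∧
  (T.Pairwise fun t s => interior (triSet t) ∩ interior (triSet s) = ∅) ∧
  (⋃ t ∈ T, triSet t) = convexHull ℝ P

/-- The triangle `t` (with vertex set `t`) is order-`k` Delaunay with respect to `P`:
the open disk bounded by its circumcircle contains at most `k` points of `P`. -/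
def OrderKTri (P : Set Pt) (k : ℕ) (t : Finset Pt) : Prop :=
  ∃ z : Pt, ∃ r : ℝ, (∀ p ∈ t, dist p z = r) ∧ {p ∈ P | dist p z < r}.encard ≤ (k : ℕ∞)

/-- `T` is an order-`k` Delaunay triangulation of `P`. -/
def IsOrderDT (P : Set Pt) (k : ℕ) (T : Set (Finset Pt)) : Prop :=
  IsTriangulation P T ∧ ∀ t ∈ T, OrderKTri P k t

/-- `{u, v}` is an order-`k` Delaunay edge of `P`: some open disk having `u` and `v`
on its boundary circle contains at most `k` points of `P`. -/
def OrderKEdge (P : Set Pt) (k : ℕ) (u v : Pt) : Prop :=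
  ∃ z : Pt, ∃ r : ℝ, dist u z = r ∧ dist v z = r ∧ {p ∈ P | dist p z < r}.encard ≤ (k : ℕ∞)

/-- `{u, v}` is a useful order-`k` Delaunay edge of `P`: some order-`k` Delaunay
triangulation of `P` contains a triangle having `u` and `v` among its vertices
(i.e. having segment `uv` as a side). -/
def UsefulEdge (P : Set Pt) (k : ℕ) (u v : Pt) : Prop :=
  ∃ T, IsOrderDT P k T ∧ ∃ t ∈ T, u ∈ t ∧ v ∈ t

/-- `{u, v}` is a Delaunay edge: it is an edge of the (unique) order-0 Delaunay
triangulation of `P`. -/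
def DelaunayEdge (P : Set Pt) (u v : Pt) : Prop := UsefulEdge P 0 u v

/-- `p` lies strictly to the left of the directed line from `v` to `u`, i.e. the
triple `v, u, p` makes a counterclockwise turn. -/
def ccw (v u p : Pt) : Prop :=
  0 < (u 0 - v 0) * (p 1 - v 1) - (u 1 - v 1) * (p 0 - v 0)


section Probability

open MeasureTheory Filter Real

/-- The unit square `[0,1]²`. -/
def unitSq : Set Pt := {p : Pt | p 0 ∈ Set.Icc (0 : ℝ) 1 ∧ p 1 ∈ Set.Icc (0 : ℝ) 1}

/-- The uniform (probability) distribution on the unit square. -/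
noncomputable def unifSq : Measure Pt := volume.restrict unitSq

/-- The law of `n` independent points, each uniform in the unit square: the product
measure on configurations `Fin n → Pt`. -/
noncomputable def conf (n : ℕ) : Measure (Fin n → Pt) := Measure.pi fun _ => unifSq

/-- The constant `c₁ ≈ 0.23807`. -/
noncomputable def c1 : ℝ :=
  ∫ a in Set.Ioi (0 : ℝ), ∫ c in Set.Ioi a, ∫ b in Set.Ioi a,
    8 * π * a *
      (2 * a * c / Real.sqrt (c ^ 2 - a ^ 2) - 2 * c * Real.arcsin (a / c)) *
      (2 * a * b / Real.sqrt (b ^ 2 - a ^ 2) - 2 * b * Real.arcsin (a / b)) *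
      Real.exp (-π * b ^ 2 + b ^ 2 * Real.arcsin (a / b) - a * Real.sqrt (b ^ 2 - a ^ 2)
        - π * c ^ 2 + c ^ 2 * Real.arcsin (a / c) - a * Real.sqrt (c ^ 2 - a ^ 2))

/-- The constant `c₂ ≈ 0.40675`. -/
noncomputable def c2 : ℝ :=
  ∫ a in Set.Ioi (0 : ℝ), ∫ c in Set.Ioi a, ∫ b in Set.Ioi c,
    8 * π * a *
      (2 * π * c - 2 * c * Real.arcsin (a / c) + 2 * a * c / Real.sqrt (c ^ 2 - a ^ 2)) *
      (2 * a * b / Real.sqrt (b ^ 2 - a ^ 2) - 2 * b * Real.arcsin (a / b)) *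
      Real.exp (-π * b ^ 2 + b ^ 2 * Real.arcsin (a / b) - a * Real.sqrt (b ^ 2 - a ^ 2)
        - c ^ 2 * Real.arcsin (a / c) + a * Real.sqrt (c ^ 2 - a ^ 2))

end Probability
/-- The set of unordered pairs of points of `P` that are useful order-`k` Delaunay edges
but not useful order-`i` Delaunay edges for any `i < k`. -/
def usefulExactly (P : Set Pt) (k : ℕ) : Set (Finset Pt) :=
  {e | ∃ u v : Pt, u ∈ P ∧ v ∈ P ∧ u ≠ v ∧ e = {u, v} ∧
    UsefulEdge P k u v ∧ ∀ i < k, ¬ UsefulEdge P i u v}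

/-- `z` is a convex combination of the points of `A` with all weights positive. -/
def PosComb (A : Finset Pt) (z : Pt) : Prop :=
  ∃ w : Pt → ℝ, (∀ p ∈ A, 0 < w p) ∧ ∑ p ∈ A, w p = 1 ∧ ∑ p ∈ A, w p • p = z

/-- A monic quadratic function whose zero set is a circle (power of a point). -/
def IsPow (h : Pt → ℝ) : Prop :=
  ∃ α β γ : ℝ, ∀ x : Pt, h x = x 0 ^ 2 + x 1 ^ 2 + α * x 0 + β * x 1 + γ

/-- An affine function in coordinates. -/
def IsAff (g : Pt → ℝ) : Prop :=
  ∃ α β γ : ℝ, ∀ x : Pt, g x = α * x 0 + β * x 1 + γ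

lemma IsPow.sub {h₁ h₂ : Pt → ℝ} (H₁ : IsPow h₁) (H₂ : IsPow h₂) :
    IsAff (fun x => h₁ x - h₂ x) := by
  obtain ⟨a, b, c, H₁⟩ := H₁
  obtain ⟨a', b', c', H₂⟩ := H₂
  exact ⟨a - a', b - b', c - c', fun x => by simp only [H₁, H₂]; ring⟩

lemma IsPow.add_aff {h g : Pt → ℝ} (H₁ : IsPow h) (H₂ : IsAff g) :
    IsPow (fun x => h x + g x) := by
  obtain ⟨a, b, c, H₁⟩ := H₁
  obtain ⟨a', b', c', H₂⟩ := H₂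
  exact ⟨a + a', b + b', c + c', fun x => by simp only [H₁, H₂]; ring⟩

lemma IsAff.const_mul {g : Pt → ℝ} (c : ℝ) (H : IsAff g) : IsAff (fun x => c * g x) := by
  obtain ⟨a', b', c', H₂⟩ := H
  exact ⟨c * a', c * b', c * c', fun x => by simp only [H₂]; ring⟩

lemma isPow_dist (z : Pt) (ρ : ℝ) :
    IsPow (fun x => (x 0 - z 0) ^ 2 + (x 1 - z 1) ^ 2 - ρ) :=
  ⟨-2 * z 0, -2 * z 1, z 0 ^ 2 + z 1 ^ 2 - ρ, fun x => by ring⟩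

lemma dist_sq_eq (x z : Pt) : dist x z ^ 2 = (x 0 - z 0) ^ 2 + (x 1 - z 1) ^ 2 := by
  rw [EuclideanSpace.dist_eq, Real.sq_sqrt (by positivity)]
  simp [Fin.sum_univ_two, Real.dist_eq, sq_abs]

lemma IsPow.exists_circle {h : Pt → ℝ} (H : IsPow h) {a : Pt} (ha : h a = 0) :
    ∃ z : Pt, ∃ r : ℝ, 0 ≤ r ∧ ∀ x, h x = dist x z ^ 2 - r ^ 2 := by
  obtain ⟨α, β, γ, H⟩ := H
  refine ⟨!₂[-α / 2, -β / 2], Real.sqrt (α ^ 2 / 4 + β ^ 2 / 4 - γ), Real.sqrt_nonneg _, ?_⟩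
  have h0 : 0 ≤ α ^ 2 / 4 + β ^ 2 / 4 - γ := by
    have := H a
    rw [ha] at this
    nlinarith [sq_nonneg (a 0 + α / 2), sq_nonneg (a 1 + β / 2)]
  intro x
  rw [dist_sq_eq, Real.sq_sqrt h0, H]
  simp
  ring

lemma pt_sum_apply {ι : Type*} (A : Finset ι) (w : ι → ℝ) (f : ι → Pt) (i : Fin 2) :
    (∑ p ∈ A, w p • f p) i = ∑ p ∈ A, w p * f p i := by
  simp

lemma IsAff.sum {g : Pt → ℝ} (H : IsAff g) {ι : Type*} {A : Finset ι} {w : ι → ℝ} {f : ι → Pt}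
    {z : Pt} (h1 : ∑ p ∈ A, w p = 1) (h2 : ∑ p ∈ A, w p • f p = z) :
    g z = ∑ p ∈ A, w p * g (f p) := by
  obtain ⟨a, b, c, H⟩ := H
  rw [H, ← h2, pt_sum_apply, pt_sum_apply]
  simp only [H, mul_add, Finset.sum_add_distrib, Finset.mul_sum]
  rw [← Finset.sum_mul, h1, one_mul]
  congr 2 <;> (apply Finset.sum_congr rfl; intros; ring)

lemma IsAff.combo {g : Pt → ℝ} (H : IsAff g) {s t : ℝ} (h : s + t = 1) (x y : Pt) :
    g (s • x + t • y) = s * g x + t * g y := by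
  obtain ⟨a, b, c, H⟩ := H
  simp only [H, PiLp.add_apply, PiLp.smul_apply, smul_eq_mul]
  linear_combination (-c) * h

lemma IsAff.continuous {g : Pt → ℝ} (H : IsAff g) : Continuous g := by
  obtain ⟨a, b, c, H⟩ := H
  rw [show g = fun x => a * x 0 + b * x 1 + c from funext H]
  fun_prop

lemma IsPow.continuous {g : Pt → ℝ} (H : IsPow g) : Continuous g := by
  obtain ⟨a, b, c, H⟩ := H
  rw [show g = fun x => x 0 ^ 2 + x 1 ^ 2 + a * x 0 + b * x 1 + c from funext H]
  fun_prop

lemma PosComb.nonempty {A : Finset Pt} {z : Pt} (h : PosComb A z) : A.Nonempty := by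
  obtain ⟨w, -, h1, -⟩ := h
  by_contra hA
  rw [Finset.not_nonempty_iff_eq_empty] at hA
  simp [hA] at h1

lemma posComb_singleton (z : Pt) : PosComb {z} z :=
  ⟨fun _ => 1, by simp, by simp, by simp⟩

lemma PosComb.mem_hull {A : Finset Pt} {z : Pt} (h : PosComb A z) : z ∈ triSet A := by
  obtain ⟨w, h0, h1, h2⟩ := h
  rw [triSet, Finset.mem_convexHull']
  exact ⟨w, fun p hp => (h0 p hp).le, h1, h2⟩

lemma exists_posComb {t : Finset Pt} {x : Pt} (hx : x ∈ triSet t) :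
    ∃ A ⊆ t, PosComb A x := by
  rw [triSet, Finset.mem_convexHull'] at hx
  obtain ⟨w, h0, h1, h2⟩ := hx
  refine ⟨t.filter (fun p => w p ≠ 0), Finset.filter_subset _ _, w, ?_, ?_, ?_⟩
  · intro p hp
    rw [Finset.mem_filter] at hp
    exact lt_of_le_of_ne (h0 p hp.1) (Ne.symm hp.2)
  · rw [Finset.sum_filter_ne_zero, h1]
  · rw [← h2]
    apply Finset.sum_subset (Finset.filter_subset _ _)
    intro p hp hp'
    simp only [Finset.mem_filter, hp, true_and, not_not] at hp'
    simp [hp']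

lemma posComb_pair {a b z : Pt} (hab : a ≠ b) :
    PosComb {a, b} z ↔ z ∈ openSegment ℝ a b := by
  constructor
  · rintro ⟨w, h0, h1, h2⟩
    rw [Finset.sum_pair hab] at h1 h2
    exact ⟨w a, w b, h0 a (by simp), h0 b (by simp), h1, h2⟩
  · rintro ⟨s, t, hs, ht, hst, rfl⟩
    refine ⟨fun p => if p = a then s else t, ?_, ?_, ?_⟩
    · intro p hp
      dsimp
      split_ifs <;> assumption
    · rw [Finset.sum_pair hab]
      simp [hab.symm, hst]
    · rw [Finset.sum_pair hab]
      simp [hab.symm]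

lemma GenPos.affineIndependent {P : Set Pt} (hP : GenPos P) {C : Finset Pt} (hC : (C : Set Pt) ⊆ P)
    (h3 : C.card ≤ 3) : AffineIndependent ℝ ((↑) : C → Pt) := by
  have : C.card = 0 ∨ C.card = 1 ∨ C.card = 2 ∨ C.card = 3 := by omega
  rcases this with h | h | h | h
  · rw [Finset.card_eq_zero] at h
    subst h
    exact affineIndependent_of_subsingleton ℝ _
  · obtain ⟨a, rfl⟩ := Finset.card_eq_one.1 h
    have : Subsingleton ({a} : Finset Pt) := ⟨fun x y => by
      have hx := x.2
      have hy := y.2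
      rw [Finset.mem_singleton] at hx hy
      exact Subtype.ext (hx.trans hy.symm)⟩
    exact affineIndependent_of_subsingleton ℝ _
  · obtain ⟨a, b, hab, rfl⟩ := Finset.card_eq_two.1 h
    have h2 := (affineIndependent_of_ne ℝ hab).range
    have : Set.range ![a, b] = (({a, b} : Finset Pt) : Set Pt) := by
      ext x
      simp [Matrix.range_cons, or_comm]
    rw [this] at h2
    exact h2
  · obtain ⟨a, b, c, hab, hac, hbc, rfl⟩ := Finset.card_eq_three.1 h
    have := hP.1 a b c (hC (by simp)) (hC (by simp)) (hC (by simp)) hab hac hbc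
    rw [← affineIndependent_iff_not_collinear_set] at this
    have h2 := this.range
    have : Set.range ![a, b, c] = (({a, b, c} : Finset Pt) : Set Pt) := by
      ext x
      simp only [Matrix.range_cons, Matrix.range_empty]
      simp
      tauto
    rw [this] at h2
    exact h2

lemma posComb_unique {C A B : Finset Pt} (hC : AffineIndependent ℝ ((↑) : C → Pt))
    (hA : A ⊆ C) (hB : B ⊆ C) {z : Pt} (h1 : PosComb A z) (h2 : PosComb B z) : A = B := by
  obtain ⟨w, a0, a1, a2⟩ := h1
  obtain ⟨w', b0, b1, b2⟩ := h2
  let W : Pt → ℝ := fun p => (if p ∈ A then w p else 0) - (if p ∈ B then w' p else 0)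
  have key : ∀ p ∈ C, W p = 0 := by
    have := (affineIndependent_iff.1 hC) Finset.univ (fun p => W p) ?_ ?_
    · intro p hp
      exact this ⟨p, hp⟩ (Finset.mem_univ _)
    · rw [← Finset.attach_eq_univ, Finset.sum_attach C W]
      simp only [W, Finset.sum_sub_distrib, Finset.sum_ite_mem]
      rw [Finset.inter_eq_right.2 hA, Finset.inter_eq_right.2 hB, a1, b1, sub_self]
    · rw [← Finset.attach_eq_univ, Finset.sum_attach C (fun p => W p • p)]
      simp only [W, sub_smul, Finset.sum_sub_distrib, ite_smul, zero_smul, Finset.sum_ite_mem]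
      rw [Finset.inter_eq_right.2 hA, Finset.inter_eq_right.2 hB, a2, b2, sub_self]
  ext p
  constructor
  · intro hp
    by_contra hn
    have := key p (hA hp)
    simp only [W, hp, hn, if_true, if_false] at this
    linarith [a0 p hp]
  · intro hp
    by_contra hn
    have := key p (hB hp)
    simp only [W, hp, hn, if_true, if_false] at this
    linarith [b0 p hp]

/-- In general position, two faces carried by mutually empty circles and with a common
relative interior point coincide. -/
lemma GenPos.face_eq {P : Set Pt} (hP : GenPos P) {A B : Finset Pt} (hA : (A : Set Pt) ⊆ P)
    (hB : (B : Set Pt) ⊆ P) {h₁ h₂ : Pt → ℝ} (H₁ : IsPow h₁) (H₂ : IsPow h₂)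
    (hA1 : ∀ p ∈ A, h₁ p = 0) (hB1 : ∀ p ∈ B, 0 ≤ h₁ p)
    (hB2 : ∀ p ∈ B, h₂ p = 0) (hA2 : ∀ p ∈ A, 0 ≤ h₂ p) {z : Pt}
    (hzA : PosComb A z) (hzB : PosComb B z) : A = B := by
  have hg := H₁.sub H₂
  have hBz : ∀ p ∈ B, h₁ p = 0 := by
    obtain ⟨w, a0, a1, a2⟩ := hzA
    obtain ⟨w', b0, b1, b2⟩ := hzB
    have e1 := hg.sum a1 a2
    have e2 := hg.sum b1 b2
    have l1 : ∑ p ∈ A, w p * (h₁ p - h₂ p) ≤ 0 := Finset.sum_nonpos fun p hp => by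
      rw [hA1 p hp]
      nlinarith [a0 p hp, hA2 p hp]
    have l2 : ∀ p ∈ B, 0 ≤ w' p * (h₁ p - h₂ p) := fun p hp => by
      rw [hB2 p hp]
      nlinarith [b0 p hp, hB1 p hp]
    have l3 := Finset.sum_nonneg l2
    have l4 : ∑ p ∈ B, w' p * (h₁ p - h₂ p) = 0 := by
      linarith
    intro p hp
    have := (Finset.sum_eq_zero_iff_of_nonneg l2).1 l4 p hp
    rcases mul_eq_zero.1 this with h | h
    · exact absurd h (b0 p hp).ne'
    · rw [hB2 p hp, sub_zero] at h
      exact h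
  have hsub : ((A ∪ B : Finset Pt) : Set Pt) ⊆ P := by
    rw [Finset.coe_union]
    exact Set.union_subset hA hB
  have hall : ∀ p ∈ A ∪ B, h₁ p = 0 := by
    intro p hp
    rcases Finset.mem_union.1 hp with h | h
    · exact hA1 p h
    · exact hBz p h
  have hcard : (A ∪ B).card ≤ 3 := by
    by_contra hc
    obtain ⟨D, hD, hD4⟩ := Finset.exists_subset_card_eq (s := A ∪ B) (n := 4) (by omega)
    obtain ⟨a, b, c, d, hab, hac, had, hbc, hbd, hcd, rfl⟩ := Finset.card_eq_four.1 hD4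
    have ha := hD (show a ∈ _ by simp)
    have hb := hD (show b ∈ _ by simp)
    have hc := hD (show c ∈ _ by simp)
    have hd := hD (show d ∈ _ by simp)
    refine hP.2 a b c d (hsub ha) (hsub hb) (hsub hc) (hsub hd) hab hac had hbc hbd hcd ?_
    obtain ⟨z, r, hr, hz⟩ := H₁.exists_circle (hall a ha)
    have hdist : ∀ p ∈ A ∪ B, dist p z = r := fun p hp => by
      have h1 := hz p
      rw [hall p hp] at h1
      have : dist p z ^ 2 = r ^ 2 := by linarith
      exact (sq_eq_sq₀ dist_nonneg hr).1 this
    refine ⟨z, r, ?_⟩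
    intro p hp
    simp only [Set.mem_insert_iff, Set.mem_singleton_iff] at hp
    rcases hp with rfl | rfl | rfl | rfl <;> apply hdist <;> assumption
  exact posComb_unique (hP.affineIndependent hsub hcard) Finset.subset_union_left
    Finset.subset_union_right hzA hzB

lemma GenPos.mono {P Q : Set Pt} (hP : GenPos P) (h : Q ⊆ P) : GenPos Q :=
  ⟨fun u v w hu hv hw => hP.1 u v w (h hu) (h hv) (h hw),
    fun u v w z hu hv hw hz => hP.2 u v w z (h hu) (h hv) (h hw) (h hz)⟩

/-- Twice the signed area of the triangle `u v x`. -/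
def orient (u v x : Pt) : ℝ := (v 0 - u 0) * (x 1 - u 1) - (v 1 - u 1) * (x 0 - u 0)

/-- The power of `x` with respect to the circle with diameter `uv`. -/
def diamPow (u v x : Pt) : ℝ := (x 0 - u 0) * (x 0 - v 0) + (x 1 - u 1) * (x 1 - v 1)

lemma isAff_orient (u v : Pt) : IsAff (orient u v) :=
  ⟨-(v 1 - u 1), v 0 - u 0, -(v 0 - u 0) * u 1 + (v 1 - u 1) * u 0, fun x => by
    simp only [orient]; ring⟩

lemma isPow_diamPow (u v : Pt) : IsPow (diamPow u v) :=
  ⟨-u 0 - v 0, -u 1 - v 1, u 0 * v 0 + u 1 * v 1, fun x => by simp only [diamPow]; ring⟩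

/-- The pencil of circles through `u` and `v`. -/
def pencil (u v : Pt) (τ : ℝ) (x : Pt) : ℝ := diamPow u v x - τ * orient u v x

lemma isPow_pencil (u v : Pt) (τ : ℝ) : IsPow (pencil u v τ) := by
  have := (isPow_diamPow u v).add_aff ((isAff_orient u v).const_mul (-τ))
  convert this using 2
  simp only [pencil]
  ring

@[simp] lemma orient_left (u v : Pt) : orient u v u = 0 := by simp [orient]
@[simp] lemma orient_right (u v : Pt) : orient u v v = 0 := by simp only [orient]; ring
@[simp] lemma pencil_left (u v : Pt) (τ : ℝ) : pencil u v τ u = 0 := by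
  simp [pencil, diamPow]
@[simp] lemma pencil_right (u v : Pt) (τ : ℝ) : pencil u v τ v = 0 := by
  simp [pencil, diamPow]

lemma normSq_pos {u v : Pt} (h : u ≠ v) : 0 < (v 0 - u 0) ^ 2 + (v 1 - u 1) ^ 2 := by
  rw [← dist_sq_eq]
  exact pow_pos (dist_pos.2 h.symm) 2

lemma collinear_of_orient {u v x : Pt} (h : orient u v x = 0) (huv : u ≠ v) :
    ∃ t : ℝ, x = (1 - t) • u + t • v := by
  have hn := normSq_pos huv
  refine ⟨((x 0 - u 0) * (v 0 - u 0) + (x 1 - u 1) * (v 1 - u 1)) /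
    ((v 0 - u 0) ^ 2 + (v 1 - u 1) ^ 2), ?_⟩
  unfold orient at h
  ext i
  fin_cases i
  · simp
    field_simp
    linear_combination (-(v 1 - u 1)) * h
  · simp
    field_simp
    linear_combination (v 0 - u 0) * h

lemma orient_line (u v : Pt) (t : ℝ) : orient u v ((1 - t) • u + t • v) = 0 := by
  simp [orient]
  ring

lemma orient_swap (u v x : Pt) : orient v u x = -orient u v x := by
  simp only [orient]; ring

lemma orient_swap_right (u v x : Pt) : orient u x v = -orient u v x := by
  simp only [orient]; ring

lemma GenPos.orient_ne {P : Set Pt} (hP : GenPos P) {u v x : Pt} (hu : u ∈ P) (hv : v ∈ P)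
    (hx : x ∈ P) (h1 : u ≠ v) (h2 : u ≠ x) (h3 : v ≠ x) : orient u v x ≠ 0 := by
  intro h
  obtain ⟨t, rfl⟩ := collinear_of_orient h h1
  apply hP.1 _ _ _ hu hv hx h1 h2 h3
  rw [collinear_iff_of_mem (p₀ := u) (by simp)]
  refine ⟨v - u, ?_⟩
  intro p hp
  simp only [Set.mem_insert_iff, Set.mem_singleton_iff] at hp
  rcases hp with rfl | rfl | rfl
  · exact ⟨0, by simp⟩
  · exact ⟨1, by simp⟩
  · refine ⟨t, ?_⟩
    rw [vadd_eq_add]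
    module

lemma diamPow_line (u v : Pt) (t : ℝ) :
    diamPow u v ((1 - t) • u + t • v) = -(t * (1 - t)) * ((v 0 - u 0) ^ 2 + (v 1 - u 1) ^ 2) := by
  simp [diamPow]
  ring

lemma mem_openSegment_of {u v x : Pt} (huv : u ≠ v) (h : orient u v x = 0)
    (h2 : diamPow u v x < 0) : x ∈ openSegment ℝ u v := by
  obtain ⟨t, rfl⟩ := collinear_of_orient h huv
  rw [diamPow_line] at h2
  have hn := normSq_pos huv
  have : 0 < t * (1 - t) := by
    by_contra hc
    nlinarith
  have h1 : 0 < t := by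
    by_contra hc
    nlinarith
  exact ⟨1 - t, t, by nlinarith, h1, by ring, rfl⟩

lemma openSegment_orient {u v x : Pt} (h : x ∈ openSegment ℝ u v) : orient u v x = 0 := by
  obtain ⟨s, t, hs, ht, hst, rfl⟩ := h
  rw [show s = 1 - t by linarith]
  exact orient_line u v t

lemma openSegment_diamPow {u v x : Pt} (huv : u ≠ v) (h : x ∈ openSegment ℝ u v) :
    diamPow u v x < 0 := by
  obtain ⟨s, t, hs, ht, hst, rfl⟩ := h
  rw [show s = 1 - t by linarith, diamPow_line]
  have hn := normSq_pos huv
  have : 0 < t * (1 - t) := mul_pos ht (by linarith)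
  nlinarith

lemma tendsto_add_smul (x d : Pt) :
    Filter.Tendsto (fun t : ℝ => x + t • d) (nhdsWithin 0 (Set.Ioi 0)) (nhds x) := by
  have : Continuous (fun t : ℝ => x + t • d) := by fun_prop
  have h := this.tendsto 0
  simp only [zero_smul, add_zero] at h
  exact h.mono_left nhdsWithin_le_nhds

lemma dense_orient_ne {u v : Pt} (huv : u ≠ v) : Dense {x | orient u v x ≠ 0} := by
  intro x
  by_cases hx : orient u v x = 0
  · let d : Pt := !₂[-(v 1 - u 1), v 0 - u 0]
    refine mem_closure_of_tendsto (tendsto_add_smul x d) ?_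
    filter_upwards [self_mem_nhdsWithin] with t ht
    have h1 : orient u v (x + t • d) = t * ((v 0 - u 0) ^ 2 + (v 1 - u 1) ^ 2) := by
      simp [orient, d] at hx ⊢
      linear_combination hx
    change orient u v (x + t • d) ≠ 0
    rw [h1]
    exact (mul_pos ht (normSq_pos huv)).ne'
  · exact subset_closure hx

lemma isOpen_orient_ne (u v : Pt) : IsOpen {x | orient u v x ≠ 0} :=
  isOpen_ne_fun (isAff_orient u v).continuous continuous_const

section Triangle

variable {t : Finset Pt}

/-- The affine basis of the plane given by the vertices of a nondegenerate triangle. -/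
def triBasis (ht : AffineIndependent ℝ ((↑) : t → Pt)) (h3 : t.card = 3) : AffineBasis t ℝ Pt :=
  ⟨(↑), ht, by
    rw [ht.affineSpan_eq_top_iff_card_eq_finrank_add_one]
    simp [h3]⟩

lemma exists_bary (ht : AffineIndependent ℝ ((↑) : t → Pt)) (h3 : t.card = 3) (p : Pt) :
    ∃ β : Pt → ℝ, ∑ q ∈ t, β q = 1 ∧ ∑ q ∈ t, β q • q = p := by
  let b := triBasis ht h3
  let β : Pt → ℝ := fun q => if hq : q ∈ t then b.coord ⟨q, hq⟩ p else 0
  refine ⟨β, ?_, ?_⟩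
  · rw [← b.sum_coord_apply_eq_one p, ← Finset.sum_attach t β, Finset.attach_eq_univ]
    exact Finset.sum_congr rfl fun q _ => by simp [β]
  · rw [← Finset.sum_attach t (fun q => β q • q), Finset.attach_eq_univ]
    refine Eq.trans ?_ (b.linear_combination_coord_eq_self p)
    exact Finset.sum_congr rfl fun q _ => by simp [β, b, triBasis]; rfl

lemma interior_triSet (ht : AffineIndependent ℝ ((↑) : t → Pt)) (h3 : t.card = 3) :
    interior (triSet t) = {x | PosComb t x} := by
  let b := triBasis ht h3
  have hb : Set.range b = (t : Set Pt) := by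
    change Set.range ((↑) : t → Pt) = _
    simp
  have h := b.interior_convexHull
  rw [hb] at h
  rw [triSet, h]
  ext x
  constructor
  · intro hx
    let β : Pt → ℝ := fun q => if hq : q ∈ t then b.coord ⟨q, hq⟩ x else 0
    refine ⟨β, ?_, ?_, ?_⟩
    · intro p hp
      simp only [β, hp, dif_pos]
      exact hx ⟨p, hp⟩
    · rw [← b.sum_coord_apply_eq_one x, ← Finset.sum_attach t β, Finset.attach_eq_univ]
      exact Finset.sum_congr rfl fun q _ => by simp [β]
    · rw [← Finset.sum_attach t (fun q => β q • q), Finset.attach_eq_univ]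
      refine Eq.trans ?_ (b.linear_combination_coord_eq_self x)
      exact Finset.sum_congr rfl fun q _ => by simp [β, b, triBasis]; rfl
  · rintro ⟨w, h0, h1, h2⟩ i
    have e1 : ∑ j : t, w j = 1 := by
      rw [← h1, ← Finset.sum_attach t w, Finset.attach_eq_univ]
    have e2 : Finset.univ.affineCombination ℝ b (fun j : t => w j) = x := by
      rw [Finset.affineCombination_eq_linear_combination _ _ _ e1, ← h2,
        ← Finset.sum_attach t (fun q => w q • q), Finset.attach_eq_univ]
      rfl
    rw [← e2, b.coord_apply_combination_of_mem (Finset.mem_univ _) e1]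
    exact h0 _ i.2

lemma isCompact_triSet (t : Finset Pt) : IsCompact (triSet t) :=
  t.finite_toSet.isCompact_convexHull ℝ

lemma isClosed_triSet (t : Finset Pt) : IsClosed (triSet t) := (isCompact_triSet t).isClosed

lemma convex_triSet (t : Finset Pt) : Convex ℝ (triSet t) := convex_convexHull _ _

lemma closure_interior_triSet (ht : AffineIndependent ℝ ((↑) : t → Pt)) (h3 : t.card = 3) :
    closure (interior (triSet t)) = triSet t := by
  rw [(convex_triSet t).closure_interior_eq_closure_of_nonempty_interior ?_,
    (isClosed_triSet t).closure_eq]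
  rw [interior_triSet ht h3]
  refine ⟨∑ q ∈ t, (1 / 3 : ℝ) • q, fun _ => 1 / 3, fun p _ => by norm_num, ?_, rfl⟩
  rw [Finset.sum_const, h3]
  norm_num

/-- Exchange step: a point inside a triangle lies in a triangle obtained by replacing one
vertex by a given point. -/
lemma exists_exchange (ht : AffineIndependent ℝ ((↑) : t → Pt)) (h3 : t.card = 3) {x p : Pt}
    (hx : PosComb t x) (hp : p ∉ t) :
    ∃ a ∈ t, x ∈ triSet (insert p (t.erase a)) := by
  obtain ⟨β, b1, b2⟩ := exists_bary ht h3 p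
  obtain ⟨w, w0, w1, w2⟩ := hx
  have hne : (t.filter (fun q => 0 < β q)).Nonempty := by
    by_contra hc
    rw [Finset.not_nonempty_iff_eq_empty, Finset.filter_eq_empty_iff] at hc
    have : ∑ q ∈ t, β q ≤ 0 := Finset.sum_nonpos fun q hq => not_lt.1 (hc hq)
    linarith
  obtain ⟨a, ha, hmin⟩ := Finset.exists_min_image _ (fun q => w q / β q) hne
  rw [Finset.mem_filter] at ha
  refine ⟨a, ha.1, ?_⟩
  set ε := w a / β a with hε
  have hεpos : 0 < ε := div_pos (w0 a ha.1) ha.2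
  have hpe : p ∉ t.erase a := fun h => hp (Finset.mem_of_mem_erase h)
  rw [triSet, Finset.mem_convexHull']
  have hwa : w a - ε * β a = 0 := by
    rw [hε]
    field_simp [ha.2.ne']
    ring
  refine ⟨fun q => if q = p then ε else w q - ε * β q, ?_, ?_, ?_⟩
  · intro q hq
    dsimp
    split_ifs with h
    · exact hεpos.le
    · have hqt : q ∈ t := by
        rcases Finset.mem_insert.1 hq with h' | h'
        · exact absurd h' h
        · exact Finset.mem_of_mem_erase h'
      by_cases hb : 0 < β q
      · have := hmin q (Finset.mem_filter.2 ⟨hqt, hb⟩)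
        rw [le_div_iff₀ hb] at this
        linarith
      · nlinarith [w0 q hqt]
  · have e : ∑ q ∈ t.erase a, (if q = p then ε else w q - ε * β q) =
        ∑ q ∈ t, (w q - ε * β q) := by
      rw [← Finset.sum_erase t (f := fun q => w q - ε * β q) hwa]
      refine Finset.sum_congr rfl fun q hq => if_neg ?_
      rintro rfl
      exact hpe hq
    rw [Finset.sum_insert hpe, e, Finset.sum_sub_distrib, ← Finset.mul_sum, b1, w1]
    simp
  · have e : ∑ q ∈ t.erase a, (if q = p then ε else w q - ε * β q) • q =
        ∑ q ∈ t, (w q - ε * β q) • q := by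
      rw [← Finset.sum_erase t (f := fun q => (w q - ε * β q) • q) (a := a)
        (by simp only [hwa, zero_smul])]
      refine Finset.sum_congr rfl fun q hq => ?_
      rw [if_neg]
      rintro rfl
      exact hpe hq
    rw [Finset.sum_insert hpe, e]
    simp only [sub_smul, Finset.sum_sub_distrib, mul_smul]
    rw [← Finset.smul_sum, b2, w2]
    simp

end Triangle

lemma exists_isPow {P : Set Pt} (hP : GenPos P) {t : Finset Pt} (ht : (t : Set Pt) ⊆ P)
    (h3 : t.card = 3) : ∃ h, IsPow h ∧ ∀ p ∈ t, h p = 0 := by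
  obtain ⟨a, b, c, hab, hac, hbc, rfl⟩ := Finset.card_eq_three.1 h3
  have ho := hP.orient_ne (ht (by simp : a ∈ _)) (ht (by simp : b ∈ _)) (ht (by simp : c ∈ _))
    hab hac hbc
  refine ⟨pencil a b (diamPow a b c / orient a b c), isPow_pencil _ _ _, ?_⟩
  intro p hp
  simp only [Finset.mem_insert, Finset.mem_singleton] at hp
  rcases hp with rfl | rfl | rfl
  · simp
  · simp
  · simp only [pencil]
    field_simp
    ring

/-- The Delaunay triangles of `Q`. -/
def delTri (Q : Set Pt) : Set (Finset Pt) :=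
  {t | t.card = 3 ∧ (t : Set Pt) ⊆ Q ∧ ∃ h, IsPow h ∧ (∀ p ∈ t, h p = 0) ∧ ∀ q ∈ Q, 0 ≤ h q}

lemma exists_delTri_of_generic {Q : Set Pt} (hfin : Q.Finite) (hQ : GenPos Q) {x : Pt}
    (hx : x ∈ convexHull ℝ Q) (hgen : ∀ a ∈ Q, ∀ b ∈ Q, a ≠ b → orient a b x ≠ 0)
    (hxQ : x ∉ Q) : ∃ t ∈ delTri Q, x ∈ triSet t := by
  classical
  have hpos : ∀ t : Finset Pt, (t : Set Pt) ⊆ Q → t.card ≤ 3 → x ∈ triSet t →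
      PosComb t x ∧ t.card = 3 := by
    intro t htQ ht3 hxt
    obtain ⟨A, hAt, hA⟩ := exists_posComb hxt
    have hA3 : A.card = 3 := by
      have hle := (Finset.card_le_card hAt).trans ht3
      have hne := hA.nonempty
      have hAQ : (A : Set Pt) ⊆ Q := (Finset.coe_subset.2 hAt).trans htQ
      by_contra hc
      have : A.card = 1 ∨ A.card = 2 := by
        have := hne.card_pos
        omega
      rcases this with h | h
      · obtain ⟨a, rfl⟩ := Finset.card_eq_one.1 h
        obtain ⟨w, -, h1, h2⟩ := hA
        simp only [Finset.sum_singleton] at h1 h2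
        rw [h1, one_smul] at h2
        exact hxQ (h2 ▸ hAQ (by simp))
      · obtain ⟨a, b, hab, rfl⟩ := Finset.card_eq_two.1 h
        rw [posComb_pair hab] at hA
        exact hgen a (hAQ (by simp)) b (hAQ (by simp)) hab (openSegment_orient hA)
    have := Finset.eq_of_subset_of_card_le hAt (by omega)
    subst this
    exact ⟨hA, hA3⟩
  let F : Finset (Finset Pt) :=
    (hfin.toFinset.powersetCard 3).filter (fun t => x ∈ triSet t)
  have hF : ∀ t, t ∈ F ↔ (t : Set Pt) ⊆ Q ∧ t.card = 3 ∧ x ∈ triSet t := by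
    intro t
    simp only [F, Finset.mem_filter, Finset.mem_powersetCard, and_assoc, ← Finset.coe_subset,
      Set.Finite.coe_toFinset]
  have hne : F.Nonempty := by
    rw [convexHull_eq_union] at hx
    simp only [Set.mem_iUnion] at hx
    obtain ⟨t, htQ, hind, hxt⟩ := hx
    have hc : t.card ≤ 3 := by
      have := hind.card_le_finrank_succ
      have h2 : Module.finrank ℝ (vectorSpan ℝ (Set.range ((↑) : t → Pt))) ≤ 2 := by
        have := Submodule.finrank_le (vectorSpan ℝ (Set.range ((↑) : t → Pt)))
        simpa using this
      simp only [Fintype.card_coe] at this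
      omega
    exact ⟨t, (hF t).2 ⟨htQ, (hpos t htQ hc hxt).2, hxt⟩⟩
  have hcirc : ∀ t : Finset Pt, ∃ h : Pt → ℝ, (t ∈ F → IsPow h ∧ ∀ p ∈ t, h p = 0) := by
    intro t
    by_cases ht : t ∈ F
    · obtain ⟨h, h1, h2⟩ := exists_isPow hQ ((hF t).1 ht).1 ((hF t).1 ht).2.1
      exact ⟨h, fun _ => ⟨h1, h2⟩⟩
    · exact ⟨0, fun h => absurd h ht⟩
  choose H hH using hcirc
  obtain ⟨t, ht, hmax⟩ := Finset.exists_max_image F (fun t => H t x) hne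
  obtain ⟨htQ, h3, hxt⟩ := (hF t).1 ht
  refine ⟨t, ⟨h3, htQ, H t, (hH t ht).1, (hH t ht).2, ?_⟩, hxt⟩
  intro q hq
  by_contra hneg
  rw [not_le] at hneg
  have hqt : q ∉ t := fun h => by
    rw [(hH t ht).2 q h] at hneg
    exact lt_irrefl _ hneg
  obtain ⟨a, ha, hxa⟩ := exists_exchange (hQ.affineIndependent htQ h3.le) h3
    (hpos t htQ h3.le hxt).1 hqt
  set t' := insert q (t.erase a) with ht'
  have hqe : q ∉ t.erase a := fun h => hqt (Finset.mem_of_mem_erase h)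
  have h3' : t'.card = 3 := by
    rw [ht', Finset.card_insert_of_notMem hqe, Finset.card_erase_of_mem ha, h3]
  have ht'Q : (t' : Set Pt) ⊆ Q := by
    intro p hp
    rcases Finset.mem_insert.1 (Finset.mem_coe.1 hp) with rfl | h
    · exact hq
    · exact htQ (Finset.mem_of_mem_erase h)
  have ht'F : t' ∈ F := (hF t').2 ⟨ht'Q, h3', hxa⟩
  obtain ⟨w, w0, w1, w2⟩ := (hpos t' ht'Q h3'.le hxa).1
  have e := ((hH t ht).1.sub (hH t' ht'F).1).sum w1 w2
  have : ∑ p ∈ t', w p * (H t p - H t' p) < 0 := by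
    have l1 : ∀ p ∈ t', w p * (H t p - H t' p) ≤ 0 := by
      intro p hp
      rw [(hH t' ht'F).2 p hp]
      rcases Finset.mem_insert.1 hp with h | h
      · have := w0 p hp
        rw [← h] at hneg
        nlinarith
      · rw [(hH t ht).2 p (Finset.mem_of_mem_erase h)]
        simp
    refine Finset.sum_neg' l1 ⟨q, Finset.mem_insert_self _ _, ?_⟩
    rw [(hH t' ht'F).2 q (Finset.mem_insert_self _ _)]
    nlinarith [w0 q (Finset.mem_insert_self _ _)]
  have := hmax t' ht'F
  linarith

lemma delTri_finite {Q : Set Pt} (hfin : Q.Finite) : (delTri Q).Finite := by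
  classical
  refine (hfin.toFinset.powerset.finite_toSet).subset ?_
  rintro t ⟨-, ht, -⟩
  simpa [← Finset.coe_subset] using ht

/-- The Delaunay triangles cover the convex hull. -/
lemma exists_delTri {Q : Set Pt} (hfin : Q.Finite) (hQ : GenPos Q)
    (h_int : (interior (convexHull ℝ Q)).Nonempty) {x : Pt} (hx : x ∈ convexHull ℝ Q) :
    ∃ t ∈ delTri Q, x ∈ triSet t := by
  have hclosed : IsClosed (⋃ t ∈ delTri Q, triSet t) :=
    (delTri_finite hfin).isClosed_biUnion fun t _ => isClosed_triSet t
  let I : Set (Pt × Pt) := (Q ×ˢ Q) ∩ {p | p.1 ≠ p.2}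
  have hI : I.Countable := ((hfin.prod hfin).subset Set.inter_subset_left).countable
  have hG : Dense (⋂ p ∈ I, {x | orient p.1 p.2 x ≠ 0}) :=
    dense_biInter_of_isOpen (fun p _ => isOpen_orient_ne _ _) hI
      (fun p hp => dense_orient_ne hp.2)
  have hcl : x ∈ closure (interior (convexHull ℝ Q)) := by
    rw [(convex_convexHull ℝ Q).closure_interior_eq_closure_of_nonempty_interior h_int]
    exact subset_closure hx
  obtain ⟨q₁, h₁, q₂, h₂, hq⟩ : ∃ q₁ ∈ Q, ∃ q₂ ∈ Q, q₁ ≠ q₂ := by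
    by_contra! hc
    obtain ⟨y, hy⟩ := h_int
    have hs : Q.Subsingleton := fun a ha b hb => hc a ha b hb
    rcases hs.eq_empty_or_singleton with h | ⟨a, h⟩
    · simp [h] at hy
    · rw [h, convexHull_singleton, interior_singleton] at hy
      exact hy
  have hsub : interior (convexHull ℝ Q) ∩ (⋂ p ∈ I, {x | orient p.1 p.2 x ≠ 0}) ⊆
      ⋃ t ∈ delTri Q, triSet t := by
    rintro y ⟨hy, hyG⟩
    simp only [Set.mem_iInter, Set.mem_ofPred_eq] at hyG
    have hgen : ∀ a ∈ Q, ∀ b ∈ Q, a ≠ b → orient a b y ≠ 0 := fun a ha b hb hab =>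
      hyG (a, b) ⟨⟨ha, hb⟩, hab⟩
    have hyQ : y ∉ Q := fun hyQ => by
      by_cases h : y = q₁
      · exact hgen y hyQ q₂ h₂ (h ▸ hq) (orient_left _ _)
      · exact hgen y hyQ q₁ h₁ h (orient_left _ _)
    obtain ⟨t, ht, hyt⟩ := exists_delTri_of_generic hfin hQ (interior_subset hy) hgen hyQ
    exact Set.mem_biUnion ht hyt
  have h1 := hG.open_subset_closure_inter (isOpen_interior (s := convexHull ℝ Q))
  have h2 := closure_minimal (h1.trans (hclosed.closure_subset_iff.2 hsub)) hclosed hcl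
  simpa using h2

lemma GenPos.delTri_face {P Q Q' : Set Pt} (hP : GenPos P) (hQ : Q ⊆ P) (hQ' : Q' ⊆ P)
    {t t' A B : Finset Pt} (ht : t ∈ delTri Q) (ht' : t' ∈ delTri Q') (hA : A ⊆ t) (hB : B ⊆ t')
    (hAQ : (A : Set Pt) ⊆ Q') (hBQ : (B : Set Pt) ⊆ Q) {z : Pt} (hzA : PosComb A z)
    (hzB : PosComb B z) : A = B := by
  obtain ⟨-, -, h, H, h0, h1⟩ := ht
  obtain ⟨-, -, h', H', h0', h1'⟩ := ht'
  exact hP.face_eq (hAQ.trans hQ') (hBQ.trans hQ) H H' (fun p hp => h0 p (hA hp))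
    (fun p hp => h1 p (hBQ hp)) (fun p hp => h0' p (hB hp)) (fun p hp => h1' p (hAQ hp)) hzA hzB

lemma GenPos.delTri_singleton {P Q : Set Pt} (hP : GenPos P) (hQ : Q ⊆ P)
    {t A : Finset Pt} (ht : t ∈ delTri Q) (hA : A ⊆ t) {p : Pt} (hp : p ∈ Q)
    (hz : PosComb A p) : A = {p} := by
  obtain ⟨-, htQ, h, H, h0, h1⟩ := ht
  have hAQ : (A : Set Pt) ⊆ Q := (Finset.coe_subset.2 hA).trans htQ
  refine hP.face_eq (hAQ.trans hQ) (by simpa using hQ hp) H (isPow_dist p 0)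
    (fun q hq => h0 q (hA hq)) (fun q hq => ?_) (fun q hq => ?_) (fun q hq => by
      simp only [sub_zero]; positivity) hz
    (posComb_singleton p)
  · rw [Finset.mem_singleton.1 hq]
    exact h1 p hp
  · rw [Finset.mem_singleton.1 hq]
    simp

lemma delTri_indep {Q : Set Pt} (hQ : GenPos Q) {t : Finset Pt} (ht : t ∈ delTri Q) :
    AffineIndependent ℝ ((↑) : t → Pt) :=
  hQ.affineIndependent ht.2.1 ht.1.le

lemma delTri_interior {Q : Set Pt} (hQ : GenPos Q) {t : Finset Pt} (ht : t ∈ delTri Q) {x : Pt} :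
    x ∈ interior (triSet t) ↔ PosComb t x := by
  rw [interior_triSet (delTri_indep hQ ht) ht.1]
  rfl

lemma triSet_subset_hull {Q : Set Pt} {t : Finset Pt} (h : (t : Set Pt) ⊆ Q) :
    triSet t ⊆ convexHull ℝ Q := convexHull_mono h

lemma GenPos.hull_interior {Q : Set Pt} (hQ : GenPos Q) {t : Finset Pt} (ht : (t : Set Pt) ⊆ Q)
    (h3 : t.card = 3) : (interior (convexHull ℝ Q)).Nonempty := by
  have h1 : (interior (triSet t)).Nonempty := by
    by_contra hc
    rw [Set.not_nonempty_iff_eq_empty] at hc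
    have := closure_interior_triSet (hQ.affineIndependent ht h3.le) h3
    rw [hc, closure_empty] at this
    obtain ⟨a, ha⟩ : t.Nonempty := Finset.card_pos.1 (by omega)
    have h2 : a ∈ triSet t := subset_convexHull ℝ _ ha
    rw [← this] at h2
    exact h2
  exact h1.mono (interior_mono (triSet_subset_hull ht))

lemma orderKTri_of {P : Set Pt} {k : ℕ} {t : Finset Pt} (hne : t.Nonempty) {h : Pt → ℝ}
    (H : IsPow h) (h0 : ∀ p ∈ t, h p = 0) (h1 : {p ∈ P | h p < 0}.encard ≤ (k : ℕ∞)) :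
    OrderKTri P k t := by
  obtain ⟨a, ha⟩ := hne
  obtain ⟨z, r, hr, hz⟩ := H.exists_circle (h0 a ha)
  refine ⟨z, r, fun p hp => ?_, ?_⟩
  · have := hz p
    rw [h0 p hp] at this
    exact (sq_eq_sq₀ dist_nonneg hr).1 (by linarith)
  · convert h1 using 5 with p
    rw [hz, sub_neg, sq_lt_sq₀ dist_nonneg hr]

lemma OrderKTri.exists_pow {P : Set Pt} {k : ℕ} {t : Finset Pt} (hne : t.Nonempty)
    (h : OrderKTri P k t) :
    ∃ h, IsPow h ∧ (∀ p ∈ t, h p = 0) ∧ {p ∈ P | h p < 0}.encard ≤ (k : ℕ∞) := by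
  obtain ⟨z, r, h0, h1⟩ := h
  refine ⟨_, isPow_dist z (r ^ 2), fun p hp => ?_, ?_⟩
  · have := dist_sq_eq p z
    rw [h0 p hp] at this
    linarith
  · obtain ⟨a, ha⟩ := hne
    have hr : 0 ≤ r := (h0 a ha) ▸ dist_nonneg
    convert h1 using 5 with p
    rw [← dist_sq_eq, sub_neg, sq_lt_sq₀ dist_nonneg hr]

/-- Delaunay triangulation of a finite set in general position. -/
lemma isTriangulation_delTri {P : Set Pt} (hfin : P.Finite) (hP : GenPos P)
    (h_int : (interior (convexHull ℝ P)).Nonempty) : IsTriangulation P (delTri P) := by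
  refine ⟨delTri_finite hfin, fun t ht => ⟨ht.1, ht.2.1⟩, fun p hp => ?_, ?_, ?_⟩
  · obtain ⟨t, ht, hpt⟩ := exists_delTri hfin hP h_int (subset_convexHull ℝ P hp)
    obtain ⟨A, hA, hpA⟩ := exists_posComb hpt
    have := hP.delTri_singleton subset_rfl ht hA hp hpA
    subst this
    exact ⟨t, ht, hA (by simp)⟩
  · intro t ht t' ht' hne
    by_contra hc
    obtain ⟨z, hz, hz'⟩ := Set.nonempty_iff_ne_empty.2 hc
    rw [delTri_interior hP ht] at hz
    rw [delTri_interior hP ht'] at hz'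
    exact hne (hP.delTri_face subset_rfl subset_rfl ht ht' subset_rfl subset_rfl ht.2.1 ht'.2.1
      hz hz')
  · ext x
    simp only [Set.mem_iUnion, exists_prop]
    exact ⟨fun ⟨t, ht, hx⟩ => triSet_subset_hull ht.2.1 hx, fun hx => exists_delTri hfin hP h_int hx⟩

/-- The triangle `t` has an interior point on the open segment `uv`. -/
def Crosses (u v : Pt) (t : Finset Pt) : Prop := ∃ q ∈ openSegment ℝ u v, PosComb t q

lemma Crosses.symm {u v : Pt} {t : Finset Pt} (h : Crosses u v t) : Crosses v u t := by
  rwa [Crosses, openSegment_symm]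

lemma openSegment_opp {u v q : Pt} {g : Pt → ℝ} (hg : IsAff g) (hq : q ∈ openSegment ℝ u v)
    (h0 : g q = 0) (hu : g u ≠ 0) : g u * g v < 0 := by
  obtain ⟨s, t, hs, ht, hst, rfl⟩ := hq
  rw [hg.combo hst] at h0
  have h1 : s * (g u) ^ 2 + t * (g u * g v) = 0 := by linear_combination g u * h0
  have : 0 < s * (g u) ^ 2 := by positivity
  by_contra hc
  nlinarith

/-- If a side of a triangle properly meets the segment `uv`, then so does the interior. -/
lemma GenPos.crosses_of_side {P : Set Pt} (hP : GenPos P) {u v : Pt} (hu : u ∈ P) (hv : v ∈ P)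
    {t : Finset Pt} (ht : (t : Set Pt) ⊆ P) (h3 : t.card = 3) {a b q : Pt} (ha : a ∈ t) (hb : b ∈ t)
    (hoa : orient u v a ≠ 0) (hob : orient u v b ≠ 0) (hab : a ≠ b)
    (hq : q ∈ openSegment ℝ a b) (hq' : q ∈ openSegment ℝ u v) : Crosses u v t := by
  have hua : a ≠ u := by rintro rfl; simp at hoa
  have hva : a ≠ v := by rintro rfl; simp at hoa
  have hub : b ≠ u := by rintro rfl; simp at hob
  have hvb : b ≠ v := by rintro rfl; simp at hob
  have h1 := hP.orient_ne (ht ha) (ht hb) hu hab hua hub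
  have h2 := openSegment_opp (isAff_orient a b) hq' (openSegment_orient hq) h1
  obtain ⟨c, hc⟩ : ∃ c, t = {a, b, c} ∧ c ≠ a ∧ c ≠ b := by
    have : ((t.erase a).erase b).card = 1 := by
      rw [Finset.card_erase_of_mem (Finset.mem_erase.2 ⟨hab.symm, hb⟩),
        Finset.card_erase_of_mem ha, h3]
    obtain ⟨c, hc⟩ := Finset.card_eq_one.1 this
    have hcm : c ∈ (t.erase a).erase b := by simp [hc]
    refine ⟨c, ?_, ?_, ?_⟩
    · rw [← hc, Finset.insert_comm, Finset.insert_comm, Finset.insert_erase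
        (Finset.mem_erase.2 ⟨hab.symm, hb⟩), Finset.insert_erase ha]
    · exact (Finset.mem_erase.1 (Finset.mem_erase.1 hcm).2).1
    · exact (Finset.mem_erase.1 hcm).1
  obtain ⟨hc, hca, hcb⟩ := hc
  have hct : c ∈ t := by simp [hc]
  have h4 := hP.orient_ne (ht ha) (ht hb) (ht hct) hab hca.symm hcb.symm
  obtain ⟨w, hwq, hw⟩ : ∃ w, openSegment ℝ q w ⊆ openSegment ℝ u v ∧
      0 < orient a b w * orient a b c := by
    have hsub : ∀ w ∈ ({u, v} : Set Pt), openSegment ℝ q w ⊆ openSegment ℝ u v := by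
      intro w hw
      obtain ⟨x, y, hx, hy, hxy, rfl⟩ := hq'
      rintro z ⟨x', y', hx', hy', hxy', rfl⟩
      rcases hw with rfl | rfl
      · refine ⟨x' * x + y', x' * y, by positivity, by positivity, ?_, by module⟩
        linear_combination x' * hxy + hxy'
      · refine ⟨x' * x, x' * y + y', by positivity, by positivity, ?_, by module⟩
        linear_combination x' * hxy + hxy'
    by_cases h : 0 < orient a b u * orient a b c
    · exact ⟨u, hsub u (by simp), h⟩
    · refine ⟨v, hsub v (by simp), ?_⟩
      have : orient a b u * orient a b c < 0 := lt_of_le_of_ne (not_lt.1 h) (mul_ne_zero h1 h4)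
      by_contra hh
      have h5 : orient a b v * orient a b c < 0 := by
        refine lt_of_le_of_ne (not_lt.1 hh) (mul_ne_zero ?_ h4)
        intro h0
        simp [h0] at h2
      nlinarith [mul_pos_of_neg_of_neg this h5, sq_nonneg (orient a b c)]
  obtain ⟨β, b1, b2⟩ := exists_bary (hP.affineIndependent ht h3.le) h3 w
  have b3 := (isAff_orient a b).sum b1 b2
  obtain ⟨x, y, hx, hy, hxy, rfl⟩ := hq
  have hcab : a ∉ ({b, c} : Finset Pt) := by simp [hab, hca.symm]
  have hcb' : b ∉ ({c} : Finset Pt) := by simp [hcb.symm]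
  rw [hc, Finset.sum_insert hcab, Finset.sum_insert hcb', Finset.sum_singleton] at b1 b2 b3
  simp only [orient_left, orient_right, mul_zero, zero_add] at b3
  have hβc : 0 < β c := by
    rw [b3] at hw
    by_contra hh
    nlinarith [sq_nonneg (orient a b c)]
  have hlim : ∀ r s : ℝ, 0 < r → ∀ᶠ ε in nhdsWithin (0 : ℝ) (Set.Ioi 0),
      0 < (1 - ε) * r + ε * s := by
    intro r s hr
    have hcont : Continuous (fun ε : ℝ => (1 - ε) * r + ε * s) := by fun_prop
    have := hcont.tendsto 0
    simp only [sub_zero, one_mul, zero_mul, add_zero] at this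
    exact (this.mono_left nhdsWithin_le_nhds).eventually (lt_mem_nhds hr)
  have hone : ∀ᶠ ε in nhdsWithin (0 : ℝ) (Set.Ioi 0), ε < 1 :=
    (Filter.Tendsto.mono_left Filter.tendsto_id nhdsWithin_le_nhds).eventually
      (gt_mem_nhds one_pos)
  obtain ⟨ε, he1, he2, he3, he4⟩ := ((hlim x (β a) hx).and ((hlim y (β b) hy).and
    (hone.and self_mem_nhdsWithin))).exists
  refine ⟨(1 - ε) • (x • a + y • b) + ε • w, hwq ⟨1 - ε, ε, by linarith, he4, by ring, rfl⟩, ?_⟩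
  refine ⟨fun p => if p = a then (1 - ε) * x + ε * β a else
    if p = b then (1 - ε) * y + ε * β b else ε * β c, ?_, ?_, ?_⟩
  · intro p _
    dsimp
    split_ifs
    · exact he1
    · exact he2
    · positivity
  · rw [hc, Finset.sum_insert hcab, Finset.sum_insert hcb', Finset.sum_singleton]
    simp only [if_true, hab.symm, hca, hcb, if_false]
    linear_combination (1 - ε) * hxy + ε * b1
  · rw [hc, Finset.sum_insert hcab, Finset.sum_insert hcb', Finset.sum_singleton]
    simp only [if_true, hab.symm, hca, hcb, if_false]
    rw [← b2]
    module

lemma mem_pair_of_orient {P : Set Pt} (hP : GenPos P) {u v p : Pt} (hu : u ∈ P) (hv : v ∈ P)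
    (huv : u ≠ v) (hp : p ∈ P) (h : orient u v p = 0) : p = u ∨ p = v := by
  by_contra! hc
  exact hP.orient_ne hu hv hp huv hc.1.symm hc.2.symm h

/-- If no Delaunay triangle crosses `uv`, then `uv` is a Delaunay edge. -/
lemma GenPos.exists_edge_of_not_crosses {P : Set Pt} (hfin : P.Finite) (hP : GenPos P)
    (h_int : (interior (convexHull ℝ P)).Nonempty) {u v : Pt} (hu : u ∈ P) (hv : v ∈ P)
    (huv : u ≠ v) (hno : ∀ t ∈ delTri P, ¬ Crosses u v t) : ∃ t ∈ delTri P, u ∈ t ∧ v ∈ t := by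
  set m : Pt := (1 / 2 : ℝ) • u + (1 / 2 : ℝ) • v with hm
  have hmo : m ∈ openSegment ℝ u v := ⟨1 / 2, 1 / 2, by norm_num, by norm_num, by norm_num, rfl⟩
  have hmP : m ∈ convexHull ℝ P :=
    (convex_convexHull ℝ P).segment_subset (subset_convexHull ℝ _ hu) (subset_convexHull ℝ _ hv)
      (openSegment_subset_segment _ _ _ hmo)
  obtain ⟨t, ht, hmt⟩ := exists_delTri hfin hP h_int hmP
  obtain ⟨A, hA, hmA⟩ := exists_posComb hmt
  have hAP : (A : Set Pt) ⊆ P := (Finset.coe_subset.2 hA).trans ht.2.1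
  have hm0 := openSegment_orient hmo
  have hmd := openSegment_diamPow huv hmo
  have hc3 := Finset.card_le_card hA
  rw [ht.1] at hc3
  have hpos := hmA.nonempty.card_pos
  have : A.card = 1 ∨ A.card = 2 ∨ A.card = 3 := by omega
  rcases this with h | h | h
  · obtain ⟨a, rfl⟩ := Finset.card_eq_one.1 h
    obtain ⟨w, -, h1, h2⟩ := hmA
    simp only [Finset.sum_singleton] at h1 h2
    rw [h1, one_smul] at h2
    have haP : m ∈ P := h2 ▸ hAP (by simp)
    rcases mem_pair_of_orient hP hu hv huv haP hm0 with h | h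
    · rw [h] at hmd
      simp [diamPow] at hmd
    · rw [h] at hmd
      simp [diamPow] at hmd
  · obtain ⟨a, b, hab, rfl⟩ := Finset.card_eq_two.1 h
    rw [posComb_pair hab] at hmA
    have ha : a ∈ t := hA (by simp)
    have hb : b ∈ t := hA (by simp)
    have hboth : orient u v a = 0 ↔ orient u v b = 0 := by
      obtain ⟨x, y, hx, hy, hxy, hz⟩ := hmA
      rw [← hz, (isAff_orient u v).combo hxy] at hm0
      constructor
      · intro h
        rw [h] at hm0
        simpa [hy.ne'] using hm0
      · intro h
        rw [h] at hm0
        simpa [hx.ne'] using hm0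
    by_cases h0 : orient u v a = 0
    · refine ⟨t, ht, ?_⟩
      rcases mem_pair_of_orient hP hu hv huv (ht.2.1 ha) h0 with h1 | h1 <;>
      rcases mem_pair_of_orient hP hu hv huv (ht.2.1 hb) (hboth.1 h0) with h2 | h2
      · exact absurd (h1.trans h2.symm) hab
      · exact ⟨h1 ▸ ha, h2 ▸ hb⟩
      · exact ⟨h2 ▸ hb, h1 ▸ ha⟩
      · exact absurd (h1.trans h2.symm) hab
    · exact absurd (hP.crosses_of_side hu hv ht.2.1 ht.1 ha hb h0 (fun h => h0 (hboth.2 h)) hab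
        hmA hmo) (hno t ht)
  · have := Finset.eq_of_subset_of_card_le hA (by rw [ht.1, h])
    subst this
    exact absurd ⟨m, hmo, hmA⟩ (hno _ ht)

/-- The part of the crossing triangles of `uv` weakly to the left of `uv`. -/
def crossHalf (P : Set Pt) (u v : Pt) : Set Pt :=
  ⋃ t ∈ {t ∈ delTri P | Crosses u v t}, triSet t ∩ {x | 0 ≤ orient u v x}

lemma mem_crossHalf {P : Set Pt} {u v x : Pt} : x ∈ crossHalf P u v ↔
    ∃ t ∈ delTri P, Crosses u v t ∧ x ∈ triSet t ∧ 0 ≤ orient u v x := by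
  simp only [crossHalf, Set.mem_iUnion, Set.mem_inter_iff, exists_prop]
  exact ⟨fun ⟨t, ⟨h1, h2⟩, h3, h4⟩ => ⟨t, h1, h2, h3, h4⟩,
    fun ⟨t, h1, h2, h3, h4⟩ => ⟨t, ⟨h1, h2⟩, h3, h4⟩⟩

lemma isClosed_crossHalf {P : Set Pt} (hfin : P.Finite) (u v : Pt) :
    IsClosed (crossHalf P u v) :=
  ((delTri_finite hfin).subset (Set.sep_subset _ _)).isClosed_biUnion fun t _ =>
    (isClosed_triSet t).inter (isClosed_le continuous_const (isAff_orient u v).continuous)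

/-- A crossing Delaunay triangle meets the line `uv` inside the segment `uv`. -/
lemma GenPos.mem_segment_of_crosses {P : Set Pt} (hP : GenPos P) {u v : Pt} (hu : u ∈ P)
    (hv : v ∈ P) (huv : u ≠ v) {t : Finset Pt} (ht : t ∈ delTri P) (hc : Crosses u v t) {x : Pt}
    (hx : x ∈ triSet t) (h0 : orient u v x = 0) :
    x = u ∨ x = v ∨ x ∈ openSegment ℝ u v := by
  obtain ⟨q, hq, hqt⟩ := hc
  have hno : ∀ w ∈ P, w ∉ openSegment ℝ q x := by
    intro w hw hwq
    have := (convex_triSet t).openSegment_interior_self_subset_interior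
      ((delTri_interior hP ht).2 hqt) hx hwq
    rw [delTri_interior hP ht] at this
    have h1 := hP.delTri_singleton subset_rfl ht subset_rfl hw this
    have h2 := ht.1
    simp [h1] at h2
  obtain ⟨τ, rfl⟩ := collinear_of_orient h0 huv
  obtain ⟨a, b, ha, hb, hab, rfl⟩ := hq
  rcases lt_trichotomy τ 0 with h | h | h
  · exfalso
    have hden : 0 < b - τ := by linarith
    refine hno u hu ⟨-τ / (b - τ), b / (b - τ), div_pos (by linarith) hden, div_pos hb hden,
      by field_simp; ring, ?_⟩
    rw [show a = 1 - b by linarith]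
    have : u = (1 : ℝ) • u := (one_smul _ _).symm
    have e1 : -τ / (b - τ) * (1 - b) + b / (b - τ) * (1 - τ) = 1 := by field_simp; ring
    have e2 : -τ / (b - τ) * b + b / (b - τ) * τ = 0 := by field_simp; ring
    calc _ = (-τ / (b - τ) * (1 - b) + b / (b - τ) * (1 - τ)) • u +
          (-τ / (b - τ) * b + b / (b - τ) * τ) • v := by module
      _ = u := by rw [e1, e2]; simp
  · left
    simp [h]
  · rcases lt_trichotomy τ 1 with h' | h' | h'
    · exact Or.inr (Or.inr ⟨1 - τ, τ, by linarith, h, by ring, rfl⟩)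
    · right; left
      simp [h']
    · exfalso
      have hden : 0 < τ - b := by linarith
      refine hno v hv ⟨(τ - 1) / (τ - b), (1 - b) / (τ - b), div_pos (by linarith) hden,
        div_pos (by linarith) hden, by field_simp; ring, ?_⟩
      rw [show a = 1 - b by linarith]
      have e1 : (τ - 1) / (τ - b) * (1 - b) + (1 - b) / (τ - b) * (1 - τ) = 0 := by
        field_simp; ring
      have e2 : (τ - 1) / (τ - b) * b + (1 - b) / (τ - b) * τ = 1 := by field_simp; ring
      calc _ = ((τ - 1) / (τ - b) * (1 - b) + (1 - b) / (τ - b) * (1 - τ)) • u +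
            ((τ - 1) / (τ - b) * b + (1 - b) / (τ - b) * τ) • v := by module
        _ = v := by rw [e1, e2]; simp

/-- Data of the circle through `u`, `v` and the left point `s` whose left part is empty. -/
structure LeftWitness (P : Set Pt) (u v s : Pt) (τ : ℝ) : Prop where
  fin : P.Finite
  gen : GenPos P
  hu : u ∈ P
  hv : v ∈ P
  huv : u ≠ v
  hs : s ∈ P
  left : 0 < orient u v s
  on : pencil u v τ s = 0
  min : ∀ p ∈ P, 0 < orient u v p → 0 ≤ pencil u v τ p

namespace LeftWitness

variable {P : Set Pt} {u v s : Pt} {τ : ℝ}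

/-- The points not inside the witness circle. -/
def out (_ : LeftWitness P u v s τ) : Set Pt := {p ∈ P | 0 ≤ pencil u v τ p}

lemma out_subset (W : LeftWitness P u v s τ) : W.out ⊆ P := Set.sep_subset _ _

lemma mem_out (W : LeftWitness P u v s τ) {p : Pt} (hp : p ∈ P) (h : 0 ≤ orient u v p) :
    p ∈ W.out := by
  refine ⟨hp, ?_⟩
  rcases h.lt_or_eq with h | h
  · exact W.min p hp h
  · rcases mem_pair_of_orient W.gen W.hu W.hv W.huv hp h.symm with h | h <;> simp [h]

lemma gen_out (W : LeftWitness P u v s τ) : GenPos W.out := W.gen.mono W.out_subset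

lemma su (W : LeftWitness P u v s τ) : s ≠ u := by
  rintro rfl
  simpa using W.left

lemma sv (W : LeftWitness P u v s τ) : s ≠ v := by
  rintro rfl
  simpa using W.left

lemma tri (W : LeftWitness P u v s τ) : {u, v, s} ∈ delTri W.out := by
  refine ⟨Finset.card_eq_three.2 ⟨u, v, s, W.huv, W.su.symm, W.sv.symm, rfl⟩, ?_,
    pencil u v τ, isPow_pencil _ _ _, ?_, fun q hq => hq.2⟩
  · intro p hp
    simp only [Finset.coe_insert, Finset.coe_singleton, Set.mem_insert_iff,
      Set.mem_singleton_iff] at hp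
    rcases hp with rfl | rfl | rfl
    · exact W.mem_out W.hu (by simp)
    · exact W.mem_out W.hv (by simp)
    · exact W.mem_out W.hs W.left.le
  · intro p hp
    simp only [Finset.mem_insert, Finset.mem_singleton] at hp
    rcases hp with rfl | rfl | rfl
    · simp
    · simp
    · exact W.on

lemma pos_of_interior (W : LeftWitness P u v s τ) {t : Finset Pt} (ht : t ∈ delTri W.out)
    {z : Pt} (hz : PosComb t z) (hzK : z ∈ crossHalf P u v) : 0 < orient u v z := by
  obtain ⟨t₀, ht₀, hc, hzt, h0⟩ := mem_crossHalf.1 hzK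
  refine h0.lt_of_ne fun h => ?_
  have hcard := ht.1
  rcases W.gen.mem_segment_of_crosses W.hu W.hv W.huv ht₀ hc hzt h.symm with h | h | h
  · have := W.gen.delTri_singleton W.out_subset ht subset_rfl (W.mem_out (h ▸ W.hu)
      (by simp [h])) hz
    simp [this] at hcard
  · have := W.gen.delTri_singleton W.out_subset ht subset_rfl (W.mem_out (h ▸ W.hv)
      (by simp [h])) hz
    simp [this] at hcard
  · rw [← posComb_pair W.huv] at h
    have hsub : ({u, v} : Finset Pt) ⊆ {u, v, s} := by
      intro p hp
      simp only [Finset.mem_insert, Finset.mem_singleton] at hp ⊢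
      tauto
    have := W.gen.delTri_face W.out_subset W.out_subset ht W.tri subset_rfl hsub ht.2.1
      ((Finset.coe_subset.2 hsub).trans W.tri.2.1) hz h
    rw [this, Finset.card_pair W.huv] at hcard
    omega

lemma crosses_of_mem (W : LeftWitness P u v s τ) {t : Finset Pt} (ht : t ∈ delTri W.out)
    {z : Pt} (hz : PosComb t z) (hzK : z ∈ crossHalf P u v) {t' : Finset Pt}
    (ht' : t' ∈ delTri P) (hzt' : z ∈ triSet t') : Crosses u v t' := by
  have hpos := W.pos_of_interior ht hz hzK
  obtain ⟨t₀, ht₀, hc, hzt, -⟩ := mem_crossHalf.1 hzK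
  obtain ⟨A, hA, hzA⟩ := exists_posComb hzt
  obtain ⟨B, hB, hzB⟩ := exists_posComb hzt'
  have hAP := (Finset.coe_subset.2 hA).trans ht₀.2.1
  have hBP := (Finset.coe_subset.2 hB).trans ht'.2.1
  have hAB := W.gen.delTri_face subset_rfl subset_rfl ht₀ ht' hA hB hAP hBP hzA hzB
  subst hAB
  have hfull : A.card = 3 → Crosses u v t' := by
    intro h
    rwa [← Finset.eq_of_subset_of_card_le hB (by rw [h, ht'.1]),
      Finset.eq_of_subset_of_card_le hA (by rw [h, ht₀.1])]
  by_cases hleft : ∀ a ∈ A, 0 ≤ orient u v a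
  · have hAQ : (A : Set Pt) ⊆ W.out := fun p hp => W.mem_out (hAP hp) (hleft p hp)
    have := W.gen.delTri_face subset_rfl W.out_subset ht₀ ht hA subset_rfl hAQ
      (ht.2.1.trans W.out_subset) hzA hz
    exact hfull (this ▸ ht.1)
  · push Not at hleft
    obtain ⟨a, ha, hoa⟩ := hleft
    obtain ⟨b, hb, hob⟩ : ∃ b ∈ A, 0 < orient u v b := by
      by_contra! hcon
      obtain ⟨w, w0, w1, w2⟩ := hzA
      have := (isAff_orient u v).sum w1 w2
      have h2 := Finset.sum_nonpos fun p hp =>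
        mul_nonpos_of_nonneg_of_nonpos (w0 p hp).le (hcon p hp)
      linarith
    have hab : a ≠ b := by
      rintro rfl
      linarith
    by_cases h3 : A.card = 3
    · exact hfull h3
    have hcard : A.card = 2 := by
      have h1 := Finset.card_le_card hA
      rw [ht₀.1] at h1
      have h2 := Finset.one_lt_card.2 ⟨a, ha, b, hb, hab⟩
      omega
    have hAe : A = {a, b} := by
      refine (Finset.eq_of_subset_of_card_le ?_ ?_).symm
      · intro p hp
        simp only [Finset.mem_insert, Finset.mem_singleton] at hp
        rcases hp with rfl | rfl <;> assumption
      · rw [hcard, Finset.card_pair hab]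
    set ya := orient u v a
    set yb := orient u v b
    have hden : 0 < yb - ya := by linarith
    set q : Pt := (yb / (yb - ya)) • a + (-ya / (yb - ya)) • b with hqdef
    have hsum : yb / (yb - ya) + -ya / (yb - ya) = 1 := by field_simp; ring
    have hq : q ∈ openSegment ℝ a b :=
      ⟨_, _, div_pos hob hden, div_pos (by linarith) hden, hsum, rfl⟩
    have hq0 : orient u v q = 0 := by
      rw [hqdef, (isAff_orient u v).combo hsum]
      change _ * ya + _ * yb = 0
      field_simp
      ring
    have hqA : PosComb A q := by
      rw [hAe, posComb_pair hab]
      exact hq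
    have hqt : q ∈ triSet t₀ := by
      exact convexHull_mono (Finset.coe_subset.2 hA) hqA.mem_hull
    have hnot : ∀ p ∈ P, q ≠ p := by
      rintro p hp rfl
      have := W.gen.delTri_singleton subset_rfl ht₀ hA hp hqA
      simp [this] at hcard
    rcases W.gen.mem_segment_of_crosses W.hu W.hv W.huv ht₀ hc hqt hq0 with h | h | h
    · exact absurd h (hnot u W.hu)
    · exact absurd h (hnot v W.hv)
    · exact W.gen.crosses_of_side W.hu W.hv ht'.2.1 ht'.1 (hB ha) (hB hb) hoa.ne hob.ne' hab hq h

lemma hull_int (W : LeftWitness P u v s τ) : (interior (convexHull ℝ P)).Nonempty :=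
  W.gen.hull_interior (W.tri.2.1.trans W.out_subset) W.tri.1

lemma hull_out_int (W : LeftWitness P u v s τ) : (interior (convexHull ℝ W.out)).Nonempty :=
  W.gen_out.hull_interior W.tri.2.1 W.tri.1

lemma subset_crossHalf (W : LeftWitness P u v s τ) {t : Finset Pt} (ht : t ∈ delTri W.out)
    {z : Pt} (hz : PosComb t z) (hzK : z ∈ crossHalf P u v) : triSet t ⊆ crossHalf P u v := by
  have hcl := isClosed_crossHalf W.fin u v
  have hmem := @delTri_interior _ W.gen_out t ht
  have hnhds : ∀ z ∈ interior (triSet t), z ∈ crossHalf P u v →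
      z ∈ interior (crossHalf P u v) := by
    intro z hz hzK
    rw [mem_interior_iff_mem_nhds]
    have hpos := W.pos_of_interior ht (hmem.1 hz) hzK
    have h1 : ∀ᶠ y in nhds z, y ∈ interior (triSet t) := isOpen_interior.mem_nhds hz
    have h2 : ∀ᶠ y in nhds z, 0 < orient u v y :=
      (isAff_orient u v).continuous.continuousAt.eventually (lt_mem_nhds hpos)
    have h3 : ∀ᶠ y in nhds z, ∀ t' ∈ delTri P, y ∈ triSet t' → z ∈ triSet t' := by
      rw [Filter.eventually_all_finite (delTri_finite W.fin)]
      intro t' _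
      by_cases hzt : z ∈ triSet t'
      · exact Filter.Eventually.of_forall fun _ _ => hzt
      · filter_upwards [(isClosed_triSet t').isOpen_compl.mem_nhds hzt] with y hy hy'
        exact absurd hy' hy
    filter_upwards [h1, h2, h3] with y hy1 hy2 hy3
    have hyP : y ∈ convexHull ℝ P :=
      triSet_subset_hull (ht.2.1.trans W.out_subset) (interior_subset hy1)
    obtain ⟨t', ht', hyt'⟩ := exists_delTri W.fin W.gen W.hull_int hyP
    exact mem_crossHalf.2 ⟨t', ht', W.crosses_of_mem ht (hmem.1 hz) hzK ht' (hy3 t' ht' hyt'),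
      hyt', hy2.le⟩
  have hpre : IsPreconnected (interior (triSet t)) := (convex_triSet t).interior.isPreconnected
  have hsub := hpre.subset_left_of_subset_union (u := interior (crossHalf P u v))
    (v := (crossHalf P u v)ᶜ) isOpen_interior hcl.isOpen_compl
    (Set.disjoint_left.2 fun x hx hx' => hx' (interior_subset hx))
    (fun x hx => by
      by_cases h : x ∈ crossHalf P u v
      · exact Or.inl (hnhds x hx h)
      · exact Or.inr h)
    ⟨z, hmem.2 hz, hnhds z (hmem.2 hz) hzK⟩
  rw [← closure_interior_triSet (delTri_indep W.gen_out ht) ht.1]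
  exact closure_minimal (hsub.trans interior_subset) hcl

lemma subset_crossHalf_of_inter (W : LeftWitness P u v s τ) {t : Finset Pt}
    (ht : t ∈ delTri W.out) {t₀ : Finset Pt} (ht₀ : t₀ ∈ delTri P) (hc : Crosses u v t₀) {z : Pt}
    (hz : z ∈ triSet t) {O : Set Pt} (hO : IsOpen O) (hzO : z ∈ O)
    (hsub : ∀ y ∈ O, PosComb t y → y ∈ triSet t₀ ∧ 0 ≤ orient u v y) :
    triSet t ⊆ crossHalf P u v := by
  rw [← closure_interior_triSet (delTri_indep W.gen_out ht) ht.1, mem_closure_iff] at hz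
  obtain ⟨y, hyO, hyt⟩ := hz O hO hzO
  rw [delTri_interior W.gen_out ht] at hyt
  exact W.subset_crossHalf ht hyt (mem_crossHalf.2 ⟨t₀, ht₀, hc, hsub y hyO hyt⟩)

/-- The Delaunay triangles of the outer points that replace the crossing triangles. -/
def fill (W : LeftWitness P u v s τ) : Set (Finset Pt) :=
  {t ∈ delTri W.out | triSet t ⊆ crossHalf P u v}

lemma mem_hull_out (W : LeftWitness P u v s τ) {t₀ : Finset Pt} (ht₀ : t₀ ∈ delTri P)
    (hc : Crosses u v t₀) {y : Pt} (hy : y ∈ triSet t₀) (hpos : 0 < orient u v y) :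
    y ∈ convexHull ℝ W.out := by
  let L := t₀.filter (fun p => 0 ≤ orient u v p)
  let R := t₀.filter (fun p => ¬ 0 ≤ orient u v p)
  have hLQ : (L : Set Pt) ⊆ W.out := fun p hp => by
    have := Finset.mem_filter.1 (Finset.mem_coe.1 hp)
    exact W.mem_out (ht₀.2.1 this.1) this.2
  have hLR : (t₀ : Set Pt) = (L : Set Pt) ∪ R := by
    rw [← Finset.coe_union, Finset.filter_union_filter_not_eq]
  have hLne : L.Nonempty := by
    by_contra hcon
    rw [Finset.not_nonempty_iff_eq_empty, Finset.filter_eq_empty_iff] at hcon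
    obtain ⟨A, hA, w, w0, w1, w2⟩ := exists_posComb hy
    have := (isAff_orient u v).sum w1 w2
    have h2 := Finset.sum_nonpos fun p hp =>
      mul_nonpos_of_nonneg_of_nonpos (w0 p hp).le (not_le.1 (hcon (hA hp))).le
    linarith
  by_cases hR : R.Nonempty
  · have hy' := hy
    rw [triSet, hLR, convexHull_union (Finset.coe_nonempty.2 hLne) (Finset.coe_nonempty.2 hR),
      mem_convexJoin] at hy'
    obtain ⟨l, hl, r, hr, a, b, ha, hb, hab, rfl⟩ := hy'
    have hl0 : 0 ≤ orient u v l := by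
      obtain ⟨A, hA, w, w0, w1, w2⟩ := exists_posComb hl
      rw [(isAff_orient u v).sum w1 w2]
      exact Finset.sum_nonneg fun p hp =>
        mul_nonneg (w0 p hp).le (Finset.mem_filter.1 (hA hp)).2
    have hr0 : orient u v r < 0 := by
      obtain ⟨A, hA, hrA⟩ := exists_posComb hr
      obtain ⟨p, hp⟩ := hrA.nonempty
      obtain ⟨w, w0, w1, w2⟩ := hrA
      rw [(isAff_orient u v).sum w1 w2]
      refine Finset.sum_neg (fun p hp => ?_) ⟨p, hp⟩
      exact mul_neg_of_pos_of_neg (w0 p hp) (not_le.1 (Finset.mem_filter.1 (hA hp)).2)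
    have hlQ : l ∈ convexHull ℝ W.out := convexHull_mono hLQ hl
    set yl := orient u v l with hyl
    set yr := orient u v r with hyr
    have hden : 0 < yl - yr := by linarith
    have hsum : -yr / (yl - yr) + yl / (yl - yr) = 1 := by field_simp; ring
    set m : Pt := (-yr / (yl - yr)) • l + (yl / (yl - yr)) • r with hm
    have hmt : m ∈ triSet t₀ := (convex_triSet t₀)
      (convexHull_mono (Finset.coe_subset.2 (Finset.filter_subset _ _)) hl)
      (convexHull_mono (Finset.coe_subset.2 (Finset.filter_subset _ _)) hr)
      (div_nonneg (by linarith) hden.le) (div_nonneg hl0 hden.le) hsum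
    have hm0 : orient u v m = 0 := by
      rw [hm, (isAff_orient u v).combo hsum, ← hyl, ← hyr]
      field_simp
      ring
    have huQ : u ∈ convexHull ℝ W.out := subset_convexHull ℝ _ (W.mem_out W.hu (by simp))
    have hvQ : v ∈ convexHull ℝ W.out := subset_convexHull ℝ _ (W.mem_out W.hv (by simp))
    have hmQ : m ∈ convexHull ℝ W.out := by
      rcases W.gen.mem_segment_of_crosses W.hu W.hv W.huv ht₀ hc hmt hm0 with h | h | h
      · rwa [h]
      · rwa [h]
      · exact (convex_convexHull ℝ _).openSegment_subset huQ hvQ h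
    rw [(isAff_orient u v).combo hab, ← hyl, ← hyr] at hpos
    have hylpos : 0 < yl := by
      by_contra hcon
      nlinarith
    set c := b * (yl - yr) / yl with hcdef
    have hc0 : 0 ≤ c := by positivity
    have hc1 : c ≤ 1 := by
      rw [hcdef, div_le_one hylpos]
      nlinarith
    have hb' : c * (yl / (yl - yr)) = b := by
      rw [hcdef]; field_simp
    have key : (1 - c) • l + c • m = a • l + b • r := by
      have e2 : (1 - c) + c * (-yr / (yl - yr)) = a := by
        have : c * (-yr / (yl - yr)) + c * (yl / (yl - yr)) = c := by rw [← mul_add, hsum, mul_one]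
        linarith
      rw [hm, ← e2, ← hb']
      module
    rw [← key]
    exact (convex_convexHull ℝ _) hlQ hmQ (by linarith) hc0 (by ring)
  · rw [Finset.not_nonempty_iff_eq_empty] at hR
    rw [triSet, hLR, hR, Finset.coe_empty, Set.union_empty] at hy
    exact convexHull_mono hLQ hy

lemma cover (W : LeftWitness P u v s τ) {t₀ : Finset Pt} (ht₀ : t₀ ∈ delTri P)
    (hc : Crosses u v t₀) {x : Pt} (hx : x ∈ triSet t₀) (h0 : 0 ≤ orient u v x) :
    ∃ t ∈ W.fill, x ∈ triSet t := by
  have hcl : IsClosed (⋃ t ∈ W.fill, triSet t) :=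
    ((delTri_finite (W.fin.subset W.out_subset)).subset (Set.sep_subset _ _)).isClosed_biUnion
      fun t _ => isClosed_triSet t
  have hO : IsOpen (interior (triSet t₀) ∩ {y | 0 < orient u v y}) :=
    isOpen_interior.inter (isOpen_lt continuous_const (isAff_orient u v).continuous)
  have hopen : ∀ y ∈ interior (triSet t₀), 0 < orient u v y → y ∈ ⋃ t ∈ W.fill, triSet t := by
    intro y hy hpos
    obtain ⟨t, ht, hyt⟩ := exists_delTri (W.fin.subset W.out_subset) W.gen_out W.hull_out_int
      (W.mem_hull_out ht₀ hc (interior_subset hy) hpos)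
    refine Set.mem_biUnion (⟨ht, ?_⟩ : t ∈ W.fill) hyt
    exact W.subset_crossHalf_of_inter ht ht₀ hc hyt hO ⟨hy, hpos⟩ fun y hy _ =>
      ⟨interior_subset hy.1, le_of_lt hy.2⟩
  obtain ⟨y, hy, hypos⟩ : ∃ y ∈ interior (triSet t₀), 0 < orient u v y := by
    obtain ⟨q, hq, hqt⟩ := hc
    have hqi := (delTri_interior W.gen ht₀).2 hqt
    have h1 : ∀ᶠ ε in nhdsWithin (0 : ℝ) (Set.Ioi 0), q + ε • (s - q) ∈ interior (triSet t₀) :=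
      (tendsto_add_smul q (s - q)).eventually (isOpen_interior.mem_nhds hqi)
    obtain ⟨ε, he, hpos⟩ := (h1.and self_mem_nhdsWithin).exists
    refine ⟨_, he, ?_⟩
    have : q + ε • (s - q) = (1 - ε) • q + ε • s := by module
    rw [this, (isAff_orient u v).combo (by ring), openSegment_orient hq, mul_zero, zero_add]
    exact mul_pos hpos W.left
  have hxcl : x ∈ ⋃ t ∈ W.fill, triSet t := by
    rw [← hcl.closure_eq]
    refine mem_closure_of_tendsto (tendsto_add_smul x (y - x)) ?_
    have hone : ∀ᶠ ε in nhdsWithin (0 : ℝ) (Set.Ioi 0), ε < 1 :=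
      (Filter.Tendsto.mono_left Filter.tendsto_id nhdsWithin_le_nhds).eventually
        (gt_mem_nhds one_pos)
    filter_upwards [self_mem_nhdsWithin, hone] with ε he he1
    have he0 : 0 < ε := he
    have : x + ε • (y - x) = (1 - ε) • x + ε • y := by module
    rw [this]
    refine hopen _ ?_ ?_
    · exact (convex_triSet t₀).openSegment_self_interior_subset_interior hx hy
        ⟨1 - ε, ε, by linarith, he0, by ring, rfl⟩
    · rw [(isAff_orient u v).combo (by ring)]
      nlinarith [mul_pos he0 hypos]
  simpa using hxcl

lemma edge_mem (W : LeftWitness P u v s τ) {t₀ : Finset Pt} (ht₀ : t₀ ∈ delTri P)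
    (hc : Crosses u v t₀) : {u, v, s} ∈ W.fill := by
  refine ⟨W.tri, ?_⟩
  have hc' := hc
  obtain ⟨q, hq, hqt⟩ := hc'
  have hqT : q ∈ triSet ({u, v, s} : Finset Pt) := by
    refine (convex_triSet _).openSegment_subset (x := u) (y := v) ?_ ?_ hq <;>
    exact subset_convexHull ℝ _ (by simp)
  refine W.subset_crossHalf_of_inter W.tri ht₀ hc hqT isOpen_interior
    ((delTri_interior W.gen ht₀).2 hqt) fun y hy hyt => ⟨interior_subset hy, ?_⟩
  obtain ⟨w, w0, w1, w2⟩ := hyt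
  rw [(isAff_orient u v).sum w1 w2]
  refine Finset.sum_nonneg fun p hp => mul_nonneg (w0 p hp).le ?_
  simp only [Finset.mem_insert, Finset.mem_singleton] at hp
  rcases hp with rfl | rfl | rfl
  · simp
  · simp
  · exact W.left.le

lemma vertex_mem_out (W : LeftWitness P u v s τ) {t : Finset Pt} (ht : t ∈ W.fill) {p : Pt}
    (hp : p ∈ P) (hpt : p ∈ triSet t) : p ∈ W.out := by
  obtain ⟨_, _, _, _, h⟩ := mem_crossHalf.1 (ht.2 hpt)
  exact W.mem_out hp h

lemma order (W : LeftWitness P u v s τ) {k : ℕ}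
    (hk : {p ∈ P | pencil u v τ p < 0}.encard ≤ (k : ℕ∞)) {t : Finset Pt} (ht : t ∈ W.fill) :
    OrderKTri P k t := by
  obtain ⟨⟨h3, hsub, h, H, h0, h1⟩, -⟩ := ht
  refine orderKTri_of (Finset.card_pos.1 (by omega)) H h0 ((Set.encard_le_encard ?_).trans hk)
  rintro p ⟨hp, hneg⟩
  refine ⟨hp, ?_⟩
  by_contra hcon
  exact absurd (h1 p ⟨hp, not_lt.1 hcon⟩) (not_le.2 hneg)

end LeftWitness

lemma diamPow_swap (u v x : Pt) : diamPow v u x = diamPow u v x := by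
  simp only [diamPow]; ring

/-- `p` lies inside the circle through `u`, `v` and the point `s` to the left of `uv`. -/
def InCirc (u v s p : Pt) : Prop :=
  diamPow u v p * orient u v s < diamPow u v s * orient u v p

lemma inCirc_iff {u v s p : Pt} (h : 0 < orient u v s) :
    InCirc u v s p ↔ pencil u v (diamPow u v s / orient u v s) p < 0 := by
  rw [pencil, sub_neg, div_mul_eq_mul_div, lt_div_iff₀ h, InCirc]

/-- One-sided criterion for useful edges. -/
def HalfCrit (P : Set Pt) (k : ℕ) (u v : Pt) : Prop :=
  ∀ s ∈ P, 0 < orient u v s → {p ∈ P | orient u v p < 0 ∧ InCirc u v s p}.encard ≤ (k : ℕ∞)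

lemma exists_leftWitness {P : Set Pt} (hfin : P.Finite) (hP : GenPos P) {u v : Pt} (hu : u ∈ P)
    (hv : v ∈ P) (huv : u ≠ v) (hne : ∃ s ∈ P, 0 < orient u v s) :
    ∃ s τ, LeftWitness P u v s τ ∧ τ = diamPow u v s / orient u v s := by
  obtain ⟨s₀, hs₀, h₀⟩ := hne
  have hL : (hfin.toFinset.filter (fun s => 0 < orient u v s)).Nonempty :=
    ⟨s₀, by simp [hs₀, h₀]⟩
  obtain ⟨s, hs, hmin⟩ := Finset.exists_min_image _ (fun s => diamPow u v s / orient u v s) hL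
  simp only [Finset.mem_filter, Set.Finite.mem_toFinset] at hs hmin
  refine ⟨s, _, ⟨hfin, hP, hu, hv, huv, hs.1, hs.2, ?_, ?_⟩, rfl⟩
  · rw [pencil]
    field_simp [hs.2.ne']
    ring
  · intro p hp h
    have := hmin p ⟨hp, h⟩
    rw [le_div_iff₀ h] at this
    rw [pencil]
    linarith

lemma LeftWitness.order_bound {P : Set Pt} {u v s : Pt} {τ : ℝ} (W : LeftWitness P u v s τ)
    (hτ : τ = diamPow u v s / orient u v s) {k : ℕ} (h : HalfCrit P k u v) :
    {p ∈ P | pencil u v τ p < 0}.encard ≤ (k : ℕ∞) := by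
  refine (Set.encard_le_encard ?_).trans (h s W.hs W.left)
  rintro p ⟨hp, hneg⟩
  refine ⟨hp, ?_, ?_⟩
  · by_contra hc
    exact absurd (W.mem_out hp (not_lt.1 hc)).2 (not_le.2 hneg)
  · rw [inCirc_iff W.left, ← hτ]
    exact hneg

lemma Crosses.exists_left {P : Set Pt} (hP : GenPos P) {u v : Pt} (hu : u ∈ P)
    (hv : v ∈ P) (huv : u ≠ v) {t : Finset Pt} (htP : (t : Set Pt) ⊆ P) (h3 : t.card = 3)
    (hc : Crosses u v t) : ∃ s ∈ P, 0 < orient u v s := by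
  obtain ⟨q, hq, w, w0, w1, w2⟩ := hc
  by_contra! hcon
  have e := (isAff_orient u v).sum w1 w2
  rw [openSegment_orient hq] at e
  have hnp : ∀ p ∈ t, w p * orient u v p ≤ 0 := fun p hp =>
    mul_nonpos_of_nonneg_of_nonpos (w0 p hp).le (hcon p (htP hp))
  have hz := (Finset.sum_eq_zero_iff_of_nonpos hnp).1 e.symm
  have hsub : t ⊆ {u, v} := by
    intro p hp
    have := (mul_eq_zero.1 (hz p hp)).resolve_left (w0 p hp).ne'
    simpa using mem_pair_of_orient hP hu hv huv (htP hp) this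
  have := Finset.card_le_card hsub
  rw [h3, Finset.card_pair huv] at this
  omega

lemma isOrderDT_delTri {P : Set Pt} (hfin : P.Finite) (hP : GenPos P)
    (h_int : (interior (convexHull ℝ P)).Nonempty) (k : ℕ) : IsOrderDT P k (delTri P) := by
  refine ⟨isTriangulation_delTri hfin hP h_int, ?_⟩
  rintro t ⟨h3, hsub, h, H, h0, h1⟩
  refine orderKTri_of (Finset.card_pos.1 (by omega)) H h0 ?_
  rw [show {p ∈ P | h p < 0} = ∅ from
    Set.eq_empty_of_forall_notMem fun p hp => absurd (h1 p hp.1) (not_le.2 hp.2)]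
  simp

lemma disjoint_keep_fill {P : Set Pt} {u v s : Pt} {τ : ℝ} (W : LeftWitness P u v s τ)
    {t t' : Finset Pt} (ht : t ∈ delTri P) (hn : ¬ Crosses u v t) (ht' : t' ∈ W.fill) {z : Pt}
    (hz : PosComb t z) (hz' : z ∈ triSet t') : False := by
  obtain ⟨t₀, ht₀, hc, hzt, -⟩ := mem_crossHalf.1 (ht'.2 hz')
  obtain ⟨A, hA, hzA⟩ := exists_posComb hzt
  have := W.gen.delTri_face subset_rfl subset_rfl ht₀ ht hA subset_rfl
    ((Finset.coe_subset.2 hA).trans ht₀.2.1) ht.2.1 hzA hz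
  subst this
  rw [← Finset.eq_of_subset_of_card_le hA (by rw [ht.1, ht₀.1])] at hc
  exact hn hc

theorem usefulEdge_of_halfCrit {P : Set Pt} (hfin : P.Finite) (hP : GenPos P)
    (h_int : (interior (convexHull ℝ P)).Nonempty) {u v : Pt} (hu : u ∈ P) (hv : v ∈ P)
    (huv : u ≠ v) {k : ℕ} (h1 : HalfCrit P k u v) (h2 : HalfCrit P k v u) : UsefulEdge P k u v := by
  by_cases hno : ∀ t ∈ delTri P, ¬ Crosses u v t
  · obtain ⟨t, ht, h⟩ := hP.exists_edge_of_not_crosses hfin h_int hu hv huv hno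
    exact ⟨_, isOrderDT_delTri hfin hP h_int k, t, ht, h⟩
  push Not at hno
  obtain ⟨t₀, ht₀, hc₀⟩ := hno
  obtain ⟨s, τ, W, hτ⟩ := exists_leftWitness hfin hP hu hv huv
    (hc₀.exists_left hP hu hv huv ht₀.2.1 ht₀.1)
  obtain ⟨s', τ', W', hτ'⟩ := exists_leftWitness hfin hP hv hu huv.symm
    (hc₀.symm.exists_left hP hv hu huv.symm ht₀.2.1 ht₀.1)
  have hdisj : ∀ t ∈ W.fill, ∀ t' ∈ W'.fill, ∀ z, PosComb t z → PosComb t' z → False := by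
    intro t ht t' ht' z hz hz'
    have e1 := W.pos_of_interior ht.1 hz (ht.2 hz.mem_hull)
    have e2 := W'.pos_of_interior ht'.1 hz' (ht'.2 hz'.mem_hull)
    rw [orient_swap] at e2
    linarith
  let K : Set (Finset Pt) := {t ∈ delTri P | ¬ Crosses u v t}
  have hcov : ∀ x ∈ convexHull ℝ P, ∃ t ∈ K ∪ (W.fill ∪ W'.fill), x ∈ triSet t := by
    intro x hx
    obtain ⟨t, ht, hxt⟩ := exists_delTri hfin hP h_int hx
    by_cases hc : Crosses u v t
    · rcases le_total 0 (orient u v x) with h | h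
      · obtain ⟨t', ht', hx'⟩ := W.cover ht hc hxt h
        exact ⟨t', Or.inr (Or.inl ht'), hx'⟩
      · obtain ⟨t', ht', hx'⟩ := W'.cover ht hc.symm hxt (by rw [orient_swap]; linarith)
        exact ⟨t', Or.inr (Or.inr ht'), hx'⟩
    · exact ⟨t, Or.inl ⟨ht, hc⟩, hxt⟩
  have hmem : ∀ t ∈ K ∪ (W.fill ∪ W'.fill), t.card = 3 ∧ (t : Set Pt) ⊆ P := by
    rintro t (ht | ht | ht)
    · exact ⟨ht.1.1, ht.1.2.1⟩
    · exact ⟨ht.1.1, ht.1.2.1.trans W.out_subset⟩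
    · exact ⟨ht.1.1, ht.1.2.1.trans W'.out_subset⟩
  refine ⟨K ∪ (W.fill ∪ W'.fill), ⟨⟨?_, hmem, ?_, ?_, ?_⟩, ?_⟩,
    {u, v, s}, Or.inr (Or.inl (W.edge_mem ht₀ hc₀)), by simp, by simp⟩
  · exact ((delTri_finite hfin).subset (Set.sep_subset _ _)).union
      (((delTri_finite (hfin.subset W.out_subset)).subset (Set.sep_subset _ _)).union
        ((delTri_finite (hfin.subset W'.out_subset)).subset (Set.sep_subset _ _)))
  · intro p hp
    obtain ⟨t, ht, hpt⟩ := hcov p (subset_convexHull ℝ _ hp)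
    refine ⟨t, ht, ?_⟩
    obtain ⟨A, hA, hpA⟩ := exists_posComb hpt
    rcases ht with ht | ht | ht
    · have := hP.delTri_singleton subset_rfl ht.1 hA hp hpA
      exact hA (by simp [this])
    · have := hP.delTri_singleton W.out_subset ht.1 hA (W.vertex_mem_out ht hp hpt) hpA
      exact hA (by simp [this])
    · have := hP.delTri_singleton W'.out_subset ht.1 hA (W'.vertex_mem_out ht hp hpt) hpA
      exact hA (by simp [this])
  · intro t ht t' ht' hne
    by_contra hcon
    obtain ⟨z, hz, hz'⟩ := Set.nonempty_iff_ne_empty.2 hcon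
    rw [interior_triSet (hP.affineIndependent (hmem t ht).2 (hmem t ht).1.le) (hmem t ht).1] at hz
    rw [interior_triSet (hP.affineIndependent (hmem t' ht').2 (hmem t' ht').1.le)
      (hmem t' ht').1] at hz'
    change PosComb t z at hz
    change PosComb t' z at hz'
    rcases ht with ht | ht | ht <;> rcases ht' with ht' | ht' | ht'
    · exact hne (hP.delTri_face subset_rfl subset_rfl ht.1 ht'.1 subset_rfl subset_rfl ht.1.2.1
        ht'.1.2.1 hz hz')
    · exact disjoint_keep_fill W ht.1 ht.2 ht' hz hz'.mem_hull
    · exact disjoint_keep_fill W' ht.1 (fun h => ht.2 h.symm) ht' hz hz'.mem_hull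
    · exact disjoint_keep_fill W ht'.1 ht'.2 ht hz' hz.mem_hull
    · exact hne (hP.delTri_face W.out_subset W.out_subset ht.1 ht'.1 subset_rfl subset_rfl
        ht.1.2.1 ht'.1.2.1 hz hz')
    · exact hdisj _ ht _ ht' z hz hz'
    · exact disjoint_keep_fill W' ht'.1 (fun h => ht'.2 h.symm) ht hz' hz.mem_hull
    · exact hdisj _ ht' _ ht z hz' hz
    · exact hne (hP.delTri_face W'.out_subset W'.out_subset ht.1 ht'.1 subset_rfl subset_rfl
        ht.1.2.1 ht'.1.2.1 hz hz')
  · ext x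
    simp only [Set.mem_iUnion, exists_prop]
    exact ⟨fun ⟨t, ht, hx⟩ => triSet_subset_hull (hmem t ht).2 hx, hcov x⟩
  · rintro t (ht | ht | ht)
    · exact (isOrderDT_delTri hfin hP h_int k).2 t ht.1
    · exact W.order (W.order_bound hτ h1) ht
    · exact W'.order (W'.order_bound hτ' h2) ht

lemma IsPow.combo_le {h : Pt → ℝ} (H : IsPow h) {s t : ℝ} (hst : s + t = 1) (hs : 0 ≤ s)
    (ht : 0 ≤ t) (x y : Pt) : h (s • x + t • y) ≤ s * h x + t * h y := by
  obtain ⟨a, b, c, H⟩ := H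
  simp only [H, PiLp.add_apply, PiLp.smul_apply, smul_eq_mul]
  have e : s * (x 0 ^ 2 + x 1 ^ 2 + a * x 0 + b * x 1 + c) +
      t * (y 0 ^ 2 + y 1 ^ 2 + a * y 0 + b * y 1 + c) -
      ((s * x 0 + t * y 0) ^ 2 + (s * x 1 + t * y 1) ^ 2 + a * (s * x 0 + t * y 0) +
        b * (s * x 1 + t * y 1) + c) = s * t * ((x 0 - y 0) ^ 2 + (x 1 - y 1) ^ 2) := by
    obtain rfl : s = 1 - t := by linarith
    ring
  have : 0 ≤ s * t * ((x 0 - y 0) ^ 2 + (x 1 - y 1) ^ 2) := by positivity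
  linarith

lemma exists_frequently_triangle {P : Set Pt} {T : Set (Finset Pt)} (hT : IsTriangulation P T)
    {s m : Pt} (hs : s ∈ convexHull ℝ P) (hm : m ∈ convexHull ℝ P) :
    ∃ t ∈ T, s ∈ triSet t ∧ ∃ ε : ℝ, 0 < ε ∧ s + ε • (m - s) ∈ triSet t := by
  have hone : ∀ᶠ ε in nhdsWithin (0 : ℝ) (Set.Ioi 0), ε < 1 :=
    (Filter.Tendsto.mono_left Filter.tendsto_id nhdsWithin_le_nhds).eventually
      (gt_mem_nhds one_pos)
  have h1 : ∀ᶠ ε in nhdsWithin (0 : ℝ) (Set.Ioi 0), ∃ t ∈ T, s + ε • (m - s) ∈ triSet t := by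
    filter_upwards [self_mem_nhdsWithin, hone] with ε he he1
    have he0 : 0 < ε := he
    have : s + ε • (m - s) ∈ convexHull ℝ P := by
      rw [show s + ε • (m - s) = (1 - ε) • s + ε • m by module]
      exact (convex_convexHull ℝ P) hs hm (by linarith) he0.le (by ring)
    rw [← hT.2.2.2.2] at this
    simpa using this
  have h2 : ∀ᶠ ε in nhdsWithin (0 : ℝ) (Set.Ioi 0), ∀ t ∈ T, s + ε • (m - s) ∈ triSet t →
      s ∈ triSet t := by
    rw [Filter.eventually_all_finite hT.1]
    intro t _
    by_cases hst : s ∈ triSet t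
    · exact Filter.Eventually.of_forall fun _ _ => hst
    · filter_upwards [(tendsto_add_smul s (m - s)).eventually
        ((isClosed_triSet t).isOpen_compl.mem_nhds hst)] with ε he he'
      exact absurd he' he
  obtain ⟨ε, ⟨⟨t, ht, hmt⟩, h2⟩, hpos⟩ := ((h1.and h2).and self_mem_nhdsWithin).exists
  exact ⟨t, ht, h2 t ht hmt, ε, hpos, hmt⟩

lemma IsTriangulation.eq_of_inter {P : Set Pt} (hP : GenPos P) {T : Set (Finset Pt)}
    (hT : IsTriangulation P T) {t t' : Finset Pt} (ht : t ∈ T) (ht' : t' ∈ T) {x : Pt}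
    (hx : x ∈ triSet t) (hx' : PosComb t' x) : t = t' := by
  by_contra hne
  have h1 := hT.2.1 t ht
  have h2 := hT.2.1 t' ht'
  have hx2 : x ∈ interior (triSet t') := by
    rw [interior_triSet (hP.affineIndependent h2.2 h2.1.le) h2.1]
    exact hx'
  rw [← closure_interior_triSet (hP.affineIndependent h1.2 h1.1.le) h1.1, mem_closure_iff] at hx
  obtain ⟨y, hy, hy'⟩ := hx _ isOpen_interior hx2
  have := hT.2.2.2.1 ht ht' hne
  exact Set.notMem_empty y (this ▸ ⟨hy', hy⟩)

lemma IsTriangulation.mem_of_mem_triSet {P : Set Pt} (hP : GenPos P) {T : Set (Finset Pt)}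
    (hT : IsTriangulation P T) {t : Finset Pt} (ht : t ∈ T) {s : Pt} (hs : s ∈ P)
    (hst : s ∈ triSet t) : s ∈ t := by
  obtain ⟨h3, htP⟩ := hT.2.1 t ht
  obtain ⟨A, hA, hsA⟩ := exists_posComb hst
  have hAP : (A : Set Pt) ⊆ P := (Finset.coe_subset.2 hA).trans htP
  by_contra hn
  have hpos := hsA.nonempty.card_pos
  have hc3 := Finset.card_le_card hA
  rw [h3] at hc3
  have : A.card = 1 ∨ A.card = 2 ∨ A.card = 3 := by omega
  rcases this with h | h | h
  · obtain ⟨a, rfl⟩ := Finset.card_eq_one.1 h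
    obtain ⟨w, -, h1, h2⟩ := hsA
    simp only [Finset.sum_singleton] at h1 h2
    rw [h1, one_smul] at h2
    exact hn (h2 ▸ hA (by simp))
  · obtain ⟨a, b, hab, rfl⟩ := Finset.card_eq_two.1 h
    rw [posComb_pair hab] at hsA
    have ha : a ∈ t := hA (by simp)
    have hb : b ∈ t := hA (by simp)
    refine hP.orient_ne (htP ha) (htP hb) hs hab ?_ ?_ (openSegment_orient hsA)
    · rintro rfl; exact hn ha
    · rintro rfl; exact hn hb
  · have := Finset.eq_of_subset_of_card_le hA (by rw [h3, h])
    subst this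
    obtain ⟨t', ht', hst'⟩ := hT.2.2.1 s hs
    have := hT.eq_of_inter hP ht' ht (subset_convexHull ℝ _ hst') hsA
    exact hn (this ▸ hst')

lemma LeftWitness.encard_le {P : Set Pt} {u v s : Pt} {τ : ℝ} (W : LeftWitness P u v s τ) {k : ℕ}
    (hU : UsefulEdge P k u v) : {p ∈ P | pencil u v τ p < 0}.encard ≤ (k : ℕ∞) := by
  obtain ⟨T, ⟨hT, hord⟩, t₁, ht₁, hut, hvt⟩ := hU
  set m : Pt := (1 / 2 : ℝ) • u + (1 / 2 : ℝ) • v with hm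
  have hmo : m ∈ openSegment ℝ u v := ⟨1 / 2, 1 / 2, by norm_num, by norm_num, by norm_num, rfl⟩
  have hseg : ∀ c ∈ openSegment ℝ u v, c ∈ triSet t₁ := fun c hc =>
    (convex_triSet t₁).openSegment_subset (subset_convexHull ℝ _ hut) (subset_convexHull ℝ _ hvt) hc
  have hmP : m ∈ convexHull ℝ P := triSet_subset_hull (hT.2.1 t₁ ht₁).2 (hseg m hmo)
  obtain ⟨t, ht, hst, ε, hε, hεt⟩ :=
    exists_frequently_triangle hT (subset_convexHull ℝ _ W.hs) hmP
  have hs := hT.mem_of_mem_triSet W.gen ht W.hs hst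
  obtain ⟨h3, htP⟩ := hT.2.1 t ht
  have hno : ¬ Crosses u v t := by
    rintro ⟨q, hq, hqt⟩
    have := hT.eq_of_inter W.gen ht₁ ht (hseg q hq) hqt
    subst this
    have hsub : ({u, v, s} : Finset Pt) ⊆ t₁ := by
      intro p hp
      simp only [Finset.mem_insert, Finset.mem_singleton] at hp
      rcases hp with rfl | rfl | rfl <;> assumption
    have := Finset.eq_of_subset_of_card_le hsub (by rw [h3, W.tri.1])
    subst this
    obtain ⟨w, w0, w1, w2⟩ := hqt
    have e := (isAff_orient u v).sum w1 w2
    rw [openSegment_orient hq, Finset.sum_insert (by simp [W.huv, W.su.symm]),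
      Finset.sum_insert (by simp [W.sv.symm]), Finset.sum_singleton] at e
    simp only [orient_left, orient_right, mul_zero, zero_add] at e
    exact (mul_pos (w0 s (by simp)) W.left).ne e
  have hpen_neg : ∀ c ∈ openSegment ℝ u v, pencil u v τ c < 0 := by
    intro c hc
    rw [pencil, openSegment_orient hc]
    have := openSegment_diamPow W.huv hc
    linarith
  have hex : ∀ p : Pt, orient u v p < 0 → pencil u v τ p < 0 →
      ∃ x : ℝ, 0 < x ∧ x < 1 ∧ (1 - x) • s + x • p ∈ openSegment ℝ u v := by
    intro p hp hpp
    have hl := W.left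
    have hden : 0 < orient u v s - orient u v p := by linarith
    have h0 : 0 < orient u v s / (orient u v s - orient u v p) := div_pos hl hden
    have h1 : orient u v s / (orient u v s - orient u v p) < 1 := by
      rw [div_lt_one hden]; linarith
    refine ⟨_, h0, h1, ?_⟩
    set x := orient u v s / (orient u v s - orient u v p) with hx
    have e0 : orient u v ((1 - x) • s + x • p) = 0 := by
      rw [(isAff_orient u v).combo (by ring), hx]
      field_simp
      ring
    refine mem_openSegment_of W.huv e0 ?_
    have := (isPow_pencil u v τ).combo_le (show (1 - x) + x = 1 by ring) (by linarith) h0.le s p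
    rw [W.on, pencil, e0] at this
    nlinarith
  have hray : ∀ b ∈ t, b ≠ s → ∀ y : ℝ, 0 < y → (1 - y) • s + y • b ∈ openSegment ℝ u v →
      False := by
    intro b hb hbs y hy hc
    have h0 := openSegment_orient hc
    rw [(isAff_orient u v).combo (by ring)] at h0
    rcases lt_trichotomy y 1 with h | h | h
    · refine hno (W.gen.crosses_of_side W.hu W.hv htP h3 hs hb W.left.ne' ?_ hbs.symm
        ⟨1 - y, y, by linarith, hy, by ring, rfl⟩ hc)
      intro hb0
      rw [hb0] at h0
      nlinarith [W.left]
    · subst h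
      simp only [sub_self, zero_smul, one_smul, zero_add] at hc
      have hd := openSegment_diamPow W.huv hc
      rcases mem_pair_of_orient W.gen W.hu W.hv W.huv (htP hb) (openSegment_orient hc) with h | h
      · rw [h] at hd
        simp [diamPow] at hd
      · rw [h] at hd
        simp [diamPow] at hd
    · have hbl : 0 < orient u v b := by
        have := W.left
        by_contra hcon
        nlinarith
      have h1 := hpen_neg _ hc
      have hy1 : 0 ≤ 1 - 1 / y := by
        rw [sub_nonneg, div_le_one hy]; exact h.le
      have h2 := (isPow_pencil u v τ).combo_le (show (1 - 1 / y) + 1 / y = 1 by ring) hy1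
        (by positivity) s ((1 - y) • s + y • b)
      have e : (1 - 1 / y) • s + (1 / y) • ((1 - y) • s + y • b) = b := by
        have e1 : (1 - 1 / y) + (1 / y) * (1 - y) = 0 := by field_simp; ring
        have e2 : (1 / y) * y = 1 := by field_simp
        calc _ = ((1 - 1 / y) + (1 / y) * (1 - y)) • s + ((1 / y) * y) • b := by module
          _ = b := by rw [e1, e2]; simp
      rw [e, W.on] at h2
      have h4 := W.min b (htP hb) hbl
      have : 1 / y * pencil u v τ ((1 - y) • s + y • b) < 0 :=
        mul_neg_of_pos_of_neg (by positivity) h1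
      linarith
  obtain ⟨a, b, hab, hte⟩ : ∃ a b, a ≠ b ∧ t.erase s = {a, b} :=
    Finset.card_eq_two.1 (by rw [Finset.card_erase_of_mem hs, h3])
  have hat : a ∈ t.erase s := by simp [hte]
  have hbt : b ∈ t.erase s := by simp [hte]
  rw [Finset.mem_erase] at hat hbt
  have hte' : t = {s, a, b} := by rw [← hte, Finset.insert_erase hs]
  have hD := W.gen.orient_ne W.hs (htP hat.2) (htP hbt.2) hat.1.symm hbt.1.symm hab
  set α : Pt → ℝ := fun x => -orient s b x / orient s a b with hα
  set β : Pt → ℝ := fun x => orient s a x / orient s a b with hβ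
  have hαa : IsAff α := by
    convert (isAff_orient s b).const_mul (-1 / orient s a b) using 2
    simp only [hα]
    ring
  have hβa : IsAff β := by
    convert (isAff_orient s a).const_mul (1 / orient s a b) using 2
    simp only [hβ]
    ring
  have hdec : ∀ x, x = (1 - α x - β x) • s + (α x • a + β x • b) := by
    intro x
    simp only [hα, hβ]
    ext i
    fin_cases i
    · simp
      field_simp
      simp only [orient]
      ring
    · simp
      field_simp
      simp only [orient]
      ring
  have hα1 : α s = 0 ∧ α a = 1 ∧ α b = 0 := by
    refine ⟨by simp [hα], ?_, by simp [hα]⟩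
    simp only [hα]
    rw [orient_swap_right, neg_neg, div_self hD]
  have hβ1 : β s = 0 ∧ β a = 0 ∧ β b = 1 := by
    refine ⟨by simp [hβ], by simp [hβ], ?_⟩
    simp only [hβ]
    rw [div_self hD]
  have hnn : ∀ g : Pt → ℝ, IsAff g → g s = 0 → 0 ≤ g a → 0 ≤ g b → 0 ≤ g m := by
    intro g hg h0 ha hb
    obtain ⟨A, hA, w, w0, w1, w2⟩ := exists_posComb hεt
    have e := hg.sum w1 w2
    rw [show s + ε • (m - s) = (1 - ε) • s + ε • m by module, hg.combo (by ring), h0] at e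
    have : 0 ≤ ∑ p ∈ A, w p * g p := Finset.sum_nonneg fun p hp => by
      refine mul_nonneg (w0 p hp).le ?_
      have := hA hp
      rw [hte'] at this
      simp only [Finset.mem_insert, Finset.mem_singleton] at this
      rcases this with rfl | rfl | rfl
      · exact h0.ge
      · exact ha
      · exact hb
    rw [← e, mul_zero, zero_add] at this
    exact nonneg_of_mul_nonneg_right this hε
  have hαm : 0 ≤ α m := hnn α hαa hα1.1 (by rw [hα1.2.1]; norm_num) hα1.2.2.ge
  have hβm : 0 ≤ β m := hnn β hβa hβ1.1 hβ1.2.1.ge (by rw [hβ1.2.2]; norm_num)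
  have hstrict : ∀ c ∈ openSegment ℝ u v, 0 ≤ α c → 0 ≤ β c → 0 < α c ∧ 0 < β c := by
    intro c hc h1 h2
    have hcs : c ≠ s := by
      rintro rfl
      exact W.left.ne' (openSegment_orient hc)
    have hd := hdec c
    constructor
    · refine h1.lt_of_ne fun h => ?_
      rw [← h, zero_smul, zero_add, sub_zero] at hd
      have hβc : 0 < β c := h2.lt_of_ne fun h' => hcs (by rw [hd, ← h']; simp)
      exact hray b hbt.2 hbt.1 _ hβc (hd ▸ hc)
    · refine h2.lt_of_ne fun h => ?_
      rw [← h, zero_smul, add_zero, sub_zero] at hd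
      have hαc : 0 < α c := h1.lt_of_ne fun h' => hcs (by rw [hd, ← h']; simp)
      exact hray a hat.2 hat.1 _ hαc (hd ▸ hc)
  have hcone : openSegment ℝ u v ⊆ {c | 0 < α c ∧ 0 < β c} := by
    refine (convex_openSegment u v).isPreconnected.subset_left_of_subset_union
      (v := {c | α c < 0 ∨ β c < 0}) ?_ ?_ ?_ ?_ ⟨m, hmo, hstrict m hmo hαm hβm⟩
    · exact (isOpen_lt continuous_const hαa.continuous).inter
        (isOpen_lt continuous_const hβa.continuous)
    · exact (isOpen_lt hαa.continuous continuous_const).union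
        (isOpen_lt hβa.continuous continuous_const)
    · rw [Set.disjoint_left]
      rintro c ⟨h1, h2⟩ (h | h) <;> linarith
    · intro c hc
      by_cases h : α c < 0 ∨ β c < 0
      · exact Or.inr h
      · push Not at h
        exact Or.inl (hstrict c hc h.1 h.2)
  have hout : ∀ b ∈ t, b ≠ s → 0 ≤ pencil u v τ b := by
    intro b hb hbs
    by_contra hcon
    have hcon := not_le.1 hcon
    have hneg : orient u v b < 0 := by
      by_contra hh
      exact absurd (W.mem_out (htP hb) (not_lt.1 hh)).2 (not_le.2 hcon)
    obtain ⟨x, hx0, hx1, hx⟩ := hex b hneg hcon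
    exact hray b hb hbs x hx0 hx
  obtain ⟨h, H, h0, hcard⟩ := (hord t ht).exists_pow ⟨s, hs⟩
  refine (Set.encard_le_encard ?_).trans hcard
  rintro p ⟨hp, hpp⟩
  refine ⟨hp, ?_⟩
  have hneg : orient u v p < 0 := by
    by_contra hh
    exact absurd (W.mem_out hp (not_lt.1 hh)).2 (not_le.2 hpp)
  obtain ⟨x, hx0, hx1, hx⟩ := hex p hneg hpp
  have hg := H.sub (isPow_pencil u v τ)
  obtain ⟨hαc, hβc⟩ := hcone hx
  set c := (1 - x) • s + x • p with hcdef
  have e1 : h c - pencil u v τ c = (1 - x) * (h s - pencil u v τ s) + x *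
    (h p - pencil u v τ p) := hg.combo (by ring) s p
  have e2 : h c - pencil u v τ c = α c * (h a - pencil u v τ a) +
      β c * (h b - pencil u v τ b) := by
    obtain ⟨A, B, C, hg⟩ := hg
    have hs0 := hg s
    simp only [hg]
    simp only [h0 s hs, W.on, sub_self] at hs0
    have d0 := congrArg (fun x : Pt => x 0) (hdec c)
    have d1 := congrArg (fun x : Pt => x 1) (hdec c)
    simp only [PiLp.add_apply, PiLp.smul_apply, smul_eq_mul] at d0 d1
    linear_combination A * d0 + B * d1 - (1 - α c - β c) * hs0
  rw [h0 s hs, W.on, sub_self, mul_zero, zero_add] at e1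
  rw [h0 a hat.2, h0 b hbt.2] at e2
  have ga := hout a hat.2 hat.1
  have gb := hout b hbt.2 hbt.1
  have : x * (h p - pencil u v τ p) ≤ 0 := by
    rw [← e1, e2]
    nlinarith
  have : h p - pencil u v τ p ≤ 0 := by
    by_contra hcon
    nlinarith
  linarith

lemma UsefulEdge.symm {P : Set Pt} {k : ℕ} {u v : Pt} (h : UsefulEdge P k u v) :
    UsefulEdge P k v u := by
  obtain ⟨T, hT, t, ht, h1, h2⟩ := h
  exact ⟨T, hT, t, ht, h2, h1⟩

lemma UsefulEdge.halfCrit {P : Set Pt} (hfin : P.Finite) (hP : GenPos P) {u v : Pt} (hu : u ∈ P)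
    (hv : v ∈ P) (huv : u ≠ v) {k : ℕ} (hU : UsefulEdge P k u v) : HalfCrit P k u v := by
  intro s₀ hs₀ hl₀
  obtain ⟨s, τ, W, hτ⟩ := exists_leftWitness hfin hP hu hv huv ⟨s₀, hs₀, hl₀⟩
  refine (Set.encard_le_encard ?_).trans (W.encard_le hU)
  rintro p ⟨hp, hneg, hin⟩
  refine ⟨hp, ?_⟩
  rw [inCirc_iff hl₀] at hin
  have h1 := W.min s₀ hs₀ hl₀
  have h2 : τ ≤ diamPow u v s₀ / orient u v s₀ := by
    rw [le_div_iff₀ hl₀]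
    rw [pencil] at h1
    linarith
  rw [pencil] at hin ⊢
  nlinarith

theorem usefulEdge_iff {P : Set Pt} (hfin : P.Finite) (hP : GenPos P)
    (h_int : (interior (convexHull ℝ P)).Nonempty) {u v : Pt} (hu : u ∈ P) (hv : v ∈ P)
    (huv : u ≠ v) {k : ℕ} : UsefulEdge P k u v ↔ HalfCrit P k u v ∧ HalfCrit P k v u :=
  ⟨fun h => ⟨h.halfCrit hfin hP hu hv huv, h.symm.halfCrit hfin hP hv hu huv.symm⟩,
    fun h => usefulEdge_of_halfCrit hfin hP h_int hu hv huv h.1 h.2⟩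

/-- One-sided criterion for families of points. -/
def HalfFam (k : ℕ) (u v : Pt) {ι : Type*} (y : ι → Pt) : Prop :=
  ∀ i, 0 < orient u v (y i) →
    {j | orient u v (y j) < 0 ∧ InCirc u v (y i) (y j)}.encard ≤ (k : ℕ∞)

/-- Two-sided criterion for families of points. -/
def CritFam (k : ℕ) (u v : Pt) {ι : Type*} (y : ι → Pt) : Prop :=
  HalfFam k u v y ∧ HalfFam k v u y

/-- The criterion holds for `k` but not for `k - 1`. -/
def ExactFam (k : ℕ) (u v : Pt) {ι : Type*} (y : ι → Pt) : Prop :=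
  CritFam k u v y ∧ ¬ CritFam (k - 1) u v y

lemma halfCrit_range {k : ℕ} {u v : Pt} {ι : Type*} {x : ι → Pt} (hx : Function.Injective x) :
    HalfCrit (Set.range x) k u v ↔ HalfFam k u v x := by
  rw [HalfCrit, Set.forall_mem_range]
  refine forall_congr' fun i => imp_congr_right fun _ => ?_
  rw [← hx.encard_image]
  congr! 2
  ext p
  constructor
  · rintro ⟨⟨j, rfl⟩, h⟩
    exact ⟨j, h, rfl⟩
  · rintro ⟨j, h, rfl⟩
    exact ⟨⟨j, rfl⟩, h⟩

lemma CritFam.mono {k l : ℕ} (h : k ≤ l) {u v : Pt} {ι : Type*} {y : ι → Pt}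
    (hk : CritFam k u v y) : CritFam l u v y :=
  have hkl : (k : ℕ∞) ≤ l := by exact_mod_cast h
  ⟨fun i hi => (hk.1 i hi).trans hkl, fun i hi => (hk.2 i hi).trans hkl⟩

lemma CritFam.symm {k : ℕ} {u v : Pt} {ι : Type*} {y : ι → Pt} (h : CritFam k u v y) :
    CritFam k v u y := ⟨h.2, h.1⟩

lemma critFam_comm {k : ℕ} {u v : Pt} {ι : Type*} {y : ι → Pt} :
    CritFam k v u y ↔ CritFam k u v y := ⟨CritFam.symm, CritFam.symm⟩

lemma exactFam_comm {k : ℕ} {u v : Pt} {ι : Type*} {y : ι → Pt} :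
    ExactFam k v u y ↔ ExactFam k u v y := by
  exact and_congr critFam_comm (not_congr critFam_comm)

/-- Points on the line `uv` are irrelevant. -/
lemma halfFam_comp_of_line {k : ℕ} {u v : Pt} {ι κ : Type*} {y : ι → Pt} {f : κ → ι}
    (hf : Function.Injective f) (h : ∀ i ∉ Set.range f, orient u v (y i) = 0) :
    HalfFam k u v (y ∘ f) ↔ HalfFam k u v y := by
  have key : ∀ s : Pt, {j | orient u v (y j) < 0 ∧ InCirc u v s (y j)}.encard =
      {j | orient u v ((y ∘ f) j) < 0 ∧ InCirc u v s ((y ∘ f) j)}.encard := by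
    intro s
    rw [← hf.encard_image]
    congr 1
    ext j
    constructor
    · rintro ⟨h1, h2⟩
      by_cases hj : j ∈ Set.range f
      · obtain ⟨l, rfl⟩ := hj
        exact ⟨l, ⟨h1, h2⟩, rfl⟩
      · exact absurd (h j hj) h1.ne
    · rintro ⟨l, hl, rfl⟩
      exact hl
  constructor
  · intro H i hi
    by_cases hj : i ∈ Set.range f
    · obtain ⟨l, rfl⟩ := hj
      rw [key]
      exact H l hi
    · exact absurd (h i hj) hi.ne'
  · intro H i hi
    have := H (f i) hi
    rwa [key] at this

lemma exactFam_comp_of_line {k : ℕ} {u v : Pt} {ι κ : Type*} {y : ι → Pt} {f : κ → ι}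
    (hf : Function.Injective f) (h : ∀ i ∉ Set.range f, orient u v (y i) = 0) :
    ExactFam k u v (y ∘ f) ↔ ExactFam k u v y := by
  have h' : ∀ i ∉ Set.range f, orient v u (y i) = 0 := fun i hi => by
    rw [orient_swap, h i hi, neg_zero]
  simp only [ExactFam, CritFam, halfFam_comp_of_line hf h, halfFam_comp_of_line hf h']

lemma exactFam_comp_equiv {k : ℕ} {u v : Pt} {ι κ : Type*} (y : ι → Pt) (e : κ ≃ ι) :
    ExactFam k u v (y ∘ e) ↔ ExactFam k u v y :=
  exactFam_comp_of_line e.injective fun i hi => absurd (e.surjective i) hi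

lemma encard_le_iff {ι : Type*} {s : Set ι} {k : ℕ} :
    s.encard ≤ (k : ℕ∞) ↔ ∀ J : Finset ι, (∀ j ∈ J, j ∈ s) → J.card ≤ k := by
  constructor
  · intro h J hJ
    have : (J : Set ι).encard ≤ k := (Set.encard_le_encard hJ).trans h
    rw [Set.encard_coe_eq_coe_finsetCard] at this
    exact_mod_cast this
  · intro h
    by_contra hc
    rw [not_le] at hc
    obtain ⟨t, ht, htk⟩ := Set.exists_subset_encard_eq (k := k + 1) (s := s)
      (by simpa using Order.add_one_le_of_lt hc)
    have hfin : t.Finite := Set.finite_of_encard_eq_coe (k := k + 1) (by simpa using htk)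
    have := h hfin.toFinset (fun j hj => ht (by simpa using hj))
    rw [hfin.encard_eq_coe_toFinset_card] at htk
    have h2 : hfin.toFinset.card = k + 1 := by exact_mod_cast htk
    omega

section Measurability

variable {Ω ι : Type*} [MeasurableSpace Ω] [Finite ι]

lemma measurable_encard_le {p : ι → Ω → Prop} (hp : ∀ i, Measurable (p i)) (k : ℕ) :
    Measurable fun ω => {j | p j ω}.encard ≤ (k : ℕ∞) := by
  simp only [encard_le_iff]
  refine Measurable.forall fun J => Measurable.imp ?_ measurable_const
  exact Measurable.forall fun j => Measurable.imp measurable_const (hp j)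

lemma measurable_lt' {f g : Ω → ℝ} (hf : Measurable f) (hg : Measurable g) :
    Measurable fun ω => f ω < g ω := measurableSet_setOfPred.1 (measurableSet_lt hf hg)

lemma measurable_coord {f : Ω → Pt} (hf : Measurable f) (i : Fin 2) : Measurable fun ω => f ω i :=
  (show Continuous fun x : Pt => x i by fun_prop).measurable.comp hf

lemma measurable_orient {U V W : Ω → Pt} (hU : Measurable U) (hV : Measurable V)
    (hW : Measurable W) : Measurable fun ω => orient (U ω) (V ω) (W ω) := by
  have := measurable_coord hU
  have := measurable_coord hV
  have := measurable_coord hW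
  unfold orient
  fun_prop

lemma measurable_diamPow {U V W : Ω → Pt} (hU : Measurable U) (hV : Measurable V)
    (hW : Measurable W) : Measurable fun ω => diamPow (U ω) (V ω) (W ω) := by
  have := measurable_coord hU
  have := measurable_coord hV
  have := measurable_coord hW
  unfold diamPow
  fun_prop

lemma measurable_halfFam (k : ℕ) {U V : Ω → Pt} {Y : Ω → ι → Pt} (hU : Measurable U)
    (hV : Measurable V) (hY : Measurable Y) : Measurable fun ω => HalfFam k (U ω) (V ω) (Y ω) := by
  have hYi : ∀ i, Measurable fun ω => Y ω i := fun i => (measurable_pi_apply i).comp hY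
  have ho := fun i => measurable_orient hU hV (hYi i)
  have hd := fun i => measurable_diamPow hU hV (hYi i)
  refine Measurable.forall fun i => Measurable.imp (measurable_lt' measurable_const (ho i)) ?_
  refine measurable_encard_le (fun j => ?_) k
  exact (measurable_lt' (ho j) measurable_const).and
    (measurable_lt' ((hd j).mul (ho i)) ((hd i).mul (ho j)))

lemma measurable_exactFam (k : ℕ) {U V : Ω → Pt} {Y : Ω → ι → Pt} (hU : Measurable U)
    (hV : Measurable V) (hY : Measurable Y) : Measurable fun ω => ExactFam k (U ω) (V ω) (Y ω) :=
  ((measurable_halfFam k hU hV hY).and (measurable_halfFam k hV hU hY)).and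
    ((measurable_halfFam (k - 1) hU hV hY).and (measurable_halfFam (k - 1) hV hU hY)).not

end Measurability

/-- The open half disk with diameter `uv` on the left of `uv`. -/
def halfDisk (u v : Pt) : Set Pt := {x | 0 < orient u v x ∧ diamPow u v x < 0}

lemma CritFam.half_le {k : ℕ} {u v : Pt} {ι : Type*} {y : ι → Pt} (h : CritFam k u v y) :
    {i | y i ∈ halfDisk u v}.encard ≤ (k : ℕ∞) ∨ {i | y i ∈ halfDisk v u}.encard ≤ (k : ℕ∞) := by
  by_cases hne : ∃ i, y i ∈ halfDisk u v
  · obtain ⟨i, hi⟩ := hne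
    refine Or.inr ((Set.encard_le_encard ?_).trans (h.1 i hi.1))
    rintro j ⟨h1, h2⟩
    rw [orient_swap] at h1
    rw [diamPow_swap] at h2
    refine ⟨by linarith, ?_⟩
    have e1 := mul_pos_of_neg_of_neg hi.2 (show orient u v (y j) < 0 by linarith)
    have e2 := mul_neg_of_neg_of_pos h2 hi.1
    exact e2.trans e1
  · left
    rw [show {i | y i ∈ halfDisk u v} = ∅ from Set.eq_empty_of_forall_notMem fun i hi => hne ⟨i, hi⟩]
    simp

lemma orient_smul (u w z : Pt) (c : ℝ) :
    orient u (u + c • w) (u + c • z) = c ^ 2 * orient 0 w z := by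
  simp [orient]; ring

lemma diamPow_smul (u w z : Pt) (c : ℝ) :
    diamPow u (u + c • w) (u + c • z) = c ^ 2 * diamPow 0 w z := by
  simp [diamPow]; ring

lemma orient_smul' (u w z : Pt) (c : ℝ) :
    orient (u + c • w) u (u + c • z) = c ^ 2 * orient w 0 z := by
  simp [orient]; ring

lemma diamPow_smul' (u w z : Pt) (c : ℝ) :
    diamPow (u + c • w) u (u + c • z) = c ^ 2 * diamPow w 0 z := by
  simp [diamPow]; ring

lemma exactFam_smul {k : ℕ} (u w : Pt) {c : ℝ} (hc : 0 < c) {ι : Type*} (z : ι → Pt) :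
    ExactFam k u (u + c • w) (fun i => u + c • z i) ↔ ExactFam k 0 w z := by
  have hc2 : 0 < c ^ 2 := by positivity
  have e1 : ∀ a, 0 < c ^ 2 * a ↔ 0 < a := fun a => by rw [mul_pos_iff_of_pos_left hc2]
  have e2 : ∀ a, c ^ 2 * a < 0 ↔ a < 0 := fun a =>
    ⟨fun h => (pos_iff_neg_of_mul_neg h).1 hc2, mul_neg_of_pos_of_neg hc2⟩
  have e3 : ∀ a b d e : ℝ, c ^ 2 * a * (c ^ 2 * b) < c ^ 2 * d * (c ^ 2 * e) ↔ a * b < d * e := by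
    intro a b d e
    rw [show c ^ 2 * a * (c ^ 2 * b) = (c ^ 2 * c ^ 2) * (a * b) by ring,
      show c ^ 2 * d * (c ^ 2 * e) = (c ^ 2 * c ^ 2) * (d * e) by ring]
    exact mul_lt_mul_iff_right₀ (by positivity)
  simp only [ExactFam, CritFam, HalfFam, InCirc, orient_smul, diamPow_smul, orient_smul',
    diamPow_smul', e1, e2, e3]

section UniformPoints

open MeasureTheory Filter

lemma measurableSet_unitSq : MeasurableSet unitSq :=
  ((measurable_coord measurable_id 0) measurableSet_Icc).inter
    ((measurable_coord measurable_id 1) measurableSet_Icc)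

/-- Axis-parallel rectangles. -/
def rect (I J : Set ℝ) : Set Pt := {p | p 0 ∈ I ∧ p 1 ∈ J}

lemma volume_rect {I J : Set ℝ} (hI : MeasurableSet I) (hJ : MeasurableSet J) :
    volume (rect I J) = volume I * volume J := by
  have hm : MeasurableSet (Set.univ.pi ![I, J]) :=
    MeasurableSet.univ_pi fun i => by fin_cases i <;> simpa
  have h := (EuclideanSpace.volume_preserving_symm_measurableEquiv_toLp (Fin 2)).measure_preimage
    hm.nullMeasurableSet
  rw [volume_pi_pi] at h
  simp only [Fin.prod_univ_two, Matrix.cons_val_zero, Matrix.cons_val_one] at h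
  rw [← h]
  congr 1
  ext p
  simp only [rect, mem_ofPred_eq, Set.mem_preimage, Set.mem_univ_pi, Fin.forall_fin_two]
  exact Iff.rfl

lemma volume_unitSq : volume unitSq = 1 := by
  have := volume_rect (measurableSet_Icc (a := (0 : ℝ)) (b := 1))
    (measurableSet_Icc (a := (0 : ℝ)) (b := 1))
  rw [show unitSq = rect (Icc 0 1) (Icc 0 1) from rfl, this]
  simp

instance : IsProbabilityMeasure unifSq := ⟨by simp [unifSq, volume_unitSq]⟩

instance (n : ℕ) : IsProbabilityMeasure (conf n) := by unfold conf; infer_instance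

lemma ae_pi_of_update {ι X : Type*} [Fintype ι] [DecidableEq ι] [MeasurableSpace X] (μ : Measure X)
    [SigmaFinite μ] (i : ι) {p : (ι → X) → Prop} (hp : Measurable p)
    (h : ∀ x, ∀ᵐ y ∂μ, p (Function.update x i y)) : ∀ᵐ x ∂Measure.pi fun _ : ι => μ, p x := by
  have hm : MeasurableSet {x | ¬ p x} := measurableSet_setOfPred.2 hp.not
  have hf : Measurable ({x | ¬ p x}.indicator (1 : (ι → X) → ENNReal)) := measurable_one.indicator hm
  rw [ae_iff, ← lintegral_indicator_one hm]
  rw [lintegral_eq_of_lmarginal_eq (μ := fun _ : ι => μ) {i} hf measurable_zero]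
  · simp
  · ext x
    rw [lmarginal_singleton, lmarginal_singleton]
    refine lintegral_congr_ae ?_
    filter_upwards [h x] with y hy
    simp [hy]

lemma orient_eq_zero_of_collinear {u v w : Pt} (h : Collinear ℝ {u, v, w}) :
    orient u v w = 0 := by
  rw [collinear_iff_of_mem (p₀ := u) (by simp)] at h
  obtain ⟨d, h⟩ := h
  obtain ⟨a, ha⟩ := h v (by simp)
  obtain ⟨b, hb⟩ := h w (by simp)
  subst ha hb
  simp [orient]
  ring

lemma inCirc_eq_of_cospherical {u v s p : Pt} (h : Cospherical {u, v, s, p}) :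
    diamPow u v p * orient u v s = diamPow u v s * orient u v p := by
  obtain ⟨c, r, h⟩ := h
  have e : ∀ x ∈ ({u, v, s, p} : Set Pt), (x 0 - c 0) ^ 2 + (x 1 - c 1) ^ 2 = r ^ 2 :=
    fun x hx => by rw [← dist_sq_eq, h x hx]
  have hu := e u (by simp)
  have hv := e v (by simp)
  have hs := e s (by simp)
  have hp := e p (by simp)
  simp only [orient, diamPow]
  linear_combination ((v 0 - u 0) * (s 1 - u 1) - (v 1 - u 1) * (s 0 - u 0)) * (hp - hu) -
    ((v 0 - u 0) * (p 1 - u 1) - (v 1 - u 1) * (p 0 - u 0)) * (hs - hu) +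
    ((s 0 - u 0) * (p 1 - u 1) - (s 1 - u 1) * (p 0 - u 0)) * (hv - hu)

lemma null_orient {u v : Pt} (h : u ≠ v) : volume {x | orient u v x = 0} = 0 := by
  let L : Pt →ₗ[ℝ] ℝ :=
    { toFun := fun x => (v 0 - u 0) * x 1 - (v 1 - u 1) * x 0
      map_add' := fun x y => by simp; ring
      map_smul' := fun c x => by simp; ring }
  have hL : ∀ x, L x = (v 0 - u 0) * x 1 - (v 1 - u 1) * x 0 := fun _ => rfl
  let A := AffineSubspace.mk' u (LinearMap.ker L)
  have hA : ∀ x, x ∈ A ↔ orient u v x = 0 := fun x => by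
    rw [AffineSubspace.mem_mk', LinearMap.mem_ker, hL, orient]
    simp
  have := Measure.addHaar_affineSubspace volume A ?_
  · convert this using 2
    ext x
    exact (hA x).symm
  · intro hT
    have h1 : (!₂[u 0 - (v 1 - u 1), u 1 + (v 0 - u 0)] : Pt) ∈ A := by
      rw [hT]; trivial
    rw [hA] at h1
    simp [orient] at h1
    apply h
    ext i
    fin_cases i <;> simp <;> nlinarith [sq_nonneg (v 0 - u 0), sq_nonneg (v 1 - u 1)]

lemma null_circ {u v s : Pt} (h : orient u v s ≠ 0) :
    volume {p | diamPow u v p * orient u v s = diamPow u v s * orient u v p} = 0 := by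
  have h1 : IsPow (pencil u v (diamPow u v s / orient u v s)) := isPow_pencil _ _ _
  obtain ⟨z, r, -, hz⟩ := h1.exists_circle (a := u) (by simp [pencil, diamPow])
  refine measure_mono_null ?_ (Measure.addHaar_sphere volume z |r|)
  intro p hp
  have : pencil u v (diamPow u v s / orient u v s) p = 0 := by
    rw [pencil]
    field_simp
    have : diamPow u v p * orient u v s = diamPow u v s * orient u v p := hp
    linarith
  rw [hz] at this
  rw [Metric.mem_sphere, ← abs_of_nonneg (dist_nonneg (x := p) (y := z))]
  exact (sq_eq_sq_iff_abs_eq_abs _ _).1 (sub_eq_zero.1 this)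

lemma measurable_ne' {Ω : Type*} [MeasurableSpace Ω] {f g : Ω → ℝ} (hf : Measurable f)
    (hg : Measurable g) : Measurable fun ω => f ω ≠ g ω :=
  (measurableSet_setOfPred.1 (measurableSet_eq_fun hf hg)).not

lemma ae_unifSq_of_null {s : Set Pt} (h : volume s = 0) : ∀ᵐ y ∂unifSq, y ∉ s :=
  ae_restrict_of_ae (measure_eq_zero_iff_ae_notMem.1 h)

lemma ae_conf_injective (n : ℕ) : ∀ᵐ x ∂conf n, Function.Injective x := by
  have : ∀ᵐ x ∂conf n, ∀ i j : Fin n, i ≠ j → x i ≠ x j := by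
    rw [ae_all_iff]; intro i
    rw [ae_all_iff]; intro j
    by_cases hij : i = j
    · simp [hij]
    simp only [ne_eq, hij, not_false_eq_true, true_imp_iff]
    refine ae_pi_of_update unifSq i ?_ fun x => ?_
    · exact (measurableSet_setOfPred.1
        (measurableSet_eq_fun (measurable_pi_apply i) (measurable_pi_apply j))).not
    · filter_upwards [ae_unifSq_of_null (measure_singleton (x j))] with y hy
      simpa [Function.update_of_ne (Ne.symm hij)] using hy
  filter_upwards [this] with x hx i j hij
  by_contra hc
  exact hx i j hc hij

lemma ae_conf_orient (n : ℕ) : ∀ᵐ x ∂conf n, ∀ i j l : Fin n, i ≠ j → i ≠ l → j ≠ l →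
    orient (x i) (x j) (x l) ≠ 0 := by
  rw [ae_all_iff]; intro i
  rw [ae_all_iff]; intro j
  rw [ae_all_iff]; intro l
  by_cases h : i ≠ j ∧ i ≠ l ∧ j ≠ l
  · obtain ⟨h1, h2, h3⟩ := h
    have := ae_pi_of_update unifSq l
      (p := fun x : Fin n → Pt => x i ≠ x j → orient (x i) (x j) (x l) ≠ 0) ?_ fun x => ?_
    · filter_upwards [this, ae_conf_injective n] with x hx hi _ _ _
      exact hx (hi.ne h1)
    · exact ((measurableSet_setOfPred.1
        (measurableSet_eq_fun (measurable_pi_apply i) (measurable_pi_apply j))).not).imp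
        (measurable_ne' (measurable_orient (measurable_pi_apply i) (measurable_pi_apply j)
          (measurable_pi_apply l)) measurable_const)
    · by_cases hx : x i = x j
      · simp [Function.update_of_ne h2, Function.update_of_ne h3, hx]
      · filter_upwards [ae_unifSq_of_null (null_orient hx)] with y hy _
        simpa [Function.update_of_ne h2, Function.update_of_ne h3] using hy
  · refine Eventually.of_forall fun x h1 h2 h3 => absurd ⟨h1, h2, h3⟩ h

lemma ae_conf_circ (n : ℕ) : ∀ᵐ x ∂conf n, ∀ i j l m : Fin n,
    i ≠ j → i ≠ l → i ≠ m → j ≠ l → j ≠ m → l ≠ m →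
    diamPow (x i) (x j) (x m) * orient (x i) (x j) (x l) ≠
      diamPow (x i) (x j) (x l) * orient (x i) (x j) (x m) := by
  rw [ae_all_iff]; intro i
  rw [ae_all_iff]; intro j
  rw [ae_all_iff]; intro l
  rw [ae_all_iff]; intro m
  by_cases h : i ≠ j ∧ i ≠ l ∧ i ≠ m ∧ j ≠ l ∧ j ≠ m ∧ l ≠ m
  · obtain ⟨h1, h2, h3, h4, h5, h6⟩ := h
    have hi := measurable_pi_apply (X := fun _ : Fin n => Pt) i
    have hj := measurable_pi_apply (X := fun _ : Fin n => Pt) j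
    have hl := measurable_pi_apply (X := fun _ : Fin n => Pt) l
    have hm := measurable_pi_apply (X := fun _ : Fin n => Pt) m
    have := ae_pi_of_update unifSq m
      (p := fun x : Fin n → Pt => orient (x i) (x j) (x l) ≠ 0 →
        diamPow (x i) (x j) (x m) * orient (x i) (x j) (x l) ≠
      diamPow (x i) (x j) (x l) * orient (x i) (x j) (x m)) ?_ fun x => ?_
    · filter_upwards [this, ae_conf_orient n] with x hx ho _ _ _ _ _ _
      exact hx (ho i j l h1 h2 h4)
    · exact (measurable_ne' (measurable_orient hi hj hl) measurable_const).imp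
        (measurable_ne' ((measurable_diamPow hi hj hm).mul (measurable_orient hi hj hl))
          ((measurable_diamPow hi hj hl).mul (measurable_orient hi hj hm)))
    · by_cases hx : orient (x i) (x j) (x l) = 0
      · simp [Function.update_of_ne h3, Function.update_of_ne h5, Function.update_of_ne h6, hx]
      · filter_upwards [ae_unifSq_of_null (null_circ hx)] with y hy _
        simpa [Function.update_of_ne h3, Function.update_of_ne h5, Function.update_of_ne h6]
          using hy
  · exact Eventually.of_forall fun x h1 h2 h3 h4 h5 h6 => absurd ⟨h1, h2, h3, h4, h5, h6⟩ h

lemma ae_conf_genPos (n : ℕ) : ∀ᵐ x ∂conf n, Function.Injective x ∧ GenPos (Set.range x) := by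
  filter_upwards [ae_conf_injective n, ae_conf_orient n, ae_conf_circ n] with x h1 h2 h3
  refine ⟨h1, ?_, ?_⟩
  · rintro _ _ _ ⟨i, rfl⟩ ⟨j, rfl⟩ ⟨l, rfl⟩ a b c hc
    exact h2 i j l (ne_of_apply_ne x a) (ne_of_apply_ne x b) (ne_of_apply_ne x c)
      (orient_eq_zero_of_collinear hc)
  · rintro _ _ _ _ ⟨i, rfl⟩ ⟨j, rfl⟩ ⟨l, rfl⟩ ⟨m, rfl⟩ a b c d e f hc
    exact h3 i j l m (ne_of_apply_ne x a) (ne_of_apply_ne x b) (ne_of_apply_ne x c)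
      (ne_of_apply_ne x d) (ne_of_apply_ne x e) (ne_of_apply_ne x f) (inCirc_eq_of_cospherical hc)

/-- Chernoff-type bound for the number of points in a set. -/
lemma pi_real_encard_le {X : Type*} [MeasurableSpace X] (ν : Measure X) [IsProbabilityMeasure ν]
    {A : Set X} (hA : MeasurableSet A) (k N : ℕ) :
    (Measure.pi fun _ : Fin N => ν).real {y | {i | y i ∈ A}.encard ≤ (k : ℕ∞)} ≤
      2 ^ k * Real.exp (-(N * ν.real A) / 2) := by
  classical
  let f : X → ℝ := fun x => 1 - A.indicator (fun _ => (1 / 2 : ℝ)) x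
  have hf0 : ∀ x, 0 ≤ f x := fun x => by
    by_cases h : x ∈ A <;> simp [f, h]
    norm_num
  have hf1 : ∀ x, f x ≤ 1 := fun x => by
    by_cases h : x ∈ A <;> simp [f, h]
  have hfi : ∫ x, f x ∂ν = 1 - ν.real A / 2 := by
    rw [integral_sub (integrable_const _) ((integrable_const _).indicator hA),
      integral_indicator_const _ hA]
    simp; ring
  have hprod : ∫ y : Fin N → X, ∏ i, f (y i) ∂(Measure.pi fun _ => ν) =
      (1 - ν.real A / 2) ^ N := by
    rw [integral_fintype_prod_eq_prod (fun _ => f)]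
    simp [hfi]
  have hfm : Measurable f := measurable_const.sub (measurable_const.indicator hA)
  have h_int : Integrable (fun y : Fin N → X => ∏ i, f (y i)) (Measure.pi fun _ => ν) := by
    refine Integrable.of_bound (C := 1) ?_ (Eventually.of_forall fun y => ?_)
    · exact (Finset.measurable_prod _ fun i _ => hfm.comp (measurable_pi_apply i)).aestronglyMeasurable
    · rw [Real.norm_of_nonneg (Finset.prod_nonneg fun i _ => hf0 _)]
      exact Finset.prod_le_one (fun i _ => hf0 _) fun i _ => hf1 _
  have hmk := mul_meas_ge_le_integral_of_nonneg (μ := Measure.pi fun _ : Fin N => ν)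
    (f := fun y : Fin N → X => ∏ i, f (y i))
    (Eventually.of_forall fun y => Finset.prod_nonneg fun i _ => hf0 _) h_int ((1 / 2) ^ k)
  rw [hprod] at hmk
  have hsub : (Measure.pi fun _ : Fin N => ν).real {y | {i | y i ∈ A}.encard ≤ (k : ℕ∞)} ≤
      (Measure.pi fun _ : Fin N => ν).real {y | (1 / 2 : ℝ) ^ k ≤ ∏ i, f (y i)} := by
    refine measureReal_mono fun y hy => ?_
    have hc : (Finset.univ.filter fun i => y i ∈ A).card ≤ k := by
      have : {i | y i ∈ A}.encard ≤ (k : ℕ∞) := hy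
      rw [encard_le_iff] at this
      exact this _ fun j hj => by simpa using hj
    have : ∏ i, f (y i) = (1 / 2) ^ (Finset.univ.filter fun i => y i ∈ A).card := by
      rw [← Finset.prod_const, Finset.prod_filter]
      refine Finset.prod_congr rfl fun i _ => ?_
      by_cases h : y i ∈ A <;> simp [f, h]
      norm_num
    simp only [mem_ofPred_eq, this]
    exact pow_le_pow_of_le_one (by norm_num) (by norm_num) hc
  have hexp : (1 - ν.real A / 2) ^ N ≤ Real.exp (-(N * ν.real A) / 2) := by
    have h1 : 1 - ν.real A / 2 ≤ Real.exp (-(ν.real A / 2)) := by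
      have := Real.add_one_le_exp (-(ν.real A / 2)); linarith
    have h2 : ν.real A ≤ 1 := measureReal_le_one
    calc (1 - ν.real A / 2) ^ N ≤ Real.exp (-(ν.real A / 2)) ^ N :=
          pow_le_pow_left₀ (by linarith) h1 N
      _ = _ := by rw [← Real.exp_nat_mul]; congr 1; ring
  have : (1 / 2 : ℝ) ^ k * (2 ^ k) = 1 := by rw [← mul_pow]; norm_num
  calc _ ≤ 2 ^ k * ((1 / 2) ^ k *
        (Measure.pi fun _ : Fin N => ν).real {y | (1 / 2 : ℝ) ^ k ≤ ∏ i, f (y i)}) := by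
        rw [← mul_assoc, mul_comm (2 ^ k), this, one_mul]; exact hsub
    _ ≤ _ := by gcongr; exact hmk.trans hexp

lemma measurableSet_halfDisk (u v : Pt) : MeasurableSet (halfDisk u v) :=
  (measurableSet_lt measurable_const
    (measurable_orient measurable_const measurable_const measurable_id)).inter
    (measurableSet_lt (measurable_diamPow measurable_const measurable_const measurable_id)
      measurable_const)

/-- The probability that `uv` is a useful edge of order exactly `k` given `N` other points. -/
def edgeProb (k N : ℕ) (u v : Pt) : ℝ := (conf N).real {y | ExactFam k u v y}

lemma edgeProb_nonneg (k N : ℕ) (u v : Pt) : 0 ≤ edgeProb k N u v := measureReal_nonneg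

lemma edgeProb_le {k N : ℕ} {u v : Pt} {a : ℝ} (h1 : a ≤ unifSq.real (halfDisk u v))
    (h2 : a ≤ unifSq.real (halfDisk v u)) :
    edgeProb k N u v ≤ 2 ^ (k + 1) * Real.exp (-(N * a) / 2) := by
  have hN : (0 : ℝ) ≤ N := Nat.cast_nonneg N
  have e1 := pi_real_encard_le unifSq (measurableSet_halfDisk u v) k N
  have e2 := pi_real_encard_le unifSq (measurableSet_halfDisk v u) k N
  have e3 : Real.exp (-(N * unifSq.real (halfDisk u v)) / 2) ≤ Real.exp (-(N * a) / 2) := by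
    gcongr
  have e4 : Real.exp (-(N * unifSq.real (halfDisk v u)) / 2) ≤ Real.exp (-(N * a) / 2) := by
    gcongr
  have : edgeProb k N u v ≤ (conf N).real ({y | {i | y i ∈ halfDisk u v}.encard ≤ (k : ℕ∞)} ∪
      {y | {i | y i ∈ halfDisk v u}.encard ≤ (k : ℕ∞)}) :=
    measureReal_mono fun y hy => hy.1.half_le
  have e5 := this.trans (measureReal_union_le _ _)
  simp only [conf] at e5
  calc _ ≤ _ := e5
    _ ≤ 2 ^ k * Real.exp (-(N * a) / 2) + 2 ^ k * Real.exp (-(N * a) / 2) := by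
      refine add_le_add (e1.trans ?_) (e2.trans ?_) <;> gcongr
    _ = _ := by ring

lemma unifSq_real_ge {A B : Set Pt} (hB : MeasurableSet B) (hBA : B ⊆ A) (hBS : B ⊆ unitSq) :
    volume.real B ≤ unifSq.real A := by
  have : volume.real B = unifSq.real B := by
    rw [unifSq, measureReal_restrict_apply hB, inter_eq_left.2 hBS]
  rw [this]
  exact measureReal_mono hBA

lemma volume_real_rect_uIcc (a b c d : ℝ) :
    volume.real (rect (uIcc a b) (uIcc c d)) = |b - a| * |d - c| := by
  rw [measureReal_def, volume_rect measurableSet_uIcc measurableSet_uIcc, uIcc, uIcc,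
    Real.volume_Icc, Real.volume_Icc, ENNReal.toReal_mul, max_sub_min_eq_abs, max_sub_min_eq_abs,
    ENNReal.toReal_ofReal (abs_nonneg _), ENNReal.toReal_ofReal (abs_nonneg _)]

lemma mem_uIcc_affine {u d a b x : ℝ} (h : x ∈ uIcc (u + a * d) (u + b * d)) (hab : a ≤ b) :
    ∃ t ∈ Icc a b, x = u + t * d := by
  rw [← segment_eq_uIcc, segment_eq_image'] at h
  obtain ⟨θ, ⟨h0, h1⟩, rfl⟩ := h
  refine ⟨a + θ * (b - a), ⟨by nlinarith, by nlinarith⟩, ?_⟩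
  simp; ring

lemma halfDisk_ge_rect {u v : Pt} (hu : u ∈ unitSq) (hv : v ∈ unitSq) :
    |v 0 - u 0| * |v 1 - u 1| / 32 ≤ unifSq.real (halfDisk u v) := by
  rcases eq_or_ne ((v 0 - u 0) * (v 1 - u 1)) 0 with h0 | h0
  · rw [← abs_mul, h0]; simp
  have key : ∀ a a' b b' : ℝ, a ∈ Icc (0 : ℝ) 1 → a' ∈ Icc (0 : ℝ) 1 → b ∈ Icc (0 : ℝ) 1 →
      b' ∈ Icc (0 : ℝ) 1 → a < a' → b < b' → 1 / 32 ≤ (a' - a) * (b' - b) →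
      (∀ s ∈ Icc a a', ∀ t ∈ Icc b b', 0 < (t - s) * ((v 0 - u 0) * (v 1 - u 1)) ∧
        0 < s * (1 - s) ∧ 0 < t * (1 - t)) →
      |v 0 - u 0| * |v 1 - u 1| / 32 ≤ unifSq.real (halfDisk u v) := by
    intro a a' b b' ha ha' hb hb' haa hbb hA H
    have hsub := unifSq_real_ge (A := halfDisk u v)
      (B := rect (uIcc (u 0 + a * (v 0 - u 0)) (u 0 + a' * (v 0 - u 0)))
        (uIcc (u 1 + b * (v 1 - u 1)) (u 1 + b' * (v 1 - u 1))))
      (((measurable_coord measurable_id 0) measurableSet_uIcc).inter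
        ((measurable_coord measurable_id 1) measurableSet_uIcc)) ?_ ?_
    · rw [volume_real_rect_uIcc] at hsub
      refine le_trans ?_ hsub
      rw [show u 0 + a' * (v 0 - u 0) - (u 0 + a * (v 0 - u 0)) = (a' - a) * (v 0 - u 0) by ring,
        show u 1 + b' * (v 1 - u 1) - (u 1 + b * (v 1 - u 1)) = (b' - b) * (v 1 - u 1) by ring,
        abs_mul, abs_mul, abs_of_pos (sub_pos.2 haa), abs_of_pos (sub_pos.2 hbb)]
      have : 0 ≤ |v 0 - u 0| * |v 1 - u 1| := by positivity
      nlinarith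
    · rintro x ⟨hx0, hx1⟩
      obtain ⟨s, hs, hx0⟩ := mem_uIcc_affine hx0 haa.le
      obtain ⟨t, ht, hx1⟩ := mem_uIcc_affine hx1 hbb.le
      obtain ⟨h1, h2, h3⟩ := H s hs t ht
      have n0 : 0 < (v 0 - u 0) ^ 2 := by
        have : v 0 - u 0 ≠ 0 := left_ne_zero_of_mul h0
        positivity
      constructor
      · simp only [orient, hx0, hx1]; linarith
      · simp only [diamPow, hx0, hx1]
        nlinarith [mul_pos h2 n0, mul_nonneg h3.le (sq_nonneg (v 1 - u 1))]
    · rintro x ⟨hx0, hx1⟩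
      obtain ⟨s, hs, hx0⟩ := mem_uIcc_affine hx0 haa.le
      obtain ⟨t, ht, hx1⟩ := mem_uIcc_affine hx1 hbb.le
      have c : ∀ p q r : ℝ, p ∈ Icc (0 : ℝ) 1 → q ∈ Icc (0 : ℝ) 1 → r ∈ Icc (0 : ℝ) 1 →
          p + r * (q - p) ∈ Icc (0 : ℝ) 1 := by
        rintro p q r ⟨p0, p1⟩ ⟨q0, q1⟩ ⟨r0, r1⟩
        constructor <;> nlinarith
      refine ⟨?_, ?_⟩
      · rw [hx0]; exact c _ _ _ hu.1 hv.1 ⟨ha.1.trans hs.1, hs.2.trans ha'.2⟩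
      · rw [hx1]; exact c _ _ _ hu.2 hv.2 ⟨hb.1.trans ht.1, ht.2.trans hb'.2⟩
  rcases lt_or_gt_of_ne h0 with h | h
  · refine key (1 / 2) (3 / 4) (1 / 4) (2 / 5) ?_ ?_ ?_ ?_ ?_ ?_ ?_ ?_ <;> try norm_num
    intro s hs1 hs2 t ht1 ht2
    exact ⟨mul_pos_of_neg_of_neg (by linarith) h, mul_pos (by linarith) (by linarith),
      mul_pos (by linarith) (by linarith)⟩
  · refine key (1 / 4) (2 / 5) (1 / 2) (3 / 4) ?_ ?_ ?_ ?_ ?_ ?_ ?_ ?_ <;> try norm_num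
    intro s hs1 hs2 t ht1 ht2
    exact ⟨mul_pos (by linarith) h, mul_pos (by linarith) (by linarith),
      mul_pos (by linarith) (by linarith)⟩

lemma halfDisk_swap (u v : Pt) : halfDisk v u = {x | 0 < -orient u v x ∧ diamPow u v x < 0} := by
  ext x
  rw [halfDisk, mem_ofPred_eq, mem_ofPred_eq, orient_swap, diamPow_swap]

lemma half_ball_aux {p q ξ η h s σ X Y : ℝ} (h0 : 0 < h) (h1 : h ≤ 1 / 2) (hs0 : 0 ≤ s)
    (hsq : s ^ 2 = p ^ 2 + q ^ 2) (hs2 : s ^ 2 ≤ 2) (hσ2 : σ ^ 2 = 1)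
    (hξ : ξ ^ 2 + η ^ 2 < (h / 2 * s / 8) ^ 2)
    (hX : X = 3 / 8 * (h / 2) * p - σ / 8 * (h / 2) * q + ξ)
    (hY : Y = 3 / 8 * (h / 2) * q + σ / 8 * (h / 2) * p + η) :
    0 < σ * (p * Y - q * X) ∧ X * (X - p) + Y * (Y - q) < 0 ∧ |X| ≤ h ∧ |Y| ≤ h := by
  have hspos : 0 < s := by
    rcases hs0.eq_or_lt with e | e
    · rw [← e] at hξ; nlinarith [sq_nonneg ξ, sq_nonneg η]
    · exact e
  have hn : X ^ 2 + Y ^ 2 ≤ 22 / 64 * (h / 2) ^ 2 * s ^ 2 := by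
    have e1 : X ^ 2 + Y ^ 2 + ((3 / 8 * (h / 2) * p - σ / 8 * (h / 2) * q - ξ) ^ 2 +
        (3 / 8 * (h / 2) * q + σ / 8 * (h / 2) * p - η) ^ 2) =
        2 * ((9 + σ ^ 2) / 64 * (h / 2) ^ 2 * (p ^ 2 + q ^ 2)) + 2 * (ξ ^ 2 + η ^ 2) := by
      rw [hX, hY]; ring
    rw [hσ2, ← hsq] at e1
    nlinarith [sq_nonneg (3 / 8 * (h / 2) * p - σ / 8 * (h / 2) * q - ξ),
      sq_nonneg (3 / 8 * (h / 2) * q + σ / 8 * (h / 2) * p - η)]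
  have hcs : ∀ z w : ℝ, z ^ 2 + w ^ 2 = s ^ 2 → |z * ξ + w * η| < h / 2 * s ^ 2 / 8 := by
    intro z w hzw
    refine abs_lt_of_sq_lt_sq ?_ (by positivity)
    have e : (z ^ 2 + w ^ 2) * (ξ ^ 2 + η ^ 2) - (z * ξ + w * η) ^ 2 = (z * η - w * ξ) ^ 2 := by
      ring
    rw [hzw] at e
    calc (z * ξ + w * η) ^ 2 ≤ s ^ 2 * (ξ ^ 2 + η ^ 2) := by
          linarith [sq_nonneg (z * η - w * ξ)]
      _ < s ^ 2 * (h / 2 * s / 8) ^ 2 := mul_lt_mul_of_pos_left hξ (pow_pos hspos 2)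
      _ = _ := by ring
  have h1' := abs_lt.1 (hcs p q hsq.symm)
  have h2' := abs_lt.1 (hcs (-(σ * q)) (σ * p)
    (by rw [hsq]; linear_combination (p ^ 2 + q ^ 2) * hσ2))
  refine ⟨?_, ?_, ?_⟩
  · have : σ * (p * Y - q * X) =
        σ ^ 2 * (h / 2 / 8) * s ^ 2 + (-(σ * q) * ξ + σ * p * η) := by
      rw [hX, hY, hsq]; ring
    rw [this, hσ2]
    linarith [h2'.1]
  · have : X * (X - p) + Y * (Y - q) = X ^ 2 + Y ^ 2 -
        (3 / 8 * (h / 2) * s ^ 2 + (p * ξ + q * η)) := by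
      have : p * X + q * Y = 3 / 8 * (h / 2) * s ^ 2 + (p * ξ + q * η) := by
        rw [hX, hY, hsq]; ring
      linarith
    rw [this]
    have e := mul_pos h0 (pow_pos hspos 2)
    have e2 := mul_le_mul_of_nonneg_right h1 e.le
    linarith [h1'.1]
  · have hh : X ^ 2 + Y ^ 2 ≤ h ^ 2 := by
      linarith [mul_le_mul_of_nonneg_left hs2 (sq_nonneg h), sq_nonneg h]
    exact ⟨abs_le_of_sq_le_sq (by linarith [sq_nonneg Y]) h0.le,
      abs_le_of_sq_le_sq (by linarith [sq_nonneg X]) h0.le⟩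

lemma halfDisk_ge_ball_aux {u v : Pt} (hu' : u ∈ unitSq) (hv : v ∈ unitSq) {h : ℝ} (h0 : 0 < h)
    (hu : u 0 ∈ Icc h (1 - h) ∧ u 1 ∈ Icc h (1 - h)) {σ : ℝ} (hσ : σ = 1 ∨ σ = -1) :
    h ^ 2 * dist v u ^ 2 / 100 ≤
      unifSq.real {x | 0 < σ * orient u v x ∧ diamPow u v x < 0} := by
  obtain ⟨⟨a1, a2⟩, a3, a4⟩ := hu
  have hσ2 : σ ^ 2 = 1 := by rcases hσ with rfl | rfl <;> norm_num
  have hs0 : 0 ≤ dist v u := dist_nonneg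
  have hsq : dist v u ^ 2 = (v 0 - u 0) ^ 2 + (v 1 - u 1) ^ 2 := dist_sq_eq v u
  have hs2 : dist v u ^ 2 ≤ 2 := by
    have e : ∀ a b : ℝ, a ∈ Icc (0 : ℝ) 1 → b ∈ Icc (0 : ℝ) 1 → (b - a) ^ 2 ≤ 1 := by
      rintro a b ⟨_, _⟩ ⟨_, _⟩
      nlinarith
    rw [hsq]
    linarith [e _ _ hu'.1 hv.1, e _ _ hu'.2 hv.2]
  obtain ⟨c, hc⟩ : ∃ c : Pt, c =
    !₂[u 0 + 3 / 8 * (h / 2) * (v 0 - u 0) - σ / 8 * (h / 2) * (v 1 - u 1),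
    u 1 + 3 / 8 * (h / 2) * (v 1 - u 1) + σ / 8 * (h / 2) * (v 0 - u 0)] := ⟨_, rfl⟩
  have hc0 : c 0 = u 0 + 3 / 8 * (h / 2) * (v 0 - u 0) - σ / 8 * (h / 2) * (v 1 - u 1) := by
    simp [hc]
  have hc1 : c 1 = u 1 + 3 / 8 * (h / 2) * (v 1 - u 1) + σ / 8 * (h / 2) * (v 0 - u 0) := by
    simp [hc]
  have key : ∀ x ∈ Metric.ball c (h / 2 * dist v u / 8), _ := fun x hx =>
    half_ball_aux (X := x 0 - u 0) (Y := x 1 - u 1) (ξ := x 0 - c 0) (η := x 1 - c 1)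
      h0 (by linarith) hs0 hsq hs2 hσ2
      (by rw [← dist_sq_eq]; exact pow_lt_pow_left₀ hx dist_nonneg (by norm_num))
      (by rw [hc0]; ring) (by rw [hc1]; ring)
  have hsub := unifSq_real_ge (A := {x | 0 < σ * orient u v x ∧ diamPow u v x < 0})
    (B := Metric.ball c (h / 2 * dist v u / 8)) measurableSet_ball
    (fun x hx => ?_) (fun x hx => ?_)
  · refine le_trans ?_ hsub
    have e : volume.real (Metric.ball c (h / 2 * dist v u / 8)) =
        (h / 2 * dist v u / 8) ^ 2 * Real.pi := by
      rw [measureReal_def, EuclideanSpace.volume_ball_fin_two, ENNReal.toReal_mul,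
        ENNReal.toReal_pow, ENNReal.toReal_ofReal (by positivity),
        ENNReal.toReal_ofReal Real.pi_pos.le]
    rw [e]
    have := Real.pi_gt_three
    have : 0 ≤ (h / 2 * dist v u / 8) ^ 2 := by positivity
    nlinarith
  · obtain ⟨k1, k2, -⟩ := key x hx
    refine ⟨k1, ?_⟩
    rw [diamPow]
    linarith
  · obtain ⟨-, -, k3, k4⟩ := key x hx
    rw [abs_le] at k3 k4
    exact ⟨⟨by linarith, by linarith⟩, by linarith, by linarith⟩

lemma halfDisk_ge_ball {u v : Pt} (hu' : u ∈ unitSq) (hv : v ∈ unitSq) {h : ℝ} (h0 : 0 < h)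
    (hu : u 0 ∈ Icc h (1 - h) ∧ u 1 ∈ Icc h (1 - h)) :
    h ^ 2 * dist v u ^ 2 / 100 ≤ unifSq.real (halfDisk u v) ∧
      h ^ 2 * dist v u ^ 2 / 100 ≤ unifSq.real (halfDisk v u) := by
  constructor
  · simpa [halfDisk] using halfDisk_ge_ball_aux hu' hv h0 hu (Or.inl rfl)
  · simpa [halfDisk_swap] using halfDisk_ge_ball_aux hu' hv h0 hu (Or.inr rfl)

/-- A power-law profile which is integrable both at `0` and at `∞`. -/
def profile (t : ℝ) : ℝ := if |t| ≤ 1 then |t| ^ (-(3 / 4) : ℝ) else |t| ^ (-(5 / 4) : ℝ)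

lemma profile_nonneg (t : ℝ) : 0 ≤ profile t := by
  unfold profile; split_ifs <;> positivity

lemma exp_neg_le_inv {α : ℝ} (h : 0 < α) : Real.exp (-α) ≤ α⁻¹ := by
  rw [Real.exp_neg]
  exact inv_anti₀ h (by linarith [Real.add_one_le_exp α])

lemma exp_neg_le_inv_sq {α : ℝ} (h : 0 < α) : Real.exp (-α) ≤ 2 * (α ^ 2)⁻¹ := by
  rw [Real.exp_neg]
  have := Real.quadratic_le_exp_of_nonneg h.le
  calc (Real.exp α)⁻¹ ≤ (α ^ 2 / 2)⁻¹ := inv_anti₀ (by positivity) (by linarith)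
    _ = _ := by rw [inv_div, div_eq_mul_inv]

lemma exp_neg_le_mixed {a b h α : ℝ} (h0 : 0 < h) (ha : 0 < a) (hb : 0 < b)
    (h1 : a * b / 64 ≤ α) (h2 : h ^ 2 * a ^ 2 / 200 ≤ α) :
    Real.exp (-α) ≤ ((1 / 200 : ℝ) ^ (-(1 / 4) : ℝ) * (1 / 64 : ℝ) ^ (-(3 / 4) : ℝ)) *
      (h ^ (-(1 / 2) : ℝ) * (a ^ (-(5 / 4) : ℝ) * b ^ (-(3 / 4) : ℝ))) := by
  have hα : 0 < α := lt_of_lt_of_le (by positivity) h1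
  have e1 : α⁻¹ = α ^ (-(1 / 4) : ℝ) * α ^ (-(3 / 4) : ℝ) := by
    rw [← Real.rpow_add hα, ← Real.rpow_neg_one]; norm_num
  have e2 : α ^ (-(1 / 4) : ℝ) ≤ (h ^ 2 * a ^ 2 / 200) ^ (-(1 / 4) : ℝ) :=
    Real.rpow_le_rpow_of_nonpos (by positivity) h2 (by norm_num)
  have e3 : α ^ (-(3 / 4) : ℝ) ≤ (a * b / 64) ^ (-(3 / 4) : ℝ) :=
    Real.rpow_le_rpow_of_nonpos (by positivity) h1 (by norm_num)
  have e4 : (h ^ 2 * a ^ 2 / 200) ^ (-(1 / 4) : ℝ) =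
      h ^ (-(1 / 2) : ℝ) * a ^ (-(1 / 2) : ℝ) * (1 / 200 : ℝ) ^ (-(1 / 4) : ℝ) := by
    rw [div_eq_mul_one_div, Real.mul_rpow (by positivity) (by norm_num),
      Real.mul_rpow (by positivity) (by positivity), ← Real.rpow_natCast h, ← Real.rpow_natCast a,
      ← Real.rpow_mul h0.le, ← Real.rpow_mul ha.le]
    norm_num
  have e5 : (a * b / 64) ^ (-(3 / 4) : ℝ) =
      a ^ (-(3 / 4) : ℝ) * b ^ (-(3 / 4) : ℝ) * (1 / 64 : ℝ) ^ (-(3 / 4) : ℝ) := by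
    rw [div_eq_mul_one_div, Real.mul_rpow (by positivity) (by norm_num),
      Real.mul_rpow (by positivity) (by positivity)]
  have e6 : a ^ (-(5 / 4) : ℝ) = a ^ (-(1 / 2) : ℝ) * a ^ (-(3 / 4) : ℝ) := by
    rw [← Real.rpow_add ha]; norm_num
  calc Real.exp (-α) ≤ α⁻¹ := exp_neg_le_inv hα
    _ ≤ (h ^ 2 * a ^ 2 / 200) ^ (-(1 / 4) : ℝ) * (a * b / 64) ^ (-(3 / 4) : ℝ) := by
      rw [e1]; exact mul_le_mul e2 e3 (by positivity) (by positivity)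
    _ = _ := by rw [e4, e5, e6]; ring

lemma exists_exp_neg_le_profile : ∃ C : ℝ, 0 ≤ C ∧ ∀ x y h α : ℝ, 0 < h → h ≤ 1 → x ≠ 0 → y ≠ 0 →
    |x| * |y| / 64 ≤ α → h ^ 2 * (x ^ 2 + y ^ 2) / 200 ≤ α →
    Real.exp (-α) ≤ C * (h ^ (-(1 / 2) : ℝ) * (profile x * profile y)) := by
  refine ⟨8192 + (1 / 200 : ℝ) ^ (-(1 / 4) : ℝ) * (1 / 64 : ℝ) ^ (-(3 / 4) : ℝ), by positivity, ?_⟩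
  intro x y h α h0 h1 hx hy hα1 hα2
  set K := (1 / 200 : ℝ) ^ (-(1 / 4) : ℝ) * (1 / 64 : ℝ) ^ (-(3 / 4) : ℝ) with hK
  have hK0 : 0 ≤ K := by positivity
  have ha : 0 < |x| := abs_pos.2 hx
  have hb : 0 < |y| := abs_pos.2 hy
  have hα : 0 < α := lt_of_lt_of_le (by positivity) hα1
  have hh : 1 ≤ h ^ (-(1 / 2) : ℝ) :=
    Real.one_le_rpow_of_pos_of_le_one_of_nonpos h0 h1 (by norm_num)
  have hpx := profile_nonneg x
  have hpy := profile_nonneg y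
  have hP : 0 ≤ h ^ (-(1 / 2) : ℝ) * (profile x * profile y) := by positivity
  have step1 : ∀ c : ℝ, 0 ≤ c → c ≤ 8192 + K → Real.exp (-α) ≤ c * (h ^ (-(1 / 2) : ℝ) *
      (profile x * profile y)) → Real.exp (-α) ≤ (8192 + K) *
      (h ^ (-(1 / 2) : ℝ) * (profile x * profile y)) := fun c _ hc h =>
    h.trans (mul_le_mul_of_nonneg_right hc hP)
  by_cases hx1 : |x| ≤ 1 <;> by_cases hy1 : |y| ≤ 1
  · refine step1 1 (by norm_num) (by linarith) ?_
    have e1 : 1 ≤ profile x := by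
      rw [profile, if_pos hx1]
      exact Real.one_le_rpow_of_pos_of_le_one_of_nonpos ha hx1 (by norm_num)
    have e2 : 1 ≤ profile y := by
      rw [profile, if_pos hy1]
      exact Real.one_le_rpow_of_pos_of_le_one_of_nonpos hb hy1 (by norm_num)
    have e3 : Real.exp (-α) ≤ 1 := Real.exp_le_one_iff.2 (by linarith)
    rw [one_mul]
    exact e3.trans (one_le_mul_of_one_le_of_one_le hh (one_le_mul_of_one_le_of_one_le e1 e2))
  · refine step1 K hK0 (by linarith) ?_
    rw [profile, profile, if_pos hx1, if_neg hy1, mul_comm (|x| ^ _)]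
    refine exp_neg_le_mixed h0 hb ha (by linarith [mul_comm |x| |y|]) ?_
    rw [sq_abs]
    refine le_trans ?_ hα2
    gcongr
    linarith [sq_nonneg x]
  · refine step1 K hK0 (by linarith) ?_
    rw [profile, profile, if_neg hx1, if_pos hy1]
    refine exp_neg_le_mixed h0 ha hb hα1 ?_
    rw [sq_abs]
    refine le_trans ?_ hα2
    gcongr
    linarith [sq_nonneg y]
  · refine step1 8192 (by norm_num) (by linarith) ?_
    rw [profile, profile, if_neg hx1, if_neg hy1]
    push Not at hx1 hy1
    have e : ∀ a : ℝ, 1 < a → (a ^ 2)⁻¹ ≤ a ^ (-(5 / 4) : ℝ) := fun a h => by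
      rw [← Real.rpow_natCast, ← Real.rpow_neg (by linarith)]
      exact Real.rpow_le_rpow_of_exponent_le h.le (by norm_num)
    calc Real.exp (-α) ≤ 2 * (α ^ 2)⁻¹ := exp_neg_le_inv_sq hα
      _ ≤ 2 * ((|x| * |y| / 64) ^ 2)⁻¹ := by gcongr
      _ = 8192 * (1 * ((|x| ^ 2)⁻¹ * (|y| ^ 2)⁻¹)) := by field_simp; norm_num
      _ ≤ _ := by gcongr <;> exact e _ ‹_›

/-- The distance of a point of the unit square to the boundary. -/
def bdist (u : Pt) : ℝ := min (min (u 0) (1 - u 0)) (min (u 1) (1 - u 1))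

lemma exists_edgeProb_le (k : ℕ) : ∃ C : ℝ, 0 ≤ C ∧ ∀ (N : ℕ) (u w : Pt), 0 < N →
    0 < bdist u → u + (Real.sqrt N)⁻¹ • w ∈ unitSq → w 0 ≠ 0 → w 1 ≠ 0 →
    edgeProb k N u (u + (Real.sqrt N)⁻¹ • w) ≤
      C * (bdist u ^ (-(1 / 2) : ℝ) * (profile (w 0) * profile (w 1))) := by
  obtain ⟨C, hC, H⟩ := exists_exp_neg_le_profile
  refine ⟨2 ^ (k + 1) * C, by positivity, fun N u w hN hu hv h0 h1 => ?_⟩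
  have hN' : (0 : ℝ) < N := by exact_mod_cast hN
  set c := (Real.sqrt N)⁻¹ with hc
  have hc2 : N * c ^ 2 = 1 := by
    rw [hc, inv_pow, Real.sq_sqrt hN'.le]; field_simp
  have hc0 : 0 < c := by positivity
  have b1 : bdist u ≤ u 0 := (min_le_left _ _).trans (min_le_left _ _)
  have b2 : bdist u ≤ 1 - u 0 := (min_le_left _ _).trans (min_le_right _ _)
  have b3 : bdist u ≤ u 1 := (min_le_right _ _).trans (min_le_left _ _)
  have b4 : bdist u ≤ 1 - u 1 := (min_le_right _ _).trans (min_le_right _ _)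
  have huS : u ∈ unitSq := ⟨⟨by linarith, by linarith⟩, by linarith, by linarith⟩
  have hball := halfDisk_ge_ball huS hv hu ⟨⟨b1, by linarith⟩, b3, by linarith⟩
  have hr1 := halfDisk_ge_rect huS hv
  have hr2 := halfDisk_ge_rect hv huS
  rw [abs_sub_comm, abs_sub_comm (u 1)] at hr2
  have d0 : (u + c • w) 0 - u 0 = c * w 0 := by simp
  have d1 : (u + c • w) 1 - u 1 = c * w 1 := by simp
  rw [dist_sq_eq, d0, d1] at hball
  rw [d0, d1, abs_mul, abs_mul, abs_of_pos hc0] at hr1 hr2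
  have := edgeProb_le (k := k) (N := N) (max_le hr1 hball.1) (max_le hr2 hball.2)
  rw [neg_div] at this
  have hu1 : bdist u ≤ 1 := by linarith
  refine this.trans ((mul_le_mul_of_nonneg_left (H _ _ _ _ hu hu1 h0 h1 ?_ ?_)
    (by positivity : (0 : ℝ) ≤ 2 ^ (k + 1))).trans_eq (mul_assoc _ _ _).symm)
  · refine le_trans (le_of_eq ?_) (div_le_div_of_nonneg_right
      (mul_le_mul_of_nonneg_left (le_max_left _ _) hN'.le) zero_le_two)
    linear_combination (-(|w 0| * |w 1|) / 64) * hc2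
  · refine le_trans (le_of_eq ?_) (div_le_div_of_nonneg_right
      (mul_le_mul_of_nonneg_left (le_max_right _ _) hN'.le) zero_le_two)
    linear_combination (-(bdist u ^ 2 * (w 0 ^ 2 + w 1 ^ 2)) / 200) * hc2

lemma integrable_profile : Integrable profile := by
  have h1 : IntegrableOn profile (Ioc 0 1) := by
    have := (intervalIntegral.intervalIntegrable_rpow' (a := 0) (b := 1)
      (r := -(3 / 4)) (by norm_num)).1
    refine this.congr_fun (fun t ht => ?_) measurableSet_Ioc
    simp only [profile, abs_of_pos ht.1, if_pos ht.2]
  have h2 : IntegrableOn profile (Ioi 1) := by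
    have := integrableOn_Ioi_rpow_of_lt (a := -(5 / 4)) (c := 1) (by norm_num) one_pos
    refine this.congr_fun (fun t (ht : 1 < t) => ?_) measurableSet_Ioi
    simp only [profile, abs_of_pos (one_pos.trans ht), if_neg ht.not_ge]
  have h3 : IntegrableOn profile (Ioi 0) := by
    rw [← Ioc_union_Ioi_eq_Ioi zero_le_one]
    exact h1.union h2
  have h4 := h3.integrable_indicator measurableSet_Ioi
  refine (h4.add h4.comp_neg).congr ?_
  filter_upwards [measure_eq_zero_iff_ae_notMem.1 (Real.volume_singleton (a := 0))] with t ht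
  have ht : t ≠ 0 := ht
  rcases lt_or_gt_of_ne ht with h | h
  · simp [indicator, h, h.le, profile, abs_neg]
  · simp [indicator, h, h.le, profile, abs_neg]

lemma integrable_coord_mul {f g : ℝ → ℝ} (hf : Integrable f) (hg : Integrable g) :
    Integrable (fun w : Pt => f (w 0) * g (w 1)) := by
  have := Integrable.fintype_prod (μ := fun _ : Fin 2 => (volume : Measure ℝ)) (f := ![f, g])
    (fun i => by fin_cases i <;> simpa)
  have h := (EuclideanSpace.volume_preserving_symm_measurableEquiv_toLp (Fin 2)).integrable_comp_of_integrable
    this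
  refine h.congr (Eventually.of_forall fun w => ?_)
  simp [Fin.prod_univ_two, Function.comp]

lemma integrable_profile_mul : Integrable (fun w : Pt => profile (w 0) * profile (w 1)) :=
  integrable_coord_mul integrable_profile integrable_profile

lemma rpow_neg_half_le_profile {t : ℝ} (h0 : 0 < t) (h1 : t ≤ 1) :
    t ^ (-(1 / 2) : ℝ) ≤ profile t := by
  rw [profile, abs_of_pos h0, if_pos h1]
  exact Real.rpow_le_rpow_of_exponent_ge h0 h1 (by norm_num)

lemma measurable_bdist : Measurable bdist := by
  have h0 := measurable_coord (Ω := Pt) measurable_id 0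
  have h1 := measurable_coord (Ω := Pt) measurable_id 1
  exact (h0.min (measurable_const.sub h0)).min (h1.min (measurable_const.sub h1))

lemma mem_unitSq_of_bdist {u : Pt} (h : 0 < bdist u) : u ∈ unitSq := by
  simp only [bdist, lt_min_iff] at h
  exact ⟨⟨by linarith, by linarith⟩, by linarith, by linarith⟩

lemma ae_bdist_pos : ∀ᵐ u ∂unifSq, 0 < bdist u := by
  have hn : ∀ c : ℝ, volume (rect {c} univ) = 0 ∧ volume (rect univ {c}) = 0 := fun c => by
    rw [volume_rect (by measurability) (by measurability),
      volume_rect (by measurability) (by measurability)]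
    simp
  filter_upwards [ae_unifSq_of_null (hn 0).1, ae_unifSq_of_null (hn 0).2,
    ae_unifSq_of_null (hn 1).1, ae_unifSq_of_null (hn 1).2,
    ae_restrict_mem measurableSet_unitSq] with u a1 a2 a3 a4 hu
  simp only [rect, mem_ofPred_eq, mem_singleton_iff, mem_univ, and_true, true_and] at a1 a2 a3 a4
  obtain ⟨⟨b1, b2⟩, b3, b4⟩ := hu
  simp only [bdist, lt_min_iff, sub_pos]
  exact ⟨⟨lt_of_le_of_ne b1 (Ne.symm a1), lt_of_le_of_ne b2 a3⟩,
    lt_of_le_of_ne b3 (Ne.symm a2), lt_of_le_of_ne b4 a4⟩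

lemma integrable_bdist_rpow : Integrable (fun u => bdist u ^ (-(1 / 2) : ℝ)) unifSq := by
  have hI : Integrable ((Icc (0 : ℝ) 1).indicator fun _ => (1 : ℝ)) :=
    (integrable_indicator_iff measurableSet_Icc).2 (integrableOn_const (by simp))
  have hp' : Integrable (fun t => profile (1 - t)) := integrable_profile.comp_sub_left 1
  have h1 := ((integrable_coord_mul integrable_profile hI).add
    (integrable_coord_mul hp' hI)).add
    ((integrable_coord_mul hI integrable_profile).add (integrable_coord_mul hI hp'))
  have h2 : Integrable _ unifSq := h1.restrict (s := unitSq)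
  refine h2.mono' (measurable_bdist.pow_const _).aestronglyMeasurable ?_
  filter_upwards [ae_bdist_pos] with u hu
  have hS := mem_unitSq_of_bdist hu
  rw [Real.norm_of_nonneg (by positivity)]
  have i0 : (Icc (0 : ℝ) 1).indicator (fun _ => (1 : ℝ)) (u 0) = 1 := indicator_of_mem hS.1 _
  have i1 : (Icc (0 : ℝ) 1).indicator (fun _ => (1 : ℝ)) (u 1) = 1 := indicator_of_mem hS.2 _
  simp only [Pi.add_apply, i0, i1, mul_one, one_mul]
  have n1 := profile_nonneg (u 0)
  have n2 := profile_nonneg (1 - u 0)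
  have n3 := profile_nonneg (u 1)
  have n4 := profile_nonneg (1 - u 1)
  obtain ⟨⟨b1, b2⟩, b3, b4⟩ := hS
  have key : ∀ t, bdist u = t → t ≤ 1 → bdist u ^ (-(1 / 2) : ℝ) ≤ profile t := fun t ht h => by
    rw [ht]; exact rpow_neg_half_le_profile (ht ▸ hu) h
  have : bdist u = u 0 ∨ bdist u = 1 - u 0 ∨ bdist u = u 1 ∨ bdist u = 1 - u 1 := by
    unfold bdist
    rcases min_choice (min (u 0) (1 - u 0)) (min (u 1) (1 - u 1)) with h | h <;> rw [h]
    · rcases min_choice (u 0) (1 - u 0) with h | h <;> simp [h]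
    · rcases min_choice (u 1) (1 - u 1) with h | h <;> simp [h]
  rcases this with h | h | h | h <;> linarith [key _ h (by linarith)]

lemma integrable_dominator (C : ℝ) : Integrable (fun p : Pt × Pt =>
    C * (bdist p.1 ^ (-(1 / 2) : ℝ) * (profile (p.2 0) * profile (p.2 1))))
    (unifSq.prod volume) :=
  (integrable_bdist_rpow.mul_prod integrable_profile_mul).const_mul C

lemma measurePreserving_comp_equiv {X : Type*} [MeasurableSpace X] (ν : Measure X) [SigmaFinite ν]
    {ι κ : Type*} [Fintype ι] [Fintype κ] (e : κ ≃ ι) :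
    MeasurePreserving (fun y : ι → X => y ∘ e) (Measure.pi fun _ => ν) (Measure.pi fun _ => ν) := by
  have h := measurePreserving_piCongrLeft (α := fun _ : κ => X) (fun _ => ν) e.symm
  refine h.congr (by fun_prop) (Eventually.of_forall fun y => ?_)
  ext j
  simp [MeasurableEquiv.coe_piCongrLeft, Equiv.piCongrLeft_apply]

section Local
variable {X : Type} [MeasurableSpace X] (G : ∀ {ι : Type}, (ι → X) → Prop)

/-- The contribution of the configurations whose points in `A` are exactly those indexed by `J`. -/
lemma pi_real_local_index (ν : Measure X) [IsProbabilityMeasure ν] {A : Set X}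
    (hA : MeasurableSet A) (hG : ∀ {ι : Type} [Finite ι], MeasurableSet {y : ι → X | G y})
    (hinv : ∀ {ι κ : Type} (e : κ ≃ ι) (y : ι → X), G (y ∘ e) ↔ G y) {N : ℕ} (J : Finset (Fin N)) :
    (Measure.pi fun _ : Fin N => ν).real
        {y | (∀ i, y i ∈ A ↔ i ∈ J) ∧ G (fun i : {i // i ∈ J} => y i)} =
      ν.real Aᶜ ^ (N - J.card) * (Measure.pi fun _ : Fin J.card => ν.restrict A).real {z | G z} := by
  classical
  have hp := measurePreserving_piEquivPiSubtypeProd (fun _ : Fin N => ν) (fun i => i ∈ J)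
  rw [show (Subtype.fintype fun i => i ∈ J) = Finset.Subtype.fintype J from
    Subsingleton.elim _ _] at hp
  have hset : {y : Fin N → X | (∀ i, y i ∈ A ↔ i ∈ J) ∧ G (fun i : {i // i ∈ J} => y i)} =
      MeasurableEquiv.piEquivPiSubtypeProd (fun _ : Fin N => X) (fun i => i ∈ J) ⁻¹'
        (({z : {i // i ∈ J} → X | G z} ∩ Set.univ.pi fun _ => A) ×ˢ
          (Set.univ.pi fun _ => Aᶜ)) := by
    ext y
    simp only [mem_ofPred_eq, mem_preimage, mem_prod, mem_inter_iff, Set.mem_pi, mem_univ, true_imp_iff,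
      MeasurableEquiv.piEquivPiSubtypeProd, MeasurableEquiv.coe_mk,
      Equiv.piEquivPiSubtypeProd_apply, Subtype.forall, mem_compl_iff]
    constructor
    · rintro ⟨h, h'⟩
      exact ⟨⟨h', fun i hi => (h i).2 hi⟩, fun i hi => fun hc => hi ((h i).1 hc)⟩
    · rintro ⟨⟨h', h1⟩, h2⟩
      exact ⟨fun i => ⟨fun hi => by_contra fun hc => h2 i hc hi, h1 i⟩, h'⟩
  have hm1 : MeasurableSet ({z : {i // i ∈ J} → X | G z} ∩ Set.univ.pi fun _ => A) :=
    hG.inter (MeasurableSet.univ_pi fun _ => hA)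
  rw [hset, measureReal_def, hp.measure_preimage
    (hm1.prod (MeasurableSet.univ_pi fun _ => hA.compl)).nullMeasurableSet, Measure.prod_prod,
    Measure.pi_pi, ENNReal.toReal_mul, mul_comm, ← Measure.restrict_apply hG,
    Measure.restrict_pi_pi]
  congr 1
  · simp [ENNReal.toReal_pow, measureReal_def, Fintype.card_subtype_compl]
  · have h2 := measurePreserving_comp_equiv (ν.restrict A) J.equivFin.symm
    rw [measureReal_def]
    have : {y : J → X | G y} = (fun y : J → X => y ∘ J.equivFin.symm) ⁻¹' {z | G z} := by
      ext y
      simp [hinv]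
    rw [← h2.measure_preimage hG.nullMeasurableSet, ← this]

lemma pi_real_local (ν : Measure X) [IsProbabilityMeasure ν] {A : Set X}
    (hA : MeasurableSet A) (hG : ∀ {ι : Type} [Finite ι], MeasurableSet {y : ι → X | G y})
    (hinv : ∀ {ι κ : Type} (e : κ ≃ ι) (y : ι → X), G (y ∘ e) ↔ G y) (N : ℕ) :
    (Measure.pi fun _ : Fin N => ν).real {y | G (fun i : {i // y i ∈ A} => y i)} =
      ∑ j ∈ Finset.range (N + 1), (N.choose j : ℝ) * (ν.real Aᶜ ^ (N - j) *
        (Measure.pi fun _ : Fin j => ν.restrict A).real {z | G z}) := by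
  classical
  have hset : {y : Fin N → X | G (fun i : {i // y i ∈ A} => y i)} =
      ⋃ J ∈ (Finset.univ : Finset (Fin N)).powerset,
        {y | (∀ i, y i ∈ A ↔ i ∈ J) ∧ G (fun i : {i // i ∈ J} => y i)} := by
    ext y
    simp only [mem_ofPred_eq, mem_iUnion, Finset.powerset_univ, Finset.mem_univ, exists_true_left]
    constructor
    · intro h
      refine ⟨Finset.univ.filter fun i => y i ∈ A, by simp, ?_⟩
      rw [← hinv (Equiv.subtypeEquivRight (p := fun i => y i ∈ A)
        (q := fun i => i ∈ Finset.univ.filter fun i => y i ∈ A) (by simp))]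
      exact h
    · rintro ⟨J, h, h'⟩
      rw [← hinv (Equiv.subtypeEquivRight (p := fun i => i ∈ J)
        (q := fun i => y i ∈ A) (fun i => (h i).symm))]
      exact h'
  have hmeas : ∀ J : Finset (Fin N), MeasurableSet
      {y : Fin N → X | (∀ i, y i ∈ A ↔ i ∈ J) ∧ G (fun i : {i // i ∈ J} => y i)} := by
    intro J
    refine MeasurableSet.inter ?_ ?_
    · have : {y : Fin N → X | ∀ i, y i ∈ A ↔ i ∈ J} =
        Set.univ.pi fun i => if i ∈ J then A else Aᶜ := by
        ext y
        simp only [mem_ofPred_eq, Set.mem_pi, mem_univ, true_imp_iff]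
        refine forall_congr' fun i => ?_
        by_cases h : i ∈ J <;> simp [h]
      change MeasurableSet {y : Fin N → X | ∀ i, y i ∈ A ↔ i ∈ J}
      exact this ▸ MeasurableSet.univ_pi fun i => by split_ifs <;> [exact hA; exact hA.compl]
    · exact (by fun_prop : Measurable fun y : Fin N → X => fun i : {i // i ∈ J} => y i)
        (hG (ι := {i // i ∈ J}))
  rw [hset, measureReal_biUnion_finset _ fun J _ => hmeas J]
  · rw [Finset.sum_congr rfl fun J _ => pi_real_local_index G ν hA hG hinv J,
      Finset.sum_powerset_apply_card (fun j => ν.real Aᶜ ^ (N - j) *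
        (Measure.pi fun _ : Fin j => ν.restrict A).real {z | G z})]
    simp
  · intro J _ K _ hJK
    refine Set.disjoint_left.2 fun y hy hz => hJK ?_
    ext i
    rw [← hy.1, ← hz.1]

lemma pi_const_smul {Y : Type*} [MeasurableSpace Y] (c : ENNReal) (hc : c ≠ ⊤) (lam : Measure Y)
    [IsFiniteMeasure lam] (j : ℕ) :
    (Measure.pi fun _ : Fin j => c • lam) = c ^ j • Measure.pi fun _ : Fin j => lam := by
  have : IsFiniteMeasure (c • lam) := lam.smul_finite hc
  refine Measure.pi_eq fun s _ => ?_
  simp [Measure.pi_pi, Finset.prod_mul_distrib]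

lemma pi_real_univ_le {Y : Type*} [MeasurableSpace Y] (lam : Measure Y)
    [IsFiniteMeasure lam] (j : ℕ) (s : Set (Fin j → Y)) :
    (Measure.pi fun _ : Fin j => lam).real s ≤ lam.real univ ^ j := by
  refine (measureReal_mono (subset_univ s)).trans_eq ?_
  simp [measureReal_def, Measure.pi_univ]

/-- The probability of a local event for `N` points whose intensity is constant equal to `1`
near the origin converges to the probability of that event for a Poisson process. -/
lemma tendsto_local (ν : ℕ → Measure X) [∀ N, IsProbabilityMeasure (ν N)] {A : Set X}
    (hA : MeasurableSet A) (lam : Measure X) [IsFiniteMeasure lam] (hpos : 0 < lam.real univ)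
    (hν : ∀ᶠ N : ℕ in atTop, (ν N).restrict A = ENNReal.ofReal ((N : ℝ)⁻¹) • lam)
    (hG : ∀ {ι : Type} [Finite ι], MeasurableSet {y : ι → X | G y})
    (hinv : ∀ {ι κ : Type} (e : κ ≃ ι) (y : ι → X), G (y ∘ e) ↔ G y) :
    Tendsto (fun N => (Measure.pi fun _ : Fin N => ν N).real {y | G (fun i : {i // y i ∈ A} => y i)})
      atTop (nhds (∑' j : ℕ, Real.exp (-lam.real univ) / j.factorial *
        (Measure.pi fun _ : Fin j => lam).real {z | G z})) := by
  set β := lam.real univ with hβ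
  set M : ℕ → ℝ := fun j => (Measure.pi fun _ : Fin j => lam).real {z | G z} with hM
  have hM0 : ∀ j, 0 ≤ M j := fun j => measureReal_nonneg
  have hMβ : ∀ j, M j ≤ β ^ j := fun j => pi_real_univ_le lam j _
  have hev : ∀ᶠ N : ℕ in atTop, (Measure.pi fun _ : Fin N => ν N).real
      {y | G (fun i : {i // y i ∈ A} => y i)} =
      ∑' j, (N.choose j : ℝ) * ((1 - β / N) ^ (N - j) * ((N : ℝ)⁻¹ ^ j * M j)) ∧ β / N ≤ 1 ∧ 0 < N := by
    filter_upwards [hν, eventually_gt_atTop 0] with N hN h0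
    have hA1 : (ν N).real A = β / N := by
      rw [measureReal_def, ← Measure.restrict_apply_univ, hN, ← measureReal_def,
        measureReal_ennreal_smul_apply,
        ENNReal.toReal_ofReal (by positivity)]
      field_simp
      rw [hβ]
    refine ⟨?_, hA1 ▸ measureReal_le_one, h0⟩
    rw [pi_real_local G (ν N) hA hG hinv, tsum_eq_sum (s := Finset.range (N + 1))]
    · refine Finset.sum_congr rfl fun j _ => ?_
      rw [hN, pi_const_smul _ ENNReal.ofReal_ne_top, measureReal_ennreal_smul_apply,
        probReal_compl_eq_one_sub hA, hA1, ENNReal.toReal_pow,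
        ENNReal.toReal_ofReal (by positivity)]
    · intro j hj
      rw [Nat.choose_eq_zero_of_lt (by simpa [Nat.lt_succ_iff] using hj)]
      simp
  refine Tendsto.congr' (hev.mono fun N h => h.1.symm) ?_
  refine tendsto_tsum_of_dominated_convergence (bound := fun j => β ^ j / j.factorial)
    (Real.summable_pow_div_factorial β) (fun j => ?_) ?_
  · have h1 := ProbabilityTheory.tendsto_choose_mul_pow_of_tendsto_mul_atTop (p := fun N : ℕ => β / N)
      (r := β) j (tendsto_const_nhds.congr' (by
        filter_upwards [eventually_gt_atTop 0] with N h0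
        field_simp))
    have h2 := h1.mul_const (M j / β ^ j)
    have hbj : β ^ j ≠ 0 := (pow_pos hpos j).ne'
    convert h2 using 2 with N
    · rw [div_pow, inv_pow]; field_simp
    · rw [hM]; field_simp
  · filter_upwards [hev] with N hN j
    obtain ⟨_, h1, h0⟩ := hN
    have hb : 0 ≤ β / N := by positivity
    have hN0 : (0 : ℝ) < N := by exact_mod_cast h0
    rw [Real.norm_of_nonneg (by
      have := hM0 j
      have : 0 ≤ 1 - β / N := by linarith
      positivity)]
    have h3 : (N.choose j : ℝ) ≤ N ^ j / j.factorial := Nat.choose_le_pow_div j N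
    calc (N.choose j : ℝ) * ((1 - β / N) ^ (N - j) * ((N : ℝ)⁻¹ ^ j * M j))
        ≤ (N ^ j / j.factorial) * (1 * ((N : ℝ)⁻¹ ^ j * β ^ j)) := by
          have hp : 0 ≤ (1 - β / (N : ℝ)) ^ (N - j) := pow_nonneg (by linarith) _
          have hq : 0 ≤ (N : ℝ)⁻¹ ^ j * M j := mul_nonneg (by positivity) (hM0 j)
          exact mul_le_mul h3 (mul_le_mul (pow_le_one₀ (by linarith) (by linarith))
            (mul_le_mul_of_nonneg_left (hMβ j) (by positivity)) hq zero_le_one)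
            (mul_nonneg hp hq) (by positivity)
      _ = β ^ j / j.factorial := by rw [inv_pow]; field_simp

lemma tsum_local_ge {lam : Measure X} [IsFiniteMeasure lam] (j : ℕ) :
    Real.exp (-lam.real univ) / j.factorial * (Measure.pi fun _ : Fin j => lam).real {z | G z} ≤
    ∑' j : ℕ, Real.exp (-lam.real univ) / j.factorial *
        (Measure.pi fun _ : Fin j => lam).real {z | G z} := by
  have h0 : ∀ j : ℕ, 0 ≤ Real.exp (-lam.real univ) / j.factorial *
      (Measure.pi fun _ : Fin j => lam).real {z | G z} := fun j =>
    mul_nonneg (by positivity) measureReal_nonneg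
  refine Summable.le_tsum ?_ j fun i _ => h0 i
  refine Summable.of_nonneg_of_le h0 (fun j => ?_)
    ((Real.summable_pow_div_factorial (lam.real univ)).mul_left (Real.exp (-lam.real univ)))
  rw [div_mul_eq_mul_div, mul_div_assoc]
  have := pi_real_univ_le lam j {z | G z}
  gcongr

end Local

/-- The part to the left of `uv` of a disk with `u` and `v` on its boundary. -/
def cap (T : ℝ) (u v : Pt) : Set Pt := {z | 0 < orient u v z ∧ diamPow u v z < T * orient u v z}

/-- The union of two disks through `u` and `v`, symmetric with respect to `uv`,
without the line `uv`. -/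
def lens (T : ℝ) (u v : Pt) : Set Pt := cap T u v ∪ cap T v u

lemma lens_swap (T : ℝ) (u v : Pt) : lens T v u = lens T u v := union_comm _ _

lemma mem_cap_swap {T : ℝ} {u v z : Pt} :
    z ∈ cap T v u ↔ orient u v z < 0 ∧ diamPow u v z < T * -orient u v z := by
  rw [cap, mem_ofPred_eq, orient_swap, diamPow_swap, neg_pos]

lemma HalfFam.comp_subtype {k : ℕ} {u v : Pt} {ι : Type*} {y : ι → Pt} (h : HalfFam k u v y)
    (p : ι → Prop) : HalfFam k u v (fun i : {i // p i} => y i) := by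
  intro i hi
  refine le_trans ?_ (h i hi)
  rw [← Subtype.val_injective.encard_image]
  refine encard_le_encard ?_
  rintro _ ⟨j, hj, rfl⟩
  exact hj

lemma halfFam_lens {k : ℕ} {T : ℝ} {u v : Pt} {ι : Type*} {y : ι → Pt}
    (h1 : ∃ i, y i ∈ cap T u v) (h2 : ¬ {i | y i ∈ cap T v u}.encard ≤ (k : ℕ∞)) :
    HalfFam k u v (fun i : {i // y i ∈ lens T u v} => y i) ↔ HalfFam k u v y := by
  refine ⟨fun H => ?_, fun h => h.comp_subtype _⟩
  have key : ∀ i, y i ∈ cap T u v →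
      {j | orient u v (y j) < 0 ∧ InCirc u v (y i) (y j)}.encard ≤ (k : ℕ∞) := by
    intro i hi
    have h0 := hi.1
    have hH := H ⟨i, Or.inl hi⟩ h0
    rw [← Subtype.val_injective.encard_image] at hH
    refine le_trans (encard_le_encard ?_) hH
    rintro j ⟨hj, hc⟩
    refine ⟨⟨j, ?_⟩, ⟨hj, hc⟩, rfl⟩
    by_contra hn
    have hn1 : T * -orient u v (y j) ≤ diamPow u v (y j) := by
      by_contra! hlt
      exact hn (Or.inr (mem_cap_swap.2 ⟨hj, hlt⟩))
    rw [InCirc] at hc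
    have hτ : diamPow u v (y i) < -T * orient u v (y i) := by
      by_contra! hge
      nlinarith
    refine h2 (le_trans (encard_le_encard ?_) hH)
    intro l hl
    have hl' := mem_cap_swap.1 hl
    refine ⟨⟨l, Or.inr hl⟩, ⟨hl'.1, ?_⟩, rfl⟩
    change diamPow u v (y l) * orient u v (y i) < diamPow u v (y i) * orient u v (y l)
    nlinarith
  intro i hi
  by_cases hic : y i ∈ cap T u v
  · exact key i hic
  · obtain ⟨l, hl⟩ := h1
    refine le_trans (encard_le_encard ?_) (key l hl)
    rintro j ⟨hj, hc⟩
    refine ⟨hj, ?_⟩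
    have hi' : T * orient u v (y i) ≤ diamPow u v (y i) := by
      by_contra! hlt
      exact hic ⟨hi, hlt⟩
    obtain ⟨hl1, hl2⟩ := hl
    rw [InCirc] at hc ⊢
    have e1 : diamPow u v (y j) < T * orient u v (y j) := by
      by_contra! hge
      nlinarith
    nlinarith

lemma exactFam_lens {k : ℕ} {T : ℝ} {u v : Pt} {ι : Type*} {y : ι → Pt}
    (h1 : ¬ {i | y i ∈ cap T u v}.encard ≤ (k : ℕ∞))
    (h2 : ¬ {i | y i ∈ cap T v u}.encard ≤ (k : ℕ∞)) :
    ExactFam k u v (fun i : {i // y i ∈ lens T u v} => y i) ↔ ExactFam k u v y := by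
  have hex : ∀ {a b : Pt}, ¬ {i | y i ∈ cap T a b}.encard ≤ (k : ℕ∞) → ∃ i, y i ∈ cap T a b := by
    intro a b h
    by_contra! hn
    refine h ?_
    rw [show {i | y i ∈ cap T a b} = ∅ from eq_empty_of_forall_notMem hn]
    simp
  have hmono : ∀ {a b : Pt}, ¬ {i | y i ∈ cap T a b}.encard ≤ (k : ℕ∞) →
      ¬ {i | y i ∈ cap T a b}.encard ≤ ((k - 1 : ℕ) : ℕ∞) := fun h hn =>
    h (hn.trans (by exact_mod_cast Nat.sub_le k 1))
  have hs : ∀ l : ℕ, HalfFam l v u (fun i : {i // y i ∈ lens T u v} => y i) ↔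
      HalfFam l v u (fun i : {i // y i ∈ lens T v u} => y i) := fun l => by
    rw [lens_swap]
  simp only [ExactFam, CritFam, hs]
  rw [halfFam_lens (hex h1) h2, halfFam_lens (hex h1) (hmono h2), halfFam_lens (hex h2) h1,
    halfFam_lens (hex h2) (hmono h1)]

/-- The part to the left of `uv` of the intersection of two disks through `u` and `v`. -/
def core (u v : Pt) : Set Pt :=
  {z | 0 < orient u v z ∧ -orient u v z < diamPow u v z ∧ diamPow u v z < 0}

lemma core_subset (u v : Pt) : core u v ⊆ lens 1 u v := by
  rintro z ⟨h1, h2, h3⟩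
  exact Or.inl ⟨h1, by linarith⟩

lemma mem_core_swap {u v z : Pt} :
    z ∈ core v u ↔ orient u v z < 0 ∧ orient u v z < diamPow u v z ∧ diamPow u v z < 0 := by
  rw [core, mem_ofPred_eq, orient_swap, diamPow_swap, neg_pos, neg_neg]

lemma halfFam_of_core {k : ℕ} {u v : Pt} {ι : Type*} {y : ι → Pt}
    (h : ∀ i, y i ∈ lens 1 u v → y i ∈ core u v ∪ core v u)
    (hk : {i | y i ∈ core v u}.encard ≤ (k : ℕ∞)) : HalfFam k u v y := by
  intro i hi
  refine (encard_le_encard ?_).trans hk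
  rintro j ⟨hj, hc⟩
  by_contra hn
  have hj' : j ∉ {i | y i ∈ core v u} := hn
  have hjl : y j ∉ lens 1 u v := fun hl => by
    rcases h j hl with h' | h'
    · exact absurd h'.1 hj.not_gt
    · exact hn h'
  have e1 : -orient u v (y j) ≤ diamPow u v (y j) := by
    by_contra! hlt
    exact hjl (Or.inr (mem_cap_swap.2 ⟨hj, by linarith⟩))
  have e2 : -orient u v (y i) < diamPow u v (y i) := by
    by_cases hl : y i ∈ lens 1 u v
    · rcases h i hl with h' | h'
      · exact h'.2.1
      · exact absurd (mem_core_swap.1 h').1 hi.not_gt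
    · by_contra! hlt
      exact hl (Or.inl ⟨hi, by linarith⟩)
  rw [InCirc] at hc
  nlinarith

/-- A local configuration which forces `ExactFam`. -/
def CoreFam (k : ℕ) (u v : Pt) {ι : Type*} (y : ι → Pt) : Prop :=
  (∀ i, y i ∈ core u v ∪ core v u) ∧ (¬ {i | y i ∈ core u v}.encard ≤ ((0 : ℕ) : ℕ∞)) ∧
    {i | y i ∈ core u v}.encard ≤ (k : ℕ∞) ∧ {i | y i ∈ core v u}.encard ≤ (k : ℕ∞) ∧
    ¬ {i | y i ∈ core v u}.encard ≤ ((k - 1 : ℕ) : ℕ∞)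

lemma encard_subtype_mem {ι : Type*} {y : ι → Pt} {A B : Set Pt} (h : A ⊆ B) :
    {i : {i // y i ∈ B} | y i ∈ A}.encard = {i | y i ∈ A}.encard := by
  rw [← Subtype.val_injective.encard_image]
  congr 1
  ext i
  constructor
  · rintro ⟨j, hj, rfl⟩
    exact hj
  · exact fun hi => ⟨⟨i, h hi⟩, hi, rfl⟩

lemma CoreFam.exactFam {k : ℕ} {u v : Pt} {ι : Type*} {y : ι → Pt}
    (h : CoreFam k u v (fun i : {i // y i ∈ lens 1 u v} => y i)) : ExactFam k u v y := by
  obtain ⟨h0, h1, h2, h3, h4⟩ := h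
  have hs : core v u ⊆ lens 1 u v := lens_swap 1 u v ▸ core_subset v u
  rw [encard_subtype_mem (core_subset u v)] at h1 h2
  rw [encard_subtype_mem hs] at h3 h4
  have h0' : ∀ i, y i ∈ lens 1 u v → y i ∈ core u v ∪ core v u := fun i hi => h0 ⟨i, hi⟩
  refine ⟨⟨halfFam_of_core h0' h3, halfFam_of_core (fun i hi => ?_) h2⟩, fun hn => h4 ?_⟩
  · rw [union_comm]
    exact h0' i (lens_swap 1 u v ▸ hi)
  · obtain ⟨i, hi⟩ : ∃ i, y i ∈ core u v := by
      by_contra! hne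
      refine h1 ?_
      rw [show {i | y i ∈ core u v} = ∅ from eq_empty_of_forall_notMem hne]
      simp
    refine (encard_le_encard ?_).trans (hn.1 i hi.1)
    intro j hj
    obtain ⟨e1, e2, e3⟩ := mem_core_swap.1 hj
    exact ⟨e1, (mul_neg_of_neg_of_pos e3 hi.1).trans (mul_pos_of_neg_of_neg hi.2.2 e1)⟩

lemma coreFam_comp_equiv {k : ℕ} {u v : Pt} {ι κ : Type*} (e : κ ≃ ι) (y : ι → Pt) :
    CoreFam k u v (y ∘ e) ↔ CoreFam k u v y := by
  have h : ∀ A : Set Pt, {i | (y ∘ e) i ∈ A}.encard = {i | y i ∈ A}.encard := fun A => by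
    rw [← e.injective.encard_image]
    congr 1
    ext i
    constructor
    · rintro ⟨j, hj, rfl⟩
      exact hj
    · exact fun hi => ⟨e.symm i, by simpa using hi, by simp⟩
  simp only [CoreFam, h]
  rw [e.forall_congr_left]
  simp

lemma measurableSet_cap (T : ℝ) (u v : Pt) : MeasurableSet (cap T u v) :=
  (measurableSet_lt measurable_const
    (measurable_orient measurable_const measurable_const measurable_id)).inter
    (measurableSet_lt (measurable_diamPow measurable_const measurable_const measurable_id)
      ((measurable_orient measurable_const measurable_const measurable_id).const_mul T))

lemma measurableSet_lens (T : ℝ) (u v : Pt) : MeasurableSet (lens T u v) :=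
  (measurableSet_cap T u v).union (measurableSet_cap T v u)

lemma measurableSet_core (u v : Pt) : MeasurableSet (core u v) := by
  have h1 : Measurable (orient u v) :=
    measurable_orient measurable_const measurable_const measurable_id
  have h2 : Measurable (diamPow u v) :=
    measurable_diamPow measurable_const measurable_const measurable_id
  exact (measurableSet_lt measurable_const h1).inter
    ((measurableSet_lt h1.neg h2).inter (measurableSet_lt h2 measurable_const))

lemma measurableSet_coreFam (k : ℕ) (u v : Pt) {ι : Type*} [Finite ι] :
    MeasurableSet {y : ι → Pt | CoreFam k u v y} := by
  have hm : ∀ {A : Set Pt}, MeasurableSet A → ∀ i : ι, Measurable fun y : ι → Pt => y i ∈ A :=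
    fun hA i => measurableSet_setOfPred.1 (measurable_pi_apply i hA)
  have h := fun l => measurable_encard_le (hm (measurableSet_core u v)) l
  have h' := fun l => measurable_encard_le (hm (measurableSet_core v u)) l
  refine measurableSet_setOfPred.2 (Measurable.and (Measurable.forall fun i =>
    hm ((measurableSet_core u v).union (measurableSet_core v u)) i) ?_)
  exact (h 0).not.and ((h k).and ((h' k).and (h' (k - 1)).not))

lemma cap_subset_ball {T : ℝ} (hT : 0 ≤ T) (u v : Pt) :
    cap T u v ⊆ Metric.ball u ((1 + T) * dist v u) := by
  rintro z ⟨h1, h2⟩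
  rw [Metric.mem_ball]
  by_contra! hge
  have hz0 : 0 ≤ dist z u := dist_nonneg
  have hv0 : 0 ≤ dist v u := dist_nonneg
  have ez := dist_sq_eq z u
  have ev := dist_sq_eq v u
  obtain ⟨a, ha⟩ : ∃ a, a = z 0 - u 0 := ⟨_, rfl⟩
  obtain ⟨b, hb⟩ : ∃ b, b = z 1 - u 1 := ⟨_, rfl⟩
  obtain ⟨p, hp⟩ : ∃ p, p = v 0 - u 0 := ⟨_, rfl⟩
  obtain ⟨q, hq⟩ : ∃ q, q = v 1 - u 1 := ⟨_, rfl⟩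
  rw [← ha, ← hb] at ez
  rw [← hp, ← hq] at ev
  have o : orient u v z = p * b - q * a := by rw [orient, ha, hb, hp, hq]
  have f : diamPow u v z = a ^ 2 + b ^ 2 - (a * p + b * q) := by
    rw [diamPow, ha, hb, hp, hq]; ring
  have cs1 : (a * p + b * q) ≤ dist z u * dist v u := by
    refine abs_le_of_sq_le_sq' ?_ (by positivity) |>.2
    rw [mul_pow, ez, ev]; nlinarith [sq_nonneg (a * q - b * p)]
  have cs2 : (p * b - q * a) ≤ dist z u * dist v u := by
    refine abs_le_of_sq_le_sq' ?_ (by positivity) |>.2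
    rw [mul_pow, ez, ev]; nlinarith [sq_nonneg (a * p + b * q)]
  rw [o] at h1 h2
  rw [f] at h2
  have h3 := mul_le_mul_of_nonneg_left cs2 hT
  have h4 := mul_le_mul_of_nonneg_left hge hz0
  nlinarith

lemma volume_cap_lt_top {T : ℝ} (hT : 0 ≤ T) (u v : Pt) : volume (cap T u v) < ⊤ :=
  (measure_mono (cap_subset_ball hT u v)).trans_lt measure_ball_lt_top

lemma lens_subset_ball {T : ℝ} (hT : 0 ≤ T) (u v : Pt) :
    ∃ R, lens T u v ⊆ Metric.ball u R := by
  refine ⟨(1 + T) * dist v u + dist v u + (1 + T) * dist u v, union_subset ?_ ?_⟩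
  · refine (cap_subset_ball hT u v).trans (Metric.ball_subset_ball ?_)
    have : 0 ≤ (1 + T) * dist u v := by positivity
    have : 0 ≤ dist v u := dist_nonneg
    linarith
  · refine (cap_subset_ball hT v u).trans fun z hz => ?_
    rw [Metric.mem_ball] at hz ⊢
    have := dist_triangle z v u
    have : 0 ≤ (1 + T) * dist v u := by positivity
    linarith

lemma volume_lens_lt_top {T : ℝ} (hT : 0 ≤ T) (u v : Pt) : volume (lens T u v) < ⊤ :=
  (measure_union_le _ _).trans_lt
    (ENNReal.add_lt_top.2 ⟨volume_cap_lt_top hT u v, volume_cap_lt_top hT v u⟩)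

lemma volume_cap_ge {T : ℝ} (hT : 0 < T) (u v : Pt) :
    (T * dist v u / 2) ^ 2 * Real.pi ≤ volume.real (cap T u v) := by
  obtain ⟨c, hc⟩ : ∃ c : Pt, c =
    !₂[u 0 + (v 0 - u 0) / 2 - T / 2 * (v 1 - u 1), u 1 + (v 1 - u 1) / 2 + T / 2 * (v 0 - u 0)] :=
    ⟨_, rfl⟩
  have hc0 : c 0 = u 0 + (v 0 - u 0) / 2 - T / 2 * (v 1 - u 1) := by simp [hc]
  have hc1 : c 1 = u 1 + (v 1 - u 1) / 2 + T / 2 * (v 0 - u 0) := by simp [hc]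
  have hsub : Metric.ball c (T * dist v u / 2) ⊆ cap T u v := by
    intro z hz
    have hv0 : 0 ≤ dist v u := dist_nonneg
    have ev := dist_sq_eq v u
    have hz2 : dist z c ^ 2 < (T * dist v u / 2) ^ 2 :=
      pow_lt_pow_left₀ hz dist_nonneg (by norm_num)
    rw [dist_sq_eq] at hz2
    obtain ⟨ξ, hξ⟩ : ∃ ξ, ξ = z 0 - c 0 := ⟨_, rfl⟩
    obtain ⟨η, hη⟩ : ∃ η, η = z 1 - c 1 := ⟨_, rfl⟩
    rw [← hξ, ← hη] at hz2
    obtain ⟨p, hp⟩ : ∃ p, p = v 0 - u 0 := ⟨_, rfl⟩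
    obtain ⟨q, hq⟩ : ∃ q, q = v 1 - u 1 := ⟨_, rfl⟩
    rw [← hp, ← hq] at hc0 hc1 ev
    have z0 : z 0 - u 0 = p / 2 - T / 2 * q + ξ := by rw [hξ, hc0]; ring
    have z1 : z 1 - u 1 = q / 2 + T / 2 * p + η := by rw [hη, hc1]; ring
    have o : orient u v z = T / 2 * dist v u ^ 2 + (p * η - q * ξ) := by
      rw [orient, z0, z1, ← hp, ← hq, ev]; ring
    have f : diamPow u v z - T * orient u v z =
        ξ ^ 2 + η ^ 2 - dist v u ^ 2 / 4 - (T * dist v u / 2) ^ 2 := by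
      rw [o, diamPow, show z 0 - v 0 = (z 0 - u 0) - p by rw [hp]; ring,
        show z 1 - v 1 = (z 1 - u 1) - q by rw [hq]; ring, z0, z1,
        show (T * dist v u / 2) ^ 2 = T ^ 2 / 4 * dist v u ^ 2 by ring, ev]; ring
    have hv1 : 0 < dist v u := by
      rcases hv0.lt_or_eq with h | h
      · exact h
      · rw [← h] at hz2; nlinarith [sq_nonneg ξ, sq_nonneg η]
    refine ⟨?_, by nlinarith [sq_nonneg (dist v u)]⟩
    have cs : |p * η - q * ξ| < T * dist v u / 2 * dist v u := by
      refine abs_lt_of_sq_lt_sq ?_ (by positivity)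
      rw [mul_pow (T * dist v u / 2)]
      calc (p * η - q * ξ) ^ 2 ≤ (ξ ^ 2 + η ^ 2) * dist v u ^ 2 := by
            rw [ev]; nlinarith [sq_nonneg (p * ξ + q * η)]
        _ < _ := mul_lt_mul_of_pos_right hz2 (by positivity)
    rw [o]
    nlinarith [(abs_lt.1 cs).1]
  have e : volume.real (Metric.ball c (T * dist v u / 2)) = (T * dist v u / 2) ^ 2 * Real.pi := by
    rw [measureReal_def, EuclideanSpace.volume_ball_fin_two, ENNReal.toReal_mul,
      ENNReal.toReal_pow, ENNReal.toReal_ofReal (by positivity),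
      ENNReal.toReal_ofReal Real.pi_pos.le]
  rw [← e]
  exact measureReal_mono hsub (volume_cap_lt_top hT.le u v).ne

lemma volume_core_pos {u v : Pt} (h : u ≠ v) : 0 < volume (core u v) := by
  have h1 : Continuous (orient u v) := by unfold orient; fun_prop
  have h2 : Continuous (diamPow u v) := by unfold diamPow; fun_prop
  have ho : IsOpen (core u v) := (isOpen_lt continuous_const h1).inter
    ((isOpen_lt h1.neg h2).inter (isOpen_lt h2 continuous_const))
  refine ho.measure_pos _ ⟨!₂[u 0 + (v 0 - u 0) / 2 - 1 / 4 * (v 1 - u 1),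
    u 1 + (v 1 - u 1) / 2 + 1 / 4 * (v 0 - u 0)], ?_⟩
  have hd : 0 < (v 0 - u 0) ^ 2 + (v 1 - u 1) ^ 2 := by
    rw [← dist_sq_eq]
    exact pow_pos (dist_pos.2 h.symm) 2
  simp only [core, mem_ofPred_eq, orient, diamPow, Matrix.cons_val_zero,
    Matrix.cons_val_one]
  refine ⟨?_, ?_, ?_⟩ <;> nlinarith

/-- The law of a uniform point, seen from `u` after scaling the mean density to `1`. -/
def scaledLaw (u : Pt) (N : ℕ) : Measure Pt := unifSq.map fun y => Real.sqrt N • (y - u)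

instance (u : Pt) (N : ℕ) : IsProbabilityMeasure (scaledLaw u N) :=
  Measure.isProbabilityMeasure_map (by fun_prop)

lemma edgeProb_eq_scaled (k : ℕ) {N : ℕ} (hN : 0 < N) (u w : Pt) :
    edgeProb k N u (u + (Real.sqrt N)⁻¹ • w) =
      (Measure.pi fun _ : Fin N => scaledLaw u N).real {z | ExactFam k 0 w z} := by
  have hN' : 0 < Real.sqrt N := Real.sqrt_pos.2 (by exact_mod_cast hN)
  have hmap : (conf N).map (fun y i => Real.sqrt N • (y i - u)) =
      Measure.pi fun _ : Fin N => scaledLaw u N := by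
    have : ∀ _ : Fin N, SigmaFinite (unifSq.map fun y => Real.sqrt N • (y - u)) := fun _ =>
      inferInstanceAs (SigmaFinite (scaledLaw u N))
    exact Measure.pi_map_pi (μ := fun _ : Fin N => unifSq)
      (f := fun _ y => Real.sqrt N • (y - u)) fun i => by fun_prop
  have hm : MeasurableSet {z : Fin N → Pt | ExactFam k 0 w z} :=
    measurableSet_setOfPred.2 (measurable_exactFam k measurable_const measurable_const
      measurable_id)
  rw [← hmap, map_measureReal_apply (by fun_prop) hm, edgeProb]
  congr 1
  ext y
  rw [mem_preimage, mem_ofPred_eq, mem_ofPred_eq, ← exactFam_smul u w (inv_pos.2 hN')]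
  have : (fun i => u + (Real.sqrt N)⁻¹ • Real.sqrt N • (y i - u)) = y := by
    ext1 i
    rw [inv_smul_smul₀ hN'.ne']
    simp
  rw [this]

lemma scaledLaw_restrict {u : Pt} (hu : 0 < bdist u) {A : Set Pt} (hA : MeasurableSet A) {R : ℝ}
    (hR : A ⊆ Metric.ball 0 R) : ∀ᶠ N : ℕ in atTop,
      (scaledLaw u N).restrict A = ENNReal.ofReal ((N : ℝ)⁻¹) • volume.restrict A := by
  have h1 : ∀ᶠ N : ℕ in atTop, R / bdist u < Real.sqrt N :=
    (Real.tendsto_sqrt_atTop.comp tendsto_natCast_atTop_atTop).eventually_gt_atTop _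
  filter_upwards [h1, eventually_gt_atTop 0] with N h1 h0
  have hN : (0 : ℝ) < N := by exact_mod_cast h0
  have hN' : 0 < Real.sqrt N := Real.sqrt_pos.2 hN
  ext s hs
  have hf : Measurable fun y : Pt => Real.sqrt N • (y - u) := by fun_prop
  rw [Measure.smul_apply, Measure.restrict_apply hs, Measure.restrict_apply hs, scaledLaw,
    Measure.map_apply hf (hs.inter hA), unifSq, Measure.restrict_apply (hf (hs.inter hA)),
    inter_eq_left.2]
  · have : (fun y : Pt => Real.sqrt N • (y - u)) ⁻¹' (s ∩ A) =
        (fun y => y + -u) ⁻¹' ((Real.sqrt N • ·) ⁻¹' (s ∩ A)) := by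
      ext y; simp [sub_eq_add_neg]
    rw [this, measure_preimage_add_right, Measure.addHaar_preimage_smul _ hN'.ne']
    simp [abs_of_pos, hN, Real.sq_sqrt hN.le]
  · intro y hy
    have hyR := hR hy.2
    rw [mem_ball_zero_iff, norm_smul, Real.norm_of_nonneg hN'.le] at hyR
    have hlt : ‖y - u‖ < bdist u := by
      rw [div_lt_iff₀ hu] at h1
      exact lt_of_mul_lt_mul_left (hyR.trans h1) hN'.le
    have c0 := (PiLp.norm_apply_le (y - u) 0).trans_lt hlt
    have c1 := (PiLp.norm_apply_le (y - u) 1).trans_lt hlt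
    rw [Real.norm_eq_abs, PiLp.sub_apply, abs_lt] at c0 c1
    have b1 : bdist u ≤ u 0 := (min_le_left _ _).trans (min_le_left _ _)
    have b2 : bdist u ≤ 1 - u 0 := (min_le_left _ _).trans (min_le_right _ _)
    have b3 : bdist u ≤ u 1 := (min_le_right _ _).trans (min_le_left _ _)
    have b4 : bdist u ≤ 1 - u 1 := (min_le_right _ _).trans (min_le_right _ _)
    exact ⟨⟨by linarith, by linarith⟩, by linarith, by linarith⟩

lemma scaledLaw_real {u : Pt} (hu : 0 < bdist u) {A : Set Pt} (hA : MeasurableSet A) {R : ℝ}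
    (hR : A ⊆ Metric.ball 0 R) : ∀ᶠ N : ℕ in atTop,
      N * (scaledLaw u N).real A = volume.real A := by
  filter_upwards [scaledLaw_restrict hu hA hR, eventually_gt_atTop 0] with N h h0
  have hN : (0 : ℝ) < N := by exact_mod_cast h0
  rw [measureReal_def, ← Measure.restrict_apply_univ, h, ← measureReal_def,
    measureReal_ennreal_smul_apply, ENNReal.toReal_ofReal (by positivity), measureReal_def,
    Measure.restrict_apply_univ, ← measureReal_def]
  field_simp

lemma abs_edgeProb_sub_le (k : ℕ) {T : ℝ} (hT : 0 < T) {u w : Pt} (hu : 0 < bdist u) :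
    ∀ᶠ N : ℕ in atTop, |(Measure.pi fun _ : Fin N => scaledLaw u N).real
        {z | ExactFam k 0 w (fun i : {i // z i ∈ lens T 0 w} => z i)} -
      edgeProb k N u (u + (Real.sqrt N)⁻¹ • w)| ≤
      2 ^ (k + 1) * Real.exp (-((T * dist w 0 / 2) ^ 2 * Real.pi) / 2) := by
  filter_upwards [scaledLaw_real hu (measurableSet_cap T 0 w) (cap_subset_ball hT.le 0 w),
    scaledLaw_real hu (measurableSet_cap T w 0)
      (subset_union_right.trans (lens_subset_ball hT.le 0 w).choose_spec),
    eventually_gt_atTop 0] with N h1 h2 h0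
  rw [edgeProb_eq_scaled k h0]
  set μ := Measure.pi fun _ : Fin N => scaledLaw u N with hμ
  have e1 := pi_real_encard_le (scaledLaw u N) (measurableSet_cap T 0 w) k N
  have e2 := pi_real_encard_le (scaledLaw u N) (measurableSet_cap T w 0) k N
  rw [h1] at e1
  rw [h2] at e2
  have v1 := volume_cap_ge hT 0 w
  have v2 := volume_cap_ge hT w 0
  rw [dist_comm 0 w] at v2
  set a := (T * dist w 0 / 2) ^ 2 * Real.pi with ha
  have x1 : Real.exp (-volume.real (cap T 0 w) / 2) ≤ Real.exp (-a / 2) :=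
    Real.exp_le_exp.2 (by linarith)
  have x2 : Real.exp (-volume.real (cap T w 0) / 2) ≤ Real.exp (-a / 2) :=
    Real.exp_le_exp.2 (by linarith)
  set B : Set (Fin N → Pt) := {y | {i | y i ∈ cap T 0 w}.encard ≤ (k : ℕ∞)} ∪
    {y | {i | y i ∈ cap T w 0}.encard ≤ (k : ℕ∞)} with hB
  have hBle : μ.real B ≤ 2 ^ (k + 1) * Real.exp (-a / 2) := by
    refine (measureReal_union_le _ _).trans ?_
    have p : (0 : ℝ) < 2 ^ k := by positivity
    rw [pow_succ]
    nlinarith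
  have hiff : ∀ z ∉ B, (ExactFam k 0 w (fun i : {i // z i ∈ lens T 0 w} => z i) ↔
      ExactFam k 0 w z) := fun z hz => exactFam_lens (fun h => hz (Or.inl h)) fun h => hz (Or.inr h)
  have aux : ∀ S S' : Set (Fin N → Pt), (∀ z ∉ B, z ∈ S → z ∈ S') →
      μ.real S ≤ μ.real S' + μ.real B := fun S S' h =>
    (measureReal_mono fun z hz => by
      by_cases hzB : z ∈ B
      · exact Or.inr hzB
      · exact Or.inl (h z hzB hz)).trans (measureReal_union_le S' B)
  have i1 := aux {z | ExactFam k 0 w (fun i : {i // z i ∈ lens T 0 w} => z i)}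
    {z | ExactFam k 0 w z} fun z hz => (hiff z hz).1
  have i2 := aux {z | ExactFam k 0 w z}
    {z | ExactFam k 0 w (fun i : {i // z i ∈ lens T 0 w} => z i)} fun z hz => (hiff z hz).2
  rw [abs_le]
  constructor
  · linarith
  · linarith

lemma lens_measure_pos {T : ℝ} (hT : 0 < T) {w : Pt} (hw : w ≠ 0) :
    0 < (volume.restrict (lens T 0 w)).real univ := by
  rw [measureReal_def, Measure.restrict_apply_univ, ← measureReal_def]
  have h := volume_cap_ge hT 0 w
  have hd : 0 < dist w 0 := dist_pos.2 hw
  refine lt_of_lt_of_le ?_ (h.trans (measureReal_mono subset_union_left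
    (volume_lens_lt_top hT.le 0 w).ne))
  have := Real.pi_pos
  positivity

lemma exists_local_limit (k : ℕ) {T : ℝ} (hT : 0 < T) {w : Pt} (hw : w ≠ 0) :
    ∃ g : ℝ, ∀ u, 0 < bdist u → Tendsto (fun N => (Measure.pi fun _ : Fin N => scaledLaw u N).real
      {z | ExactFam k 0 w (fun i : {i // z i ∈ lens T 0 w} => z i)}) atTop (nhds g) := by
  have : IsFiniteMeasure (volume.restrict (lens T 0 w)) :=
    ⟨by simpa using volume_lens_lt_top hT.le 0 w⟩
  refine ⟨_, fun u hu => tendsto_local (fun {ι} z => ExactFam k 0 w z) (scaledLaw u)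
    (measurableSet_lens T 0 w) (volume.restrict (lens T 0 w)) (lens_measure_pos hT hw)
    (scaledLaw_restrict hu (measurableSet_lens T 0 w) (lens_subset_ball hT.le 0 w).choose_spec)
    ?_ ?_⟩
  · intro ι _
    exact measurableSet_setOfPred.2 (measurable_exactFam k measurable_const measurable_const
      measurable_id)
  · exact fun e y => exactFam_comp_equiv y e

lemma coreFam_measure_pos {k : ℕ} (hk : 1 ≤ k) {w : Pt} (hw : w ≠ 0) :
    0 < (Measure.pi fun _ : Fin (k + 1) => volume.restrict (lens 1 0 w)).real
      {z | CoreFam k 0 w z} := by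
  have : IsFiniteMeasure (volume.restrict (lens 1 0 w)) :=
    ⟨by simpa using volume_lens_lt_top zero_le_one 0 w⟩
  refine ENNReal.toReal_pos (ne_of_gt ?_) (measure_ne_top _ _)
  let s : Fin (k + 1) → Set Pt := Fin.cons (core 0 w) fun _ => core w 0
  have hpos : 0 < (Measure.pi fun _ : Fin (k + 1) => volume.restrict (lens 1 0 w)) (univ.pi s) := by
    rw [Measure.pi_pi, Fin.prod_univ_succ]
    have hs : core w 0 ⊆ lens 1 0 w := lens_swap 1 0 w ▸ core_subset w 0
    simp only [s, Fin.cons_zero, Fin.cons_succ]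
    rw [Measure.restrict_apply (measurableSet_core _ _),
      Measure.restrict_apply (measurableSet_core _ _), inter_eq_left.2 (core_subset 0 w),
      inter_eq_left.2 hs]
    refine ENNReal.mul_pos (volume_core_pos hw.symm).ne' ?_
    rw [Finset.prod_const]
    exact pow_ne_zero _ (volume_core_pos hw).ne'
  refine hpos.trans_le (measure_mono fun z hz => ?_)
  have h0 : z 0 ∈ core 0 w := hz 0 trivial
  have h1 : ∀ i : Fin k, z i.succ ∈ core w 0 := fun i => hz i.succ trivial
  have hdisj : ∀ p, p ∈ core 0 w → p ∉ core w 0 := fun p hp hq =>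
    absurd (mem_core_swap.1 hq).1 hp.1.not_gt
  have s1 : {i | z i ∈ core 0 w} = {0} := by
    ext i
    refine Fin.cases ?_ (fun j => ?_) i
    · simpa using h0
    · simpa [Fin.succ_ne_zero] using fun h => hdisj _ h (h1 j)
  have s2 : {i | z i ∈ core w 0} = range Fin.succ := by
    ext i
    refine Fin.cases ?_ (fun j => ?_) i
    · simpa using hdisj _ h0
    · simpa using h1 j
  have c2 : {i | z i ∈ core w 0}.encard = (k : ℕ∞) := by
    rw [s2, ← image_univ, (Fin.succ_injective k).encard_image, encard_univ]
    simp
  refine ⟨Fin.cases (Or.inl h0) fun i => Or.inr (h1 i), ?_, ?_, c2.le, ?_⟩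
  · rw [s1]; simp
  · rw [s1, encard_singleton]; exact_mod_cast hk
  · rw [c2, not_le]; exact_mod_cast Nat.sub_lt hk one_pos

lemma exists_edgeProb_ge {k : ℕ} (hk : 1 ≤ k) {w : Pt} (hw : w ≠ 0) :
    ∃ δ > 0, ∀ u, 0 < bdist u → ∀ᶠ N : ℕ in atTop,
      δ ≤ edgeProb k N u (u + (Real.sqrt N)⁻¹ • w) := by
  have : IsFiniteMeasure (volume.restrict (lens 1 0 w)) :=
    ⟨by simpa using volume_lens_lt_top zero_le_one 0 w⟩
  have hge := tsum_local_ge (fun {ι} (z : ι → Pt) => CoreFam k 0 w z)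
    (lam := volume.restrict (lens 1 0 w)) (k + 1)
  have hp := coreFam_measure_pos hk hw
  set L := ∑' j : ℕ, Real.exp (-(volume.restrict (lens 1 0 w)).real univ) / j.factorial *
        (Measure.pi fun _ : Fin j => volume.restrict (lens 1 0 w)).real {z | CoreFam k 0 w z}
  have hL : 0 < L := lt_of_lt_of_le (by positivity) hge
  refine ⟨L / 2, half_pos hL, fun u hu => ?_⟩
  have ht := tendsto_local (fun {ι} (z : ι → Pt) => CoreFam k 0 w z) (scaledLaw u)
    (measurableSet_lens 1 0 w) (volume.restrict (lens 1 0 w)) (lens_measure_pos one_pos hw)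
    (scaledLaw_restrict hu (measurableSet_lens 1 0 w)
      (lens_subset_ball zero_le_one 0 w).choose_spec)
    (fun {ι} _ => measurableSet_coreFam k 0 w) (fun e y => coreFam_comp_equiv e y)
  filter_upwards [ht.eventually_const_lt (half_lt_self hL), eventually_gt_atTop 0] with N h1 h0
  rw [edgeProb_eq_scaled k h0]
  exact h1.le.trans (measureReal_mono fun z hz => CoreFam.exactFam hz)

lemma exists_common_limit {α : Type*} (S : Set α) (e : ℕ → α → ℝ)
    (h : ∀ ε > 0, ∃ g : ℝ, ∀ u ∈ S, ∀ᶠ N in atTop, |g - e N u| ≤ ε) :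
    ∃ q : ℝ, ∀ u ∈ S, Tendsto (fun N => e N u) atTop (nhds q) := by
  rcases S.eq_empty_or_nonempty with rfl | ⟨u₀, h₀⟩
  · exact ⟨0, by simp⟩
  have hc : CauchySeq fun N => e N u₀ := by
    refine Metric.cauchySeq_iff'.2 fun ε hε => ?_
    obtain ⟨g, hg⟩ := h (ε / 3) (by positivity)
    obtain ⟨M, hM⟩ := eventually_atTop.1 (hg u₀ h₀)
    refine ⟨M, fun n hn => ?_⟩
    have a := abs_le.1 (hM n hn)
    have b := abs_le.1 (hM M le_rfl)
    rw [Real.dist_eq, abs_lt]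
    constructor <;> linarith [a.1, a.2, b.1, b.2]
  obtain ⟨q, hq⟩ := cauchySeq_tendsto_of_complete hc
  refine ⟨q, fun u hu => Metric.tendsto_atTop'.2 fun ε hε => ?_⟩
  obtain ⟨g, hg⟩ := h (ε / 4) (by positivity)
  have hq' := (Metric.tendsto_nhds.1 hq (ε / 4) (by positivity))
  obtain ⟨M, hM⟩ := eventually_atTop.1 ((hg u hu).and ((hg u₀ h₀).and hq'))
  refine ⟨M, fun n hn => ?_⟩
  obtain ⟨a, b, c⟩ := hM n hn.le
  rw [Real.dist_eq, abs_lt] at c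
  rw [abs_le] at a b
  rw [Real.dist_eq, abs_lt]
  constructor <;> linarith [a.1, a.2, b.1, b.2, c.1, c.2]

/-- Far from the boundary, the scaled edge probabilities converge to a positive limit. -/
theorem exists_edgeProb_limit {k : ℕ} (hk : 1 ≤ k) :
    ∃ q : Pt → ℝ, ∀ w ≠ 0, 0 < q w ∧ ∀ u, 0 < bdist u →
      Tendsto (fun N : ℕ => edgeProb k N u (u + (Real.sqrt N)⁻¹ • w)) atTop (nhds (q w)) := by
  have key : ∀ w : Pt, ∃ q : ℝ, w ≠ 0 → 0 < q ∧ ∀ u, 0 < bdist u →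
      Tendsto (fun N : ℕ => edgeProb k N u (u + (Real.sqrt N)⁻¹ • w)) atTop (nhds q) := by
    intro w
    rcases eq_or_ne w 0 with hw | hw
    · exact ⟨0, fun h => absurd hw h⟩
    obtain ⟨q, hq⟩ := exists_common_limit {u | 0 < bdist u}
      (fun (N : ℕ) u => edgeProb k N u (u + (Real.sqrt N)⁻¹ • w)) (by
        intro ε hε
        have hd : 0 < dist w 0 := dist_pos.2 hw
        have hlim : Tendsto (fun T : ℝ =>
            2 ^ (k + 1) * Real.exp (-((T * dist w 0 / 2) ^ 2 * Real.pi) / 2)) atTop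
            (nhds (2 ^ (k + 1) * 0)) := by
          refine Tendsto.const_mul _ (Real.tendsto_exp_atBot.comp ?_)
          have h1 : Tendsto (fun T : ℝ => (T * dist w 0 / 2) ^ 2) atTop atTop :=
            (tendsto_pow_atTop two_ne_zero).comp
              ((tendsto_id.atTop_mul_const hd).atTop_div_const two_pos)
          exact (tendsto_neg_atTop_atBot.comp (h1.atTop_mul_const Real.pi_pos)).atBot_div_const
            two_pos
        rw [mul_zero] at hlim
        obtain ⟨T, hT1, hT2⟩ := ((hlim.eventually_lt_const (half_pos hε)).and
          (eventually_gt_atTop 0)).exists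
        obtain ⟨g, hg⟩ := exists_local_limit k hT2 hw
        refine ⟨g, fun u hu => ?_⟩
        filter_upwards [abs_edgeProb_sub_le k hT2 hu,
          Metric.tendsto_nhds.1 (hg u hu) (ε / 2) (half_pos hε)] with N h1 h2
        rw [Real.dist_eq, abs_lt] at h2
        have h1' := abs_le.1 (h1.trans hT1.le)
        rw [abs_le]
        constructor <;> linarith [h1'.1, h1'.2, h2.1, h2.2])
    refine ⟨q, fun _ => ⟨?_, hq⟩⟩
    obtain ⟨δ, hδ, hδ'⟩ := exists_edgeProb_ge hk hw
    have hc : 0 < bdist (!₂[1 / 2, 1 / 2] : Pt) := by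
      simp [bdist]; norm_num
    exact hδ.trans_le (ge_of_tendsto (hq _ hc) (hδ' _ hc))
  choose q hq using key
  exact ⟨q, fun w hw => hq w hw⟩

lemma measurable_edgeProb (k N : ℕ) : Measurable fun p : Pt × Pt => edgeProb k N p.1 p.2 := by
  have hs : MeasurableSet {p : (Pt × Pt) × (Fin N → Pt) | ExactFam k p.1.1 p.1.2 p.2} :=
    measurableSet_setOfPred.2 (measurable_exactFam k (measurable_fst.comp measurable_fst)
      (measurable_snd.comp measurable_fst) measurable_snd)
  exact (measurable_measure_prodMk_left (ν := conf N) hs).ennreal_toReal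

lemma mul_integral_unifSq (u : Pt) (f : Pt → ℝ) {N : ℕ} (hN : 0 < N) :
    N * ∫ v, f v ∂unifSq = ∫ w, unitSq.indicator f (u + (Real.sqrt N)⁻¹ • w) := by
  have hN' : (0 : ℝ) < N := by exact_mod_cast hN
  rw [Measure.integral_comp_smul volume (fun v => unitSq.indicator f (u + v)),
    integral_add_left_eq_self (μ := (volume : Measure Pt)) (unitSq.indicator f),
    integral_indicator measurableSet_unitSq, unifSq]
  simp [Real.sq_sqrt hN'.le]

lemma unitSq_mem_nhds {u : Pt} (hu : 0 < bdist u) : unitSq ∈ nhds u := by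
  have hc : Continuous bdist := by unfold bdist; fun_prop
  exact mem_of_superset (hc.continuousAt.preimage_mem_nhds (Ioi_mem_nhds hu))
    fun p hp => mem_unitSq_of_bdist hp

lemma null_coord (i : Fin 2) : ∀ᵐ w : Pt, w i ≠ 0 := by
  have h := (EuclideanSpace.volume_preserving_symm_measurableEquiv_toLp (Fin 2)).quasiMeasurePreserving
  have h2 : Measure.QuasiMeasurePreserving (fun f : Fin 2 → ℝ => f i) volume volume :=
    Measure.quasiMeasurePreserving_eval _ i
  exact (h2.comp h).ae (Measure.ae_ne volume 0)

/-- The edge probability at distance of order `N ^ (-1/2)`, cut off outside the unit square. -/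
def rescaledEdgeProb (k N : ℕ) (p : Pt × Pt) : ℝ :=
  unitSq.indicator (edgeProb k N p.1) (p.1 + (Real.sqrt N)⁻¹ • p.2)

lemma measurable_rescaledEdgeProb (k N : ℕ) : Measurable (rescaledEdgeProb k N) := by
  have hg : Measurable fun p : Pt × Pt => p.1 + (Real.sqrt N)⁻¹ • p.2 := by fun_prop
  have hi : Measurable fun p : Pt × Pt => unitSq.indicator (edgeProb k N p.1) p.2 :=
    (measurable_edgeProb k N).indicator (measurable_snd measurableSet_unitSq)
  have hp : Measurable fun p : Pt × Pt => (p.1, p.1 + (Real.sqrt N)⁻¹ • p.2) :=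
    measurable_fst.prodMk hg
  have := hi.comp hp
  exact this

theorem tendsto_mul_integral_edgeProb {k : ℕ} (hk : 1 ≤ k) :
    ∃ d : ℝ, 0 < d ∧ Tendsto (fun N : ℕ => N * ∫ u, ∫ v, edgeProb k N u v ∂unifSq ∂unifSq)
      atTop (nhds d) := by
  obtain ⟨q, hq⟩ := exists_edgeProb_limit hk
  obtain ⟨C, hC, hbound⟩ := exists_edgeProb_le k
  let F : ℕ → Pt × Pt → ℝ := rescaledEdgeProb k
  let D : Pt × Pt → ℝ := fun p =>
    C * (bdist p.1 ^ (-(1 / 2) : ℝ) * (profile (p.2 0) * profile (p.2 1)))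
  have hD : Integrable D (unifSq.prod volume) := integrable_dominator C
  have hFm : ∀ N, Measurable (F N) := measurable_rescaledEdgeProb k
  have hae : ∀ᵐ p ∂(unifSq.prod (volume : Measure Pt)), 0 < bdist p.1 ∧ p.2 0 ≠ 0 ∧ p.2 1 ≠ 0 := by
    have a1 := Measure.quasiMeasurePreserving_fst (μ := unifSq) (ν := (volume : Measure Pt))
      |>.ae ae_bdist_pos
    have a2 := fun i => Measure.quasiMeasurePreserving_snd (μ := unifSq) (ν := (volume : Measure Pt))
      |>.ae (null_coord i)
    filter_upwards [a1, a2 0, a2 1] with p h1 h2 h3 using ⟨h1, h2, h3⟩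
  have hFD : ∀ N : ℕ, 0 < N → ∀ᵐ p ∂(unifSq.prod (volume : Measure Pt)), ‖F N p‖ ≤ D p := by
    intro N hN
    filter_upwards [hae] with p hp
    by_cases hS : p.1 + (Real.sqrt N)⁻¹ • p.2 ∈ unitSq
    · simp only [F, rescaledEdgeProb, indicator_of_mem hS]
      rw [Real.norm_of_nonneg (edgeProb_nonneg _ _ _ _)]
      exact hbound N p.1 p.2 hN hp.1 hS hp.2.1 hp.2.2
    · simp only [F, rescaledEdgeProb, indicator_of_notMem hS, norm_zero]
      exact mul_nonneg hC (mul_nonneg (Real.rpow_nonneg hp.1.le _)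
        (mul_nonneg (profile_nonneg _) (profile_nonneg _)))
  have hlim : ∀ᵐ p ∂(unifSq.prod (volume : Measure Pt)),
      Tendsto (fun N => F N p) atTop (nhds (q p.2)) ∧ 0 < q p.2 := by
    filter_upwards [hae] with p hp
    have hw : p.2 ≠ 0 := fun h => hp.2.1 (by rw [h]; rfl)
    refine ⟨((hq p.2 hw).2 p.1 hp.1).congr' ?_, (hq p.2 hw).1⟩
    have ht : Tendsto (fun N : ℕ => p.1 + (Real.sqrt N)⁻¹ • p.2) atTop (nhds p.1) := by
      have h1 : Tendsto (fun N : ℕ => (Real.sqrt N)⁻¹) atTop (nhds 0) :=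
        (Real.tendsto_sqrt_atTop.comp tendsto_natCast_atTop_atTop).inv_tendsto_atTop
      simpa using (h1.smul_const p.2).const_add p.1
    filter_upwards [ht.eventually (unitSq_mem_nhds hp.1)] with N hN
    simp only [F, rescaledEdgeProb]
    exact (indicator_of_mem (show p.1 + (Real.sqrt N)⁻¹ • p.2 ∈ unitSq from hN) _).symm
  have hFi : ∀ N : ℕ, 0 < N → Integrable (F N) (unifSq.prod volume) := fun N hN =>
    hD.mono' (hFm N).aestronglyMeasurable (hFD N hN)
  have hT := tendsto_integral_filter_of_dominated_convergence (l := atTop)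
    (μ := unifSq.prod (volume : Measure Pt)) (F := F) (f := fun p => q p.2) D
    (Eventually.of_forall fun N => (hFm N).aestronglyMeasurable)
    ((eventually_gt_atTop 0).mono hFD) hD (hlim.mono fun p h => h.1)
  have hqm : AEStronglyMeasurable (fun p : Pt × Pt => q p.2) (unifSq.prod volume) :=
    aestronglyMeasurable_of_tendsto_ae atTop (fun N => (hFm N).aestronglyMeasurable)
      (hlim.mono fun p h => h.1)
  have hqi : Integrable (fun p : Pt × Pt => q p.2) (unifSq.prod volume) := by
    refine hD.mono' hqm ?_
    have hall : ∀ᵐ p ∂(unifSq.prod (volume : Measure Pt)), ∀ N : ℕ, 0 < N → ‖F N p‖ ≤ D p :=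
      ae_all_iff.2 fun N => by
        by_cases hN : 0 < N
        · filter_upwards [hFD N hN] with p hp _ using hp
        · exact Eventually.of_forall fun p h => absurd h hN
    filter_upwards [hlim, hall] with p h1 h2
    exact le_of_tendsto h1.1.norm ((eventually_gt_atTop 0).mono fun N hN => h2 N hN)
  refine ⟨∫ p, q p.2 ∂(unifSq.prod volume), ?_, ?_⟩
  · rw [integral_pos_iff_support_of_nonneg_ae (hlim.mono fun p h => h.2.le) hqi, pos_iff_ne_zero]
    intro h0
    have hz : ∀ᵐ p ∂(unifSq.prod (volume : Measure Pt)), False := by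
      filter_upwards [hlim, measure_eq_zero_iff_ae_notMem.1 h0] with p h1 h2
      exact h2 h1.2.ne'
    have hu := ae_iff.1 hz
    simp only [not_false_eq_true] at hu
    have : (unifSq.prod (volume : Measure Pt)) (univ ×ˢ univ) = 0 :=
      measure_mono_null (fun p _ => trivial) hu
    rw [Measure.prod_prod, measure_univ, one_mul] at this
    exact (isOpen_univ.measure_pos (volume : Measure Pt) univ_nonempty).ne' this
  · refine hT.congr' ?_
    filter_upwards [eventually_gt_atTop 0] with N hN
    rw [integral_prod _ (hFi N hN), ← integral_const_mul]
    refine integral_congr_ae (Eventually.of_forall fun u => ?_)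
    exact (mul_integral_unifSq u (edgeProb k N u) hN).symm

lemma GenPos.hull_range_interior {n : ℕ} (hn : 3 ≤ n) {x : Fin n → Pt}
    (hx : Function.Injective x) (hP : GenPos (range x)) :
    (interior (convexHull ℝ (range x))).Nonempty := by
  obtain ⟨t, ht, h3⟩ := Finset.exists_subset_card_eq (s := Finset.univ.image x) (n := 3)
    (by rw [Finset.card_image_of_injective _ hx]; simpa using hn)
  refine hP.hull_interior (t := t) (fun p hp => ?_) h3
  obtain ⟨i, -, rfl⟩ := Finset.mem_image.1 (ht hp)
  exact ⟨i, rfl⟩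

lemma useful_and_not_useful_iff {n : ℕ} (hn : 3 ≤ n) {x : Fin n → Pt}
    (hx : Function.Injective x) (hP : GenPos (range x)) {k : ℕ} (hk : 1 ≤ k) {i j : Fin n}
    (hij : i ≠ j) :
    (UsefulEdge (range x) k (x i) (x j) ∧ ∀ l < k, ¬UsefulEdge (range x) l (x i) (x j)) ↔
      ExactFam k (x i) (x j) x := by
  have key : ∀ l, UsefulEdge (range x) l (x i) (x j) ↔ CritFam l (x i) (x j) x := fun l => by
    rw [usefulEdge_iff (finite_range x) hP (hP.hull_range_interior hn hx) ⟨i, rfl⟩ ⟨j, rfl⟩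
      (hx.ne hij), halfCrit_range hx, halfCrit_range hx, CritFam]
  simp only [key, ExactFam]
  exact and_congr_right fun _ => ⟨fun h => h _ (by omega),
    fun h l hl hc => h (hc.mono (by omega))⟩

open Classical in
lemma ncard_usefulExactly {n : ℕ} (hn : 3 ≤ n) {x : Fin n → Pt}
    (hx : Function.Injective x) (hP : GenPos (range x)) {k : ℕ} (hk : 1 ≤ k) :
    (usefulExactly (range x) k).ncard =
      {p : Fin n × Fin n | p.1 < p.2 ∧ ExactFam k (x p.1) (x p.2) x}.ncard := by
  have himg : usefulExactly (range x) k = (fun p : Fin n × Fin n => ({x p.1, x p.2} : Finset Pt)) ''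
      {p | p.1 < p.2 ∧ ExactFam k (x p.1) (x p.2) x} := by
    ext e
    constructor
    · rintro ⟨_, _, ⟨i, rfl⟩, ⟨j, rfl⟩, hne, rfl, h⟩
      have hij : i ≠ j := ne_of_apply_ne x hne
      have hE := (useful_and_not_useful_iff hn hx hP hk hij).1 h
      rcases hij.lt_or_gt with hlt | hlt
      · exact ⟨(i, j), ⟨hlt, hE⟩, by ext; simp⟩
      · exact ⟨(j, i), ⟨hlt, exactFam_comm.2 hE⟩, by ext; simp [or_comm]⟩
    · rintro ⟨⟨i, j⟩, ⟨hlt, hE⟩, rfl⟩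
      exact ⟨x i, x j, ⟨i, rfl⟩, ⟨j, rfl⟩, hx.ne hlt.ne, by ext; simp,
        (useful_and_not_useful_iff hn hx hP hk hlt.ne).2 hE⟩
  rw [himg]
  refine Set.InjOn.ncard_image ?_
  rintro ⟨i, j⟩ ⟨h, -⟩ ⟨i', j'⟩ ⟨h', -⟩ heq
  have h1 : ({x i, x j} : Set Pt) = {x i', x j'} := by
    ext p
    simpa using congrArg (fun s : Finset Pt => p ∈ s) heq
  rcases Set.pair_eq_pair_iff.1 h1 with ⟨a, b⟩ | ⟨a, b⟩
  · rw [hx a, hx b]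
  · have ha := hx a
    have hb := hx b
    simp only at h h'
    rw [ha, hb] at h
    exact absurd h h'.asymm

/-- The probability that the points with indices `i` and `j` form an exact edge. -/
def pairProb (k : ℕ) {n : ℕ} (i j : Fin n) : ℝ := (conf n).real {x | ExactFam k (x i) (x j) x}

lemma measurableSet_exactFam_pair (k : ℕ) {n : ℕ} (i j : Fin n) :
    MeasurableSet {x : Fin n → Pt | ExactFam k (x i) (x j) x} :=
  measurableSet_setOfPred.2 (measurable_exactFam k (measurable_pi_apply i) (measurable_pi_apply j)
    measurable_id)

lemma pairProb_comp_equiv (k : ℕ) {n : ℕ} (e : Equiv.Perm (Fin n)) (i j : Fin n) :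
    pairProb k (e i) (e j) = pairProb k i j := by
  have h := measurePreserving_comp_equiv unifSq e
  have h2 := h.measureReal_preimage (measurableSet_exactFam_pair k i j).nullMeasurableSet
  rw [pairProb, pairProb, conf, ← h2]
  congr 1
  ext x
  exact (exactFam_comp_equiv x e).symm

lemma pairProb_eq (k : ℕ) {n : ℕ} {i j i' j' : Fin n} (h : i ≠ j) (h' : i' ≠ j') :
    pairProb k i j = pairProb k i' j' := by
  obtain ⟨e, he⟩ := Equiv.Perm.exists_extending_pair ![i', j'] ![i, j]
    (by simpa [Function.Injective, Fin.forall_fin_two, eq_comm] using h')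
    (by simpa [Function.Injective, Fin.forall_fin_two, eq_comm] using h)
  rw [← pairProb_comp_equiv k e i' j']
  exact congrArg₂ (pairProb k) (he 0).symm (he 1).symm

lemma measurePreserving_cons_cons (N : ℕ) :
    MeasurePreserving (fun p : Pt × Pt × (Fin N → Pt) =>
      (Fin.cons p.1 (Fin.cons p.2.1 p.2.2 : Fin (N + 1) → Pt) : Fin (N + 2) → Pt))
      (unifSq.prod (unifSq.prod (conf N))) (conf (N + 2)) := by
  have e1 := (measurePreserving_piFinSuccAbove (fun _ : Fin (N + 2) => unifSq) 0).symm
  have e2 := (measurePreserving_piFinSuccAbove (fun _ : Fin (N + 1) => unifSq) 0).symm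
  have h := e1.comp ((MeasurePreserving.id unifSq).prod e2)
  have heq : (fun p : Pt × Pt × (Fin N → Pt) =>
      (Fin.cons p.1 (Fin.cons p.2.1 p.2.2 : Fin (N + 1) → Pt) : Fin (N + 2) → Pt)) =
      (MeasurableEquiv.piFinSuccAbove (fun _ : Fin (N + 2) => Pt) 0).symm ∘
      Prod.map id (MeasurableEquiv.piFinSuccAbove (fun _ : Fin (N + 1) => Pt) 0).symm := by
    funext p
    simp [MeasurableEquiv.piFinSuccAbove_symm_apply, Fin.insertNthEquiv]
  rw [heq]
  exact h

lemma exactFam_cons_cons {k N : ℕ} {u v : Pt} {y : Fin N → Pt} :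
    ExactFam k u v (Fin.cons u (Fin.cons v y : Fin (N + 1) → Pt) : Fin (N + 2) → Pt) ↔
      ExactFam k u v y := by
  refine (exactFam_comp_of_line (f := fun i : Fin N => i.succ.succ)
    ((Fin.succ_injective _).comp (Fin.succ_injective _)) ?_).symm
  intro i
  refine Fin.cases (fun _ => ?_) (Fin.cases (fun _ => ?_) fun i hi => absurd ⟨i, rfl⟩ hi) i
  · simp [orient]
  · simp only [Fin.cons_succ, Fin.cons_zero, orient]
    ring

lemma pairProb_zero_one (k N : ℕ) :
    pairProb k (0 : Fin (N + 2)) 1 = ∫ u, ∫ v, edgeProb k N u v ∂unifSq ∂unifSq := by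
  have hset : (fun p : Pt × Pt × (Fin N → Pt) =>
      (Fin.cons p.1 (Fin.cons p.2.1 p.2.2 : Fin (N + 1) → Pt) : Fin (N + 2) → Pt)) ⁻¹'
      {x : Fin (N + 2) → Pt | ExactFam k (x 0) (x 1) x} =
      {p : Pt × Pt × (Fin N → Pt) | ExactFam k p.1 p.2.1 p.2.2} := by
    ext p
    exact exactFam_cons_cons
  have hm : MeasurableSet {p : Pt × Pt × (Fin N → Pt) | ExactFam k p.1 p.2.1 p.2.2} :=
    measurableSet_setOfPred.2 (measurable_exactFam k measurable_fst
      (measurable_fst.comp measurable_snd) (measurable_snd.comp measurable_snd))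
  have hi := (integrable_const (μ := unifSq.prod (unifSq.prod (conf N))) (1 : ℝ)).indicator hm
  rw [pairProb, ← (measurePreserving_cons_cons N).measureReal_preimage
    (measurableSet_exactFam_pair k 0 1).nullMeasurableSet, hset, ← integral_indicator_one hm]
  refine (integral_prod _ hi).trans (integral_congr_ae ?_)
  filter_upwards [hi.prod_right_ae] with u hu
  refine (integral_prod _ hu).trans (integral_congr_ae (Eventually.of_forall fun v => ?_))
  refine Eq.trans ?_ (integral_indicator_one (μ := conf N) (measurableSet_setOfPred.2
    (measurable_exactFam k (measurable_const (a := u)) (measurable_const (a := v)) measurable_id)))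
  rfl

open Classical in
lemma integral_ncard_usefulExactly {k : ℕ} (hk : 1 ≤ k) {N : ℕ} (hN : 1 ≤ N) :
    ∫ x : Fin (N + 2) → Pt, ((usefulExactly (range x) k).ncard : ℝ) ∂conf (N + 2) =
      (N + 2) * (N + 1) / 2 * ∫ u, ∫ v, edgeProb k N u v ∂unifSq ∂unifSq := by
  have h1 : ∫ x : Fin (N + 2) → Pt, ((usefulExactly (range x) k).ncard : ℝ) ∂conf (N + 2) =
      ∫ x, ∑ j : Fin (N + 2), ∑ i ∈ Finset.Iio j,
        {x : Fin (N + 2) → Pt | ExactFam k (x i) (x j) x}.indicator 1 x ∂conf (N + 2) := by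
    refine integral_congr_ae ?_
    filter_upwards [ae_conf_genPos (N + 2)] with x hx
    rw [ncard_usefulExactly (by omega) hx.1 hx.2 hk, ncard_eq_toFinset_card', toFinset_ofPred,
      Finset.natCast_card_filter, Fintype.sum_prod_type_right]
    refine Finset.sum_congr rfl fun j _ => ?_
    rw [← Finset.sum_subset (Finset.subset_univ (Finset.Iio j))]
    · refine Finset.sum_congr rfl fun i hi => ?_
      simp [indicator_apply, Finset.mem_Iio.1 hi]
    · intro i _ hi
      rw [if_neg fun h => hi (Finset.mem_Iio.2 h.1)]
  have h2 : ∀ j : Fin (N + 2), ∀ i ∈ Finset.Iio j, Integrable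
      ({x : Fin (N + 2) → Pt | ExactFam k (x i) (x j) x}.indicator
        (1 : (Fin (N + 2) → Pt) → ℝ)) (conf (N + 2)) :=
    fun j i _ => (integrable_const (1 : ℝ)).indicator (measurableSet_exactFam_pair k i j)
  rw [h1, integral_finsetSum _ fun j _ => integrable_finsetSum _ (h2 j)]
  have h3 : ∀ j : Fin (N + 2), ∫ x, ∑ i ∈ Finset.Iio j,
        {x : Fin (N + 2) → Pt | ExactFam k (x i) (x j) x}.indicator
          (1 : (Fin (N + 2) → Pt) → ℝ) x ∂conf (N + 2) =
      (j : ℕ) * pairProb k (0 : Fin (N + 2)) 1 := fun j => by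
    rw [integral_finsetSum _ (h2 j), ← Fin.card_Iio j, ← nsmul_eq_mul, ← Finset.sum_const]
    refine Finset.sum_congr rfl fun i hi => ?_
    rw [integral_indicator_one (measurableSet_exactFam_pair k i j)]
    exact pairProb_eq k (Finset.mem_Iio.1 hi).ne (by simp)
  rw [Finset.sum_congr rfl fun j _ => h3 j, ← Finset.sum_mul, pairProb_zero_one,
    Fin.sum_univ_eq_sum_range (fun j => (j : ℝ)), ← Nat.cast_sum]
  congr 1
  rw [eq_div_iff two_ne_zero]
  exact_mod_cast Finset.sum_range_id_mul_two (N + 2)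

end UniformPoints

open MeasureTheory Filter in
/-- For every fixed `k ≥ 1` there is a constant `d_k > 0` such that, for `n` independent
uniform points in the unit square, the expected number `E[U_k]` of useful order-`k`
(and not useful order-`i` for `i < k`) edges satisfies `E[U_k] / n → d_k`. -/
theorem expected_useful_k_edges (k : ℕ) (hk : 1 ≤ k) :
    ∃ d : ℝ, 0 < d ∧
      Tendsto
        (fun n : ℕ =>
          (∫ x : Fin n → Pt, ((usefulExactly (Set.range x) k).ncard : ℝ) ∂(conf n)) / n)
        atTop (nhds d) := by
  obtain ⟨d, hd, hlim⟩ := tendsto_mul_integral_edgeProb hk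
  refine ⟨1 / 2 * d, by positivity, ?_⟩
  rw [← tendsto_add_atTop_iff_nat 2]
  have h1 : Tendsto (fun N : ℕ => (1 + (N : ℝ)⁻¹) / 2) atTop (nhds (1 / 2)) := by
    simpa using (tendsto_inv_atTop_nhds_zero_nat (𝕜 := ℝ)).const_add 1 |>.div_const 2
  refine (h1.mul hlim).congr' ?_
  filter_upwards [eventually_ge_atTop 1] with N hN
  rw [integral_ncard_usefulExactly hk hN]
  have : (N : ℝ) ≠ 0 := by positivity
  push_cast
  field_simp

end
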